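/- arXiv:2002.12072 — 2 statements merged into one kernel-verified Lean document; each statement's English description precedes it below -/
import Mathlib

section
/- Let p be a prime with p ≡ 1 (mod 4), and let x, y be integers with p = x² + y² and x odd. Let (p/3) denote the Legendre symbol of p modulo 3. Then (3(p/3) − 2) · Σ_{k=0}^{p−1} ( C(2k,k)²/16^k ) · p/(12k + 1) ≡ (3(p/3) + 2) · Σ_{k=0}^{p−1} ( C(2k,k)²/16^k ) · p/(12k + 5) ≡ 4x² − 2p (mod p²). -/
/-- A rational number is a `p`-integer if its denominator (in lowest terms)
is not divisible by `p`. -/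
def isPInt (p : ℕ) (x : ℚ) : Prop := ¬ p ∣ x.den

/-- For `p`-integers `u, v`, `u ≡ v (mod p^k)` means `(u - v)/p^k` is a `p`-integer. -/
def pCong (p k : ℕ) (u v : ℚ) : Prop := isPInt p ((u - v) / (p : ℚ) ^ k)

/-- The Legendre symbol `(p/3)`: `1` if `p ≡ 1 (mod 3)` and `-1` if `p ≡ 2 (mod 3)`. -/
def legThree (p : ℕ) : ℚ := if p % 3 = 1 then 1 else -1

namespace ModSq

section Basic

variable {p : ℕ}

lemma natCast_mul_self : (p : ZMod (p ^ 2)) * p = 0 := by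
  rw [← Nat.cast_mul, ← sq, ZMod.natCast_self]

/-- `p` times the `k`-th harmonic number, modulo `p ^ 2`. -/
def pHarmonic (p k : ℕ) : ZMod (p ^ 2) := p * ∑ i ∈ Finset.range k, ((i + 1 : ℕ) : ZMod (p ^ 2))⁻¹

/-- The product of `i + z * p` over `1 ≤ i ≤ k`, modulo `p ^ 2`. -/
def shiftedFactorial (p k : ℕ) (z : ZMod (p ^ 2)) : ZMod (p ^ 2) :=
  ∏ i ∈ Finset.range k, (((i + 1 : ℕ) : ZMod (p ^ 2)) + z * p)

lemma pHarmonic_mul (a b : ℕ) : pHarmonic p a * pHarmonic p b = 0 := by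
  unfold pHarmonic
  linear_combination (∑ i ∈ Finset.range a, ((i + 1 : ℕ) : ZMod (p ^ 2))⁻¹) *
    (∑ i ∈ Finset.range b, ((i + 1 : ℕ) : ZMod (p ^ 2))⁻¹) * natCast_mul_self (p := p)

lemma shiftedFactorial_reflect {k : ℕ} (hk : k < p) (z : ZMod (p ^ 2)) :
    shiftedFactorial p (p - 1) z =
      shiftedFactorial p (p - 1 - k) z * ((-1) ^ k * shiftedFactorial p k (-1 - z)) := by
  unfold shiftedFactorial
  conv_lhs => rw [show p - 1 = p - 1 - k + k by omega, Finset.prod_range_add]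
  congr 1
  rw [← Finset.prod_range_reflect]
  have : ((-1 : ZMod (p ^ 2)) ^ k) = ∏ i ∈ Finset.range k, (-1) := by simp
  rw [this, ← Finset.prod_mul_distrib]
  refine Finset.prod_congr rfl fun i hi => ?_
  rw [Finset.mem_range] at hi
  have : ((p - 1 - k + (k - 1 - i) + 1 : ℕ) : ZMod (p ^ 2)) + ((i + 1 : ℕ) : ZMod (p ^ 2)) = p := by
    rw [← Nat.cast_add]; congr 1; omega
  linear_combination this

lemma prod_arith_progression {w : ZMod (p ^ 2)} (hw : 3 * w = 1) {A c d : ℕ}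
    (h : 3 * (A + 1) = c * p + d) (k : ℕ) (z : ZMod (p ^ 2)) :
    shiftedFactorial p A ((z - (c : ZMod (p ^ 2))) * w) *
      ∏ i ∈ Finset.range k, ((3 * i + d : ZMod (p ^ 2)) + z * (p : ZMod (p ^ 2))) =
    3 ^ k * shiftedFactorial p (A + k) ((z - (c : ZMod (p ^ 2))) * w) := by
  unfold shiftedFactorial
  have : (3 : ZMod (p ^ 2)) ^ k = ∏ i ∈ Finset.range k, 3 := by simp
  rw [Finset.prod_range_add, this, mul_left_comm, ← Finset.prod_mul_distrib]
  congr 1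
  refine Finset.prod_congr rfl fun i _ => ?_
  have h' : (3 : ZMod (p ^ 2)) * (A + 1) = c * p + d := by exact_mod_cast congrArg (Nat.cast) h
  push_cast
  linear_combination -h' - (z - c) * p * hw

lemma shiftedFactorial_three_mul (k : ℕ) (z : ZMod (p ^ 2)) :
    shiftedFactorial p (3 * k) z =
      (∏ i ∈ Finset.range k, ((3 * i + 1 : ZMod (p ^ 2)) + z * (p : ZMod (p ^ 2)))) *
      (∏ i ∈ Finset.range k, ((3 * i + 2 : ZMod (p ^ 2)) + z * (p : ZMod (p ^ 2)))) *
      ∏ i ∈ Finset.range k, ((3 * i + 3 : ZMod (p ^ 2)) + z * (p : ZMod (p ^ 2))) := by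
  induction k with
  | zero => simp [shiftedFactorial]
  | succ k ih =>
    unfold shiftedFactorial at *
    rw [show 3 * (k + 1) = 3 * k + 1 + 1 + 1 by ring]
    simp only [Finset.prod_range_succ, ih]
    push_cast
    ring

lemma shiftedFactorial_triple_of_mod_one {w : ZMod (p ^ 2)} (hw : 3 * w = 1) {t : ℕ}
    (ht : p = 3 * t + 1) (k : ℕ) (z : ZMod (p ^ 2)) :
    shiftedFactorial p (3 * k) z *
      (shiftedFactorial p t ((z - 1) * w) * shiftedFactorial p (2 * t) ((z - 2) * w)) =
    3 ^ (3 * k) * (shiftedFactorial p k (z * w) * shiftedFactorial p (t + k) ((z - 1) * w) *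
      shiftedFactorial p (2 * t + k) ((z - 2) * w)) := by
  have h0 := prod_arith_progression hw (A := 0) (c := 0) (d := 3) (by omega) k z
  have h1 := prod_arith_progression hw (A := t) (c := 1) (d := 2) (by omega) k z
  have h2 := prod_arith_progression hw (A := 2 * t) (c := 2) (d := 1) (by omega) k z
  rw [shiftedFactorial_three_mul]
  push_cast at h0 h1 h2
  rw [zero_add, sub_zero, show shiftedFactorial p 0 (z * w) = 1 by simp [shiftedFactorial],
    one_mul] at h0
  rw [h0]
  linear_combination (3 ^ k * shiftedFactorial p k (z * w)) *
    (h1 * shiftedFactorial p (2 * t) ((z - 2) * w) * (∏ i ∈ Finset.range k, ((3 * i + 1 :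
      ZMod (p ^ 2)) + z * (p : ZMod (p ^ 2)))) + 3 ^ k * shiftedFactorial p (t + k) ((z - 1) *
      w) * h2)

lemma shiftedFactorial_triple_of_mod_two {w : ZMod (p ^ 2)} (hw : 3 * w = 1) {t : ℕ}
    (ht : p = 3 * t + 2) (k : ℕ) (z : ZMod (p ^ 2)) :
    shiftedFactorial p (3 * k + 1) z *
      (shiftedFactorial p t ((z - 1) * w) * shiftedFactorial p (2 * t + 1) ((z - 2) * w)) =
    3 ^ (3 * k + 1) * (shiftedFactorial p k (z * w) *
      shiftedFactorial p (t + (k + 1)) ((z - 1) * w) *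
      shiftedFactorial p (2 * t + 1 + k) ((z - 2) * w)) := by
  have h0 := prod_arith_progression hw (A := 0) (c := 0) (d := 3) (by omega) k z
  have h1 := prod_arith_progression hw (A := t) (c := 1) (d := 1) (by omega) (k + 1) z
  have h2 := prod_arith_progression hw (A := 2 * t + 1) (c := 2) (d := 2) (by omega) k z
  have hs : shiftedFactorial p (3 * k + 1) z =
      shiftedFactorial p (3 * k) z * ((3 * k + 1 : ZMod (p ^ 2)) + z * p) := by
    unfold shiftedFactorial
    rw [Finset.prod_range_succ]
    push_cast
    ring
  rw [hs, shiftedFactorial_three_mul]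
  rw [Finset.prod_range_succ] at h1
  push_cast at h0 h1 h2
  rw [zero_add, sub_zero, show shiftedFactorial p 0 (z * w) = 1 by simp [shiftedFactorial],
    one_mul] at h0
  rw [h0]
  linear_combination (3 ^ k * shiftedFactorial p k (z * w)) *
    (h1 * shiftedFactorial p (2 * t + 1) ((z - 2) * w) * (∏ i ∈ Finset.range k, ((3 * i + 2 :
      ZMod (p ^ 2)) + z * (p : ZMod (p ^ 2)))) + 3 ^ (k + 1) * shiftedFactorial p (t + (k +
      1)) ((z - 1) * w) * h2)

variable [Fact p.Prime]

lemma isUnit_natCast {k : ℕ} (hk : ¬ p ∣ k) : IsUnit (k : ZMod (p ^ 2)) := by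
  rw [ZMod.isUnit_iff_coprime]
  exact Nat.Coprime.pow_right 2 ((Nat.Prime.coprime_iff_not_dvd Fact.out).2 hk).symm

lemma isUnit_natCast_of_lt {k : ℕ} (h0 : 0 < k) (hk : k < p) : IsUnit (k : ZMod (p ^ 2)) :=
  isUnit_natCast (Nat.not_dvd_of_pos_of_lt h0 hk)

lemma isUnit_factorial {k : ℕ} (hk : k < p) : IsUnit (k.factorial : ZMod (p ^ 2)) :=
  isUnit_natCast fun h => absurd ((Nat.Prime.dvd_factorial Fact.out).1 h) (by omega)

lemma shiftedFactorial_eq {k : ℕ} (hk : k < p) (z : ZMod (p ^ 2)) :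
    shiftedFactorial p k z = k.factorial * (1 + z * pHarmonic p k) := by
  induction k with
  | zero => simp [shiftedFactorial, pHarmonic]
  | succ k ih =>
    have hu : ((k + 1 : ℕ) : ZMod (p ^ 2)) * ((k + 1 : ℕ) : ZMod (p ^ 2))⁻¹ = 1 :=
      ZMod.mul_inv_of_unit _ (isUnit_natCast_of_lt k.succ_pos hk)
    have ih := ih (by omega)
    have h0 := natCast_mul_self (p := p)
    unfold shiftedFactorial pHarmonic at *
    rw [Finset.prod_range_succ, ih, Finset.sum_range_succ, Nat.factorial_succ, Nat.cast_mul]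
    generalize ((k + 1 : ℕ) : ZMod (p ^ 2))⁻¹ = c at *
    generalize ((k + 1 : ℕ) : ZMod (p ^ 2)) = b at *
    generalize (∑ i ∈ Finset.range k, ((i + 1 : ℕ) : ZMod (p ^ 2))⁻¹) = s at *
    linear_combination (k.factorial : ZMod (p ^ 2)) * z * z * s * h0 - (k.factorial :
      ZMod (p ^ 2)) * z * p * hu

lemma pHarmonic_pred (hodd : Odd p) : pHarmonic p (p - 1) = 0 := by
  have hp : 0 < p := (Fact.out : p.Prime).pos
  have h := shiftedFactorial_reflect (p := p) (k := p - 1) (by omega) 0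
  have he : Even (p - 1) := Nat.Odd.sub_odd hodd odd_one
  rw [he.neg_one_pow, Nat.sub_self] at h
  rw [shiftedFactorial_eq (by omega), shiftedFactorial_eq (by omega),
    shiftedFactorial_eq (by omega)] at h
  apply (isUnit_factorial (p := p) (k := p - 1) (by omega)).mul_left_cancel
  simp at h
  linear_combination h

lemma factorial_reflect {k : ℕ} (hk : k < p) :
    ((p - 1).factorial : ZMod (p ^ 2)) =
      (p - 1 - k).factorial * ((-1) ^ k * (k.factorial * (1 - pHarmonic p k))) := by
  have h := shiftedFactorial_reflect hk 0
  rw [shiftedFactorial_eq (by omega), shiftedFactorial_eq (by omega),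
    shiftedFactorial_eq (by omega)] at h
  linear_combination h

lemma pHarmonic_reflect (hodd : Odd p) {k : ℕ} (hk : k < p) :
    pHarmonic p (p - 1 - k) = pHarmonic p k := by
  have h := shiftedFactorial_reflect hk (-1)
  have h' := factorial_reflect hk
  rw [shiftedFactorial_eq (by omega), shiftedFactorial_eq (by omega),
    shiftedFactorial_eq (by omega), pHarmonic_pred hodd] at h
  apply (((isUnit_factorial (p := p) (k := p - 1 - k) (by omega)).mul
    (isUnit_one.neg.pow k)).mul (isUnit_factorial (p := p) (k := k) (by omega))).mul_left_cancel
  linear_combination h - h'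

end Basic

section Reduction

variable {p : ℕ} [Fact p.Prime]

/-- Reduction modulo `p` on `ZMod (p ^ 2)`. -/
def red (p : ℕ) : ZMod (p ^ 2) →+* ZMod p := ZMod.castHom (dvd_pow_self p two_ne_zero) (ZMod p)

lemma natCast_dvd_of_red_eq_zero {a : ZMod (p ^ 2)} (h : red p a = 0) :
    (p : ZMod (p ^ 2)) ∣ a := by
  have : NeZero (p ^ 2) := ⟨pow_ne_zero _ (Fact.out : p.Prime).ne_zero⟩
  rw [← ZMod.natCast_zmod_val a, map_natCast, ZMod.natCast_eq_zero_iff] at h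
  rw [← ZMod.natCast_zmod_val a]
  exact Nat.cast_dvd_cast h

lemma natCast_dvd_sub_of_red_eq {a b : ZMod (p ^ 2)} (h : red p a = red p b) :
    (p : ZMod (p ^ 2)) ∣ a - b :=
  natCast_dvd_of_red_eq_zero (by rw [map_sub, h, sub_self])

lemma isUnit_of_red_ne_zero {a : ZMod (p ^ 2)} (h : red p a ≠ 0) : IsUnit a := by
  have : NeZero (p ^ 2) := ⟨pow_ne_zero _ (Fact.out : p.Prime).ne_zero⟩
  rw [← ZMod.natCast_zmod_val a] at h ⊢
  rw [map_natCast, Ne, ZMod.natCast_eq_zero_iff] at h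
  exact isUnit_natCast h

/-- The Legendre symbol `(p / 3)` as an integer. -/
def legendreThree (p : ℕ) : ℤ := if p % 3 = 1 then 1 else -1

lemma legendreThree_sq (p : ℕ) : legendreThree p * legendreThree p = 1 := by
  unfold legendreThree
  split_ifs <;> rfl

lemma three_pow_half (hp4 : p % 4 = 1) (hp3 : p % 3 ≠ 0) :
    (3 : ZMod p) ^ (p / 2) = (legendreThree p : ZMod p) := by
  have h3 : Fact (Nat.Prime 3) := ⟨Nat.prime_three⟩
  have h := legendreSym.eq_pow p 3
  have hq := legendreSym.quadratic_reciprocity_one_mod_four (p := p) (q := 3) hp4 (by norm_num)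
  have hl : legendreSym 3 p = legendreThree p := by
    rw [legendreSym.mod]
    unfold legendreThree
    rcases (by omega : p % 3 = 1 ∨ p % 3 = 2) with h | h
    · rw [show (p : ℤ) % (3 : ℕ) = 1 by omega, if_pos h]; norm_num
    · rw [show (p : ℤ) % (3 : ℕ) = 2 by omega, if_neg (by omega)]; norm_num
  have hq' : legendreSym p 3 = legendreThree p := by rw [← hl, hq]; rfl
  rw [hq'] at h
  exact_mod_cast h.symm

lemma three_pow_pred (hodd : Odd p) {w : ZMod (p ^ 2)} (hw : 3 * w = 1) (hp3 : p % 3 ≠ 0) :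
    (3 : ZMod (p ^ 2)) ^ (p - 1) = 1 - 2 * w * pHarmonic p (p / 3) := by
  have hp : 0 < p := (Fact.out : p.Prime).pos
  have key : ∀ t, t < p → ((p - 1).factorial : ZMod (p ^ 2)) *
      (shiftedFactorial p t (-w) * shiftedFactorial p (p - 1 - t) (-2 * w)) =
      3 ^ (p - 1) * (shiftedFactorial p t 0 * shiftedFactorial p (p - 1 - t) (-w) *
        (p - 1).factorial) →
      (3 : ZMod (p ^ 2)) ^ (p - 1) = 1 - 2 * w * pHarmonic p t := by
    intro t ht h
    rw [shiftedFactorial_eq ht, shiftedFactorial_eq ht, shiftedFactorial_eq (by omega),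
      shiftedFactorial_eq (by omega), pHarmonic_reflect hodd ht] at h
    have hz := pHarmonic_mul (p := p) t t
    apply (((isUnit_factorial (p := p) (k := p - 1) (by omega)).mul
      (isUnit_factorial ht)).mul
      (isUnit_factorial (p := p) (k := p - 1 - t) (by omega))).mul_left_cancel
    generalize ((p - 1 - t).factorial : ZMod (p ^ 2)) = A at *
    generalize ((p - 1).factorial : ZMod (p ^ 2)) = B at *
    generalize (t.factorial : ZMod (p ^ 2)) = C at *
    generalize pHarmonic p t = H at *
    generalize (3 : ZMod (p ^ 2)) ^ (p - 1) = Q at *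
    linear_combination -(1 + w * H) * h + hz * (A * B * C * Q * w ^ 2 - A * B * C * w ^ 2 + 2 *
      A * B * C * w^3 * H)
  have hfac (z) : shiftedFactorial p (p - 1) z = (p - 1).factorial := by
    rw [shiftedFactorial_eq (by omega), pHarmonic_pred hodd]; ring
  rcases (by omega : p = 3 * (p / 3) + 1 ∨ p = 3 * (p / 3) + 2) with h | h
  · have h1 := shiftedFactorial_triple_of_mod_one hw h (p / 3) 0
    rw [show p / 3 + p / 3 = p - 1 - p / 3 by omega, show 2 * (p / 3) + p / 3 = p - 1 by omega,
      show 2 * (p / 3) = p - 1 - p / 3 by omega, show 3 * (p / 3) = p - 1 by omega, hfac,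
        hfac] at h1
    refine key _ (by omega) ?_
    convert h1 using 3 <;> ring_nf
  · have h1 := shiftedFactorial_triple_of_mod_two hw h (p / 3) 0
    rw [show p / 3 + (p / 3 + 1) = p - 1 - p / 3 by omega,
      show 2 * (p / 3) + 1 + p / 3 = p - 1 by omega,
      show 2 * (p / 3) + 1 = p - 1 - p / 3 by omega, show 3 * (p / 3) + 1 = p - 1 by omega,
      hfac, hfac] at h1
    refine key _ (by omega) ?_
    convert h1 using 3 <;> ring_nf

lemma three_pow_half_sq (hp4 : p % 4 = 1) {w : ZMod (p ^ 2)} (hw : 3 * w = 1) (hp3 : p % 3 ≠ 0) :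
    (3 : ZMod (p ^ 2)) ^ (p / 2) =
      (legendreThree p : ZMod (p ^ 2)) * (1 - w * pHarmonic p (p / 3)) := by
  have hp : 2 ≤ p := (Fact.out : p.Prime).two_le
  have hodd : Odd p := Nat.odd_iff.2 (by omega)
  have h1 := three_pow_pred hodd hw hp3
  obtain ⟨y, hy⟩ : (p : ZMod (p ^ 2)) ∣ 3 ^ (p / 2) - (legendreThree p : ZMod (p ^ 2)) := by
    apply natCast_dvd_sub_of_red_eq
    rw [map_pow, map_intCast, ← three_pow_half hp4 hp3, map_ofNat]
  rw [show p - 1 = p / 2 + p / 2 by omega, pow_add] at h1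
  have hl : (legendreThree p : ZMod (p ^ 2)) * legendreThree p = 1 := by
    rw [← Int.cast_mul, legendreThree_sq, Int.cast_one]
  have h0 := natCast_mul_self (p := p)
  apply (isUnit_natCast_of_lt (p := p) (k := 2) (by norm_num) (by omega)).mul_left_cancel
  generalize (3 : ZMod (p ^ 2)) ^ (p / 2) = Q at *
  generalize (legendreThree p : ZMod (p ^ 2)) = l at *
  obtain rfl : Q = l + p * y := by linear_combination hy
  push_cast
  linear_combination l * h1 - l * y * y * h0 - (l + 2 * p * y) * hl

end Reduction

section Triplication

variable {p : ℕ}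

lemma harmonic_relation {R : Type*} [CommRing R] {π w U V hA hB hM hT : R} (h0 : π * π = 0)
    (hw : 3 * w = 1) (hU : IsUnit U) (hV : IsUnit V)
    (e0 : U * ((1 - w * (π * hT)) * (1 - 2 * w * (π * hT))) =
      V * ((1 - w * (π * hB)) * (1 - 2 * w * (π * hM))))
    (e1 : U * ((1 + π * hM) * (1 - w * (π * hT))) =
      V * ((1 + w * (π * hA)) * (1 - w * (π * hM)))) :
    π * hA + π * hB = 2 * (π * hM) + 2 * (π * hT) := by
  apply (hU.mul hV).mul_left_cancel
  have h : (U * V) * (((1 + π * hM) * (1 - w * (π * hT))) *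
        ((1 - w * (π * hB)) * (1 - 2 * w * (π * hM)))) =
      (U * V) * (((1 + w * (π * hA)) * (1 - w * (π * hM))) *
        ((1 - w * (π * hT)) * (1 - 2 * w * (π * hT)))) := by
    linear_combination V * ((1 - w * (π * hB)) * (1 - 2 * w * (π * hM))) * e1 -
      V * ((1 + w * (π * hA)) * (1 - w * (π * hM))) * e0
  generalize U * V = W at *
  clear e0 e1 hU hV
  grind

lemma triplication [Fact p.Prime] (hp4 : p % 4 = 1) (hp3 : p % 3 ≠ 0)
    {w : ZMod (p ^ 2)} (hw : 3 * w = 1) (z : ZMod (p ^ 2)) :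
    shiftedFactorial p (p / 4) z * (shiftedFactorial p (p / 3) ((z - 1) * w) *
        shiftedFactorial p (p - 1 - p / 3) ((z - 2) * w)) =
      3 ^ (p / 4) * (shiftedFactorial p (p / 12) (z * w) *
        shiftedFactorial p (p / 2 - p / 12) ((z - 1) * w) *
        shiftedFactorial p (p - 1 - p / 4) ((z - 2) * w)) := by
  rcases (by omega : p % 3 = 1 ∨ p % 3 = 2) with h | h
  · have := shiftedFactorial_triple_of_mod_one hw (t := p / 3) (by omega) (p / 12) z
    rwa [show p - 1 - p / 3 = 2 * (p / 3) by omega, show p / 2 - p / 12 = p / 3 + p / 12 by omega,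
      show p - 1 - p / 4 = 2 * (p / 3) + p / 12 by omega, show p / 4 = 3 * (p / 12) by omega]
  · have := shiftedFactorial_triple_of_mod_two hw (t := p / 3) (by omega) (p / 12) z
    rwa [show p - 1 - p / 3 = 2 * (p / 3) + 1 by omega,
      show p / 2 - p / 12 = p / 3 + (p / 12 + 1) by omega,
      show p - 1 - p / 4 = 2 * (p / 3) + 1 + p / 12 by omega,
      show p / 4 = 3 * (p / 12) + 1 by omega]

lemma fourth_power_relation {R : Type*} [CommRing R] {π w v l q A B M M' T T' P σ τ hA hB hM hT : R}
    (h0 : π * π = 0) (hw : 3 * w = 1) (hv : 4 * v = w)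
    (hP : IsUnit P) (hl : l * l = 1) (hσ : σ * σ = 1) (hτ : τ * τ = 1)
    (hq : q * q = l * (1 - w * (π * hT)))
    (hPM : P = M' * (σ * (M * (1 - π * hM)))) (hPT : P = T' * (τ * (T * (1 - π * hT))))
    (e0 : M * (T * T') * ((1 - w * (π * hT)) * (1 - 2 * w * (π * hT))) =
      q * (A * B * M') * ((1 - w * (π * hB)) * (1 - 2 * w * (π * hM))))
    (hlin : π * hA + π * hB = 2 * (π * hM) + 2 * (π * hT)) :
    l * M ^ 4 * (1 + 2 * v * (5 * (π * hB) + π * hA)) = (A * B) ^ 2 * (1 + π * hM) := by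
  have hTT : T * T' = P * τ * (1 + π * hT) := by
    linear_combination -(τ * (1 + π * hT)) * hPT - T * T' * (1 - (π * hT) ^ 2) * hτ +
      T * T' * hT ^ 2 * h0
  have hMM : M * M' = P * σ * (1 + π * hM) := by
    linear_combination -(σ * (1 + π * hM)) * hPM - M * M' * (1 - (π * hM) ^ 2) * hσ +
      M * M' * hM ^ 2 * h0
  have h1 : P * (M ^ 2 * τ * ((1 + π * hT) * ((1 - w * (π * hT)) * (1 - 2 * w * (π * hT))))) =
      P * (q * (A * B) * σ * ((1 + π * hM) * ((1 - w * (π * hB)) * (1 - 2 * w * (π * hM))))) := by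
    linear_combination M * e0 - M ^ 2 * ((1 - w * (π * hT)) * (1 - 2 * w * (π * hT))) * hTT +
      q * (A * B) * ((1 - w * (π * hB)) * (1 - 2 * w * (π * hM))) * hMM
  have h2 := hP.mul_left_cancel h1
  have h3 : M ^ 2 * τ = q * (A * B) * σ * (1 + w * (π * hM - π * hB)) := by
    clear hTT hMM h1 e0 hPM hPT hq
    grind
  have h4 : M ^ 4 = l * (A * B) ^ 2 *
      ((1 - w * (π * hT)) * ((1 + w * (π * hM - π * hB)) * (1 + w * (π * hM - π * hB)))) := by
    linear_combination (M ^ 2 * τ + q * (A * B) * σ * (1 + w * (π * hM - π * hB))) * h3 -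
      M ^ 4 * hτ + (q * (A * B) * (1 + w * (π * hM - π * hB))) ^ 2 * hσ +
      ((A * B) * (1 + w * (π * hM - π * hB))) ^ 2 * hq
  rw [h4]
  have hc : (1 - w * (π * hT)) * ((1 + w * (π * hM - π * hB)) * (1 + w * (π * hM - π * hB))) *
      (1 + 2 * v * (5 * (π * hB) + π * hA)) = 1 + π * hM := by
    clear hTT hMM h1 e0 hPM hPT hq h3 h4 h2
    grind
  linear_combination (A * B) ^ 2 * (l * l) * hc + (A * B) ^ 2 * (1 + π * hM) * hl

lemma factorial_quarter_pow_four [Fact p.Prime] (hp4 : p % 4 = 1) (hp3 : p % 3 ≠ 0)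
    {v : ZMod (p ^ 2)} (hv : 12 * v = 1) :
    (legendreThree p : ZMod (p ^ 2)) * ((p / 4).factorial : ZMod (p ^ 2)) ^ 4 *
        (1 + 2 * v * (5 * pHarmonic p (p / 2 - p / 12) + pHarmonic p (p / 12))) =
      ((p / 12).factorial * (p / 2 - p / 12).factorial : ZMod (p ^ 2)) ^ 2 *
        (1 + pHarmonic p (p / 4)) := by
  have hp : 0 < p := (Fact.out : p.Prime).pos
  have hodd : Odd p := Nat.odd_iff.2 (by omega)
  have hw : (3 : ZMod (p ^ 2)) * (4 * v) = 1 := by linear_combination hv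
  have e0 := triplication hp4 hp3 hw 0
  have e1 := triplication hp4 hp3 hw 1
  have hq := three_pow_half_sq hp4 hw hp3
  rw [show p / 2 = p / 4 + p / 4 by omega, pow_add] at hq
  have hPM := factorial_reflect (p := p) (k := p / 4) (by omega)
  have hPT := factorial_reflect (p := p) (k := p / 3) (by omega)
  have hsq (k : ℕ) : (-1 : ZMod (p ^ 2)) ^ k * (-1) ^ k = 1 := by rw [← mul_pow]; simp
  have hl : (legendreThree p : ZMod (p ^ 2)) * legendreThree p = 1 := by
    rw [← Int.cast_mul, legendreThree_sq, Int.cast_one]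
  have h3 : IsUnit ((3 : ZMod (p ^ 2)) ^ (p / 4)) := (IsUnit.of_mul_eq_one _ hw).pow _
  have hM := pHarmonic_reflect hodd (k := p / 4) (by omega)
  have hT := pHarmonic_reflect hodd (k := p / 3) (by omega)
  have u1 := isUnit_factorial (p := p) (k := p / 4) (by omega)
  have u2 := isUnit_factorial (p := p) (k := p / 3) (by omega)
  have u3 := isUnit_factorial (p := p) (k := p - 1 - p / 4) (by omega)
  have u4 := isUnit_factorial (p := p) (k := p - 1 - p / 3) (by omega)
  have u5 := isUnit_factorial (p := p) (k := p / 12) (by omega)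
  have u6 := isUnit_factorial (p := p) (k := p / 2 - p / 12) (by omega)
  have u7 := isUnit_factorial (p := p) (k := p - 1) (by omega)
  rw [shiftedFactorial_eq (by omega), shiftedFactorial_eq (by omega),
    shiftedFactorial_eq (by omega), shiftedFactorial_eq (by omega),
    shiftedFactorial_eq (by omega), shiftedFactorial_eq (by omega), hM, hT] at e0 e1
  obtain ⟨S, hS⟩ : ∃ S : ℕ → ZMod (p ^ 2), ∀ k, pHarmonic p k = (p : ZMod (p ^ 2)) * S k := ⟨_,
    fun _ => rfl⟩
  simp only [hS] at e0 e1 hq hPM hPT ⊢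
  have hlin := harmonic_relation (hA := S (p / 12)) (hB := S (p / 2 - p / 12))
    (hM := S (p / 4)) (hT := S (p / 3)) natCast_mul_self hw (u1.mul (u2.mul u4))
    (h3.mul ((u5.mul u6).mul u3)) (by linear_combination e0) (by linear_combination e1)
  exact fourth_power_relation natCast_mul_self hw rfl u7 hl (hsq _) (hsq _) hq hPM hPT
    (by linear_combination e0) hlin

end Triplication

section Teichmuller

variable {p : ℕ} [Fact p.Prime]

lemma pow_eq_pow_of_red_eq {a b : ZMod (p ^ 2)} (h : red p a = red p b) : a ^ p = b ^ p := by
  have := dvd_sub_pow_of_dvd_sub (natCast_dvd_sub_of_red_eq h) 1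
  rw [pow_one, show 1 + 1 = 2 from rfl, ← Nat.cast_pow, ZMod.natCast_self, zero_dvd_iff] at this
  exact sub_eq_zero.1 this

lemma red_val (t : ZMod p) : red p (t.val : ZMod (p ^ 2)) = t := by simp

/-- The Teichmüller lift from `ZMod p` to `ZMod (p ^ 2)`. -/
def teichmuller (p : ℕ) [Fact p.Prime] : ZMod p →* ZMod (p ^ 2) where
  toFun t := (t.val : ZMod (p ^ 2)) ^ p
  map_one' := (pow_eq_pow_of_red_eq (b := (1 : ZMod (p ^ 2)))
    (by rw [red_val, map_one])).trans (one_pow p)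
  map_mul' s t := by
    rw [← mul_pow]
    exact pow_eq_pow_of_red_eq (by rw [map_mul, red_val, red_val, red_val])

lemma teichmuller_red (x : ZMod (p ^ 2)) : teichmuller p (red p x) = x ^ p :=
  pow_eq_pow_of_red_eq (a := ((red p x).val : ZMod (p ^ 2))) (red_val _)

lemma red_teichmuller (t : ZMod p) : red p (teichmuller p t) = t := by
  show red p ((t.val : ZMod (p ^ 2)) ^ p) = t
  rw [map_pow, red_val, ZMod.pow_card]

lemma teichmuller_zero : teichmuller p 0 = 0 := by
  rw [← map_zero (red p), teichmuller_red, zero_pow (Fact.out : p.Prime).ne_zero]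

lemma teichmuller_one_sub (t : ZMod p) :
    teichmuller p (1 - t) = (1 - teichmuller p t) ^ p := by
  rw [← teichmuller_red, map_sub (red p), map_one, red_teichmuller]

lemma sum_teichmuller_pow {g : (ZMod p)ˣ} (hg : ∀ x, x ∈ Subgroup.zpowers g) {k : ℕ}
    (hk : 0 < k) : ∑ t, teichmuller p t ^ k = if p - 1 ∣ k then (p : ZMod (p ^ 2)) - 1 else 0 := by
  split_ifs with h
  · obtain ⟨c, rfl⟩ := h
    have : ∀ t, teichmuller p t ^ ((p - 1) * c) = if t = 0 then 0 else 1 := by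
      intro t
      split_ifs with ht
      · rw [ht, teichmuller_zero, zero_pow hk.ne']
      · rw [pow_mul, ← map_pow, ZMod.pow_card_sub_one_eq_one ht, map_one, one_pow]
    simp only [this]
    rw [Finset.sum_ite, Finset.sum_const_zero, zero_add, Finset.sum_const, nsmul_one,
      Finset.filter_not, Finset.filter_eq', if_pos (Finset.mem_univ _),
      Finset.card_sdiff_of_subset (Finset.subset_univ _), Finset.card_singleton, Finset.card_univ,
      ZMod.card, Nat.cast_sub (Fact.out : p.Prime).one_le, Nat.cast_one]
  · have hs : teichmuller p g ^ k * ∑ t, teichmuller p t ^ k = ∑ t, teichmuller p t ^ k := by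
      rw [Finset.mul_sum]
      exact Fintype.sum_equiv (Units.mulLeft g) _ _ fun t => by
        rw [Units.mulLeft_apply, map_mul, mul_pow]
    have hu : IsUnit (teichmuller p (g : ZMod p) ^ k - 1) := by
      apply isUnit_of_red_ne_zero
      rw [map_sub, map_one, map_pow, red_teichmuller, sub_ne_zero]
      intro h1
      have h2 : g ^ k = 1 := Units.ext (by rw [Units.val_pow_eq_pow_val, h1, Units.val_one])
      apply h
      have := orderOf_dvd_of_pow_eq_one h2
      rwa [orderOf_eq_card_of_forall_mem_zpowers hg, Nat.card_eq_fintype_card,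
        ZMod.card_units] at this
    apply hu.mul_left_cancel
    linear_combination hs

lemma sum_teichmuller_mul_one_sub_pow (a n : ℕ) :
    ∑ t, teichmuller p t ^ a * (1 - teichmuller p t) ^ n =
      ∑ j ∈ Finset.range (n + 1), (-1) ^ j * (n.choose j : ZMod (p ^ 2)) *
        ∑ t, teichmuller p t ^ (a + j) := by
  simp only [Finset.mul_sum]
  rw [Finset.sum_comm]
  refine Finset.sum_congr rfl fun t _ => ?_
  rw [sub_eq_neg_add, add_pow, Finset.mul_sum]
  refine Finset.sum_congr rfl fun j _ => ?_
  rw [neg_pow, one_pow, pow_add]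
  ring

lemma one_add_pow_of_sq_eq_zero {R : Type*} [CommRing R] {e : R} (h : e * e = 0) (k : ℕ) :
    (1 + e) ^ k = 1 + k * e := by
  induction k with
  | zero => simp
  | succ k ih =>
    rw [pow_succ, ih]
    push_cast
    linear_combination k * h

lemma mul_eq_zero_of_natCast_dvd {p : ℕ} {a b : ZMod (p ^ 2)} (ha : (p : ZMod (p ^ 2)) ∣ a)
    (hb : (p : ZMod (p ^ 2)) ∣ b) : a * b = 0 := by
  obtain ⟨c, rfl⟩ := ha
  obtain ⟨d, rfl⟩ := hb
  linear_combination c * d * natCast_mul_self (p := p)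

lemma pow_mul_prime {m : ℕ} (hm : p = 4 * m + 1) (x : ZMod (p ^ 2)) (hx : IsUnit x ∨ x = 0) :
    x ^ (2 * m * p) = (1 - 2 * (m : ZMod (p ^ 2))) * x ^ (2 * m) +
      2 * (m : ZMod (p ^ 2)) * x ^ (6 * m) := by
  have hm0 : m ≠ 0 := fun h => by
    have := (Fact.out : p.Prime).one_lt
    omega
  rcases hx with hx | rfl
  · have hr : red p x ≠ 0 := (hx.map (red p)).ne_zero
    have he : (p : ZMod (p ^ 2)) ∣ x ^ (4 * m) - 1 := by
      apply natCast_dvd_of_red_eq_zero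
      rw [map_sub, map_one, map_pow, show 4 * m = p - 1 by omega,
        ZMod.pow_card_sub_one_eq_one hr, sub_self]
    have h := one_add_pow_of_sq_eq_zero (mul_eq_zero_of_natCast_dvd he he) (2 * m)
    rw [add_sub_cancel, ← pow_mul] at h
    rw [show 2 * m * p = 2 * m + 4 * m * (2 * m) by subst hm; ring, pow_add, h,
      show 6 * m = 2 * m + 4 * m by ring, pow_add]
    push_cast
    ring
  · simp [hm0, hm]

lemma sum_teichmuller_pow_mul {m : ℕ} (hm : p = 4 * m + 1) {g : (ZMod p)ˣ}
    (hg : ∀ x, x ∈ Subgroup.zpowers g) :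
    ∑ t, teichmuller p t ^ (3 * m) * teichmuller p (1 - t) ^ (2 * m) =
      ((p : ZMod (p ^ 2)) - 1) * (-1) ^ m * ((1 - 2 * (m : ZMod (p ^ 2))) * ((2 * m).choose m :
        ZMod (p ^ 2)) +
        4 * (m : ZMod (p ^ 2)) * ((6 * m).choose m : ZMod (p ^ 2))) := by
  have hm0 : 0 < m := by
    have := (Fact.out : p.Prime).one_lt
    omega
  have h1 : ∀ t : ZMod p, teichmuller p t ^ (3 * m) * teichmuller p (1 - t) ^ (2 * m) =
      (1 - 2 * (m : ZMod (p ^ 2))) * (teichmuller p t ^ (3 * m) * (1 - teichmuller p t) ^ (2 * m)) +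
      2 * (m : ZMod (p ^ 2)) * (teichmuller p t ^ (3 * m) * (1 - teichmuller p t) ^ (6 * m)) := by
    intro t
    have hx : IsUnit (1 - teichmuller p t) ∨ 1 - teichmuller p t = 0 := by
      by_cases ht : t = 1
      · right; rw [ht, map_one, sub_self]
      · left
        apply isUnit_of_red_ne_zero
        rw [map_sub, map_one, red_teichmuller, sub_ne_zero]
        exact Ne.symm ht
    rw [teichmuller_one_sub, ← pow_mul, mul_comm p, pow_mul_prime hm _ hx]
    ring
  have hS : ∀ j, ∑ t, teichmuller p t ^ (3 * m + j) =
      if 4 * m ∣ 3 * m + j then (p : ZMod (p ^ 2)) - 1 else 0 := fun j => by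
    rw [sum_teichmuller_pow hg (by omega), show p - 1 = 4 * m by omega]
  have hd : ∀ j, 4 * m ∣ 3 * m + j → j ≤ 6 * m → j = m ∨ j = 5 * m := by
    rintro j ⟨c, hc⟩ hj
    have : c < 3 := by by_contra!; nlinarith
    interval_cases c <;> omega
  have h2 : ∑ t, teichmuller p t ^ (3 * m) * (1 - teichmuller p t) ^ (2 * m) =
      (-1) ^ m * ((2 * m).choose m : ZMod (p ^ 2)) * ((p : ZMod (p ^ 2)) - 1) := by
    rw [sum_teichmuller_mul_one_sub_pow, Finset.sum_eq_single m]
    · rw [hS, if_pos ⟨1, by ring⟩]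
    · intro j hj hjm
      rw [Finset.mem_range] at hj
      rw [hS, if_neg, mul_zero]
      intro h
      rcases hd j h (by omega) with h | h <;> omega
    · intro h; exact absurd (Finset.mem_range.2 (by omega)) h
  have h3 : ∑ t, teichmuller p t ^ (3 * m) * (1 - teichmuller p t) ^ (6 * m) =
      (-1) ^ m * (2 * ((6 * m).choose m : ZMod (p ^ 2))) * ((p : ZMod (p ^ 2)) - 1) := by
    rw [sum_teichmuller_mul_one_sub_pow, Finset.sum_eq_add m (5 * m) (by omega)]
    · rw [hS, hS, if_pos ⟨1, by ring⟩, if_pos ⟨2, by ring⟩,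
        Nat.choose_symm_of_eq_add (show 6 * m = 5 * m + m by ring),
        show 5 * m = m + 2 * (2 * m) by ring, pow_add, pow_mul (-1 : ZMod (p ^ 2)) 2]
      simp
      ring
    · rintro j hj ⟨hjm, hjm'⟩
      rw [Finset.mem_range] at hj
      rw [hS, if_neg, mul_zero]
      intro h
      rcases hd j h (by omega) with h | h <;> omega
    · intro h; exact absurd (Finset.mem_range.2 (by omega)) h
    · intro h; exact absurd (Finset.mem_range.2 (by omega)) h
  simp only [h1]
  rw [Finset.sum_add_distrib, ← Finset.mul_sum, ← Finset.mul_sum, h2, h3]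
  ring

end Teichmuller

section JacobiSum

variable {p : ℕ} [Fact p.Prime]

lemma jacobi_relation {R : Type*} [CommRing R] {π m M N C D U P ε hM hN : R}
    (h0 : π * π = 0) (hm : 4 * m + 1 = π) (h4 : IsUnit (4 : R)) (h2 : IsUnit (2 * m + π))
    (hε : ε * ε = 1) (hC : M ^ 2 * C = N)
    (hD : (2 * m + π) * (1 + π * hM) * (M ^ 2 * D) = N * (1 + π * hN) * (m + π))
    (hP : P = N * (N * (1 - π * hN)))
    (hU : U = (π - 1) * ε * ((1 - 2 * m) * C + 4 * m * D)) :
    U ^ 2 * M ^ 4 = P * (1 + π * hM) := by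
  have hD' : (2 * m + π) * (M ^ 2 * D) = N * (1 + π * hN) * (m + π) * (1 - π * hM) := by
    linear_combination (1 - π * hM) * hD + hM ^ 2 * (2 * m + π) * (M ^ 2 * D) * h0
  have h1 : (2 * m + π) * (2 * (M ^ 2 * U)) = (2 * m + π) * (-ε * N * (2 - π * hN + π * hM)) := by
    apply (h4.mul h4).mul_left_cancel
    rw [hU]
    have h6 : 16 * (2 * (π - 1) * ((2 * m + π) * (1 - 2 * m) + 4 * m * ((1 + π * hN) * (m + π) *
        (1 - π * hM)))) = 16 * ((2 * m + π) * -(2 - π * hN + π * hM)) := by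
      clear hP h2 h4 hε hU hC hD hD'
      grind
    linear_combination 32 * (π - 1) * ε * ((2 * m + π) * (1 - 2 * m) * hC + 4 * m * hD') +
      ε * N * h6
  have h5 := h2.mul_left_cancel h1
  apply h4.mul_left_cancel
  rw [hP]
  linear_combination (2 * (M ^ 2 * U) - ε * N * (2 - π * hN + π * hM)) * h5 +
    (N * (2 - π * hN + π * hM)) ^ 2 * hε + N ^ 2 * (hM + hN) ^ 2 * h0

lemma sq_eq_sq_of_sq_add_sq_eq_prime {x y a b : ℤ} (hxy : (p : ℤ) = x ^ 2 + y ^ 2)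
    (hab : (p : ℤ) = a ^ 2 + b ^ 2) (hp4 : p % 4 = 1) (hx : Odd x) (ha : Odd a) :
    x ^ 2 = a ^ 2 := by
  have hpp : Prime (p : ℤ) := Nat.prime_iff_prime_int.1 Fact.out
  have key : ∀ b : ℤ, (p : ℤ) = a ^ 2 + b ^ 2 → (p : ℤ) ∣ x * b - y * a → x ^ 2 = a ^ 2 := by
    intro b hab ⟨c, hc⟩
    have hb : Even b := by
      by_contra hb
      rw [Int.not_even_iff_odd] at hb
      have := (ha.pow (n := 2)).add_odd (hb.pow (n := 2))
      rw [← hab] at this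
      obtain ⟨k, hk⟩ := this
      omega
    have hy : Even y := by
      by_contra hb
      rw [Int.not_even_iff_odd] at hb
      have := (hx.pow (n := 2)).add_odd (hb.pow (n := 2))
      rw [← hxy] at this
      obtain ⟨k, hk⟩ := this
      omega
    have hodd : Odd (x * a + y * b) := (hx.mul ha).add_even (hy.mul_right b)
    have hne : x * a + y * b ≠ 0 := fun h => by rw [h] at hodd; exact absurd hodd (by decide)
    have h1 : (x * a + y * b) ^ 2 + (p * c) ^ 2 = (p : ℤ) ^ 2 := by
      rw [← hc]
      linear_combination -(a ^ 2 + b ^ 2) * hxy - p * hab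
    have hp0 : (0 : ℤ) < p := by exact_mod_cast (Fact.out : p.Prime).pos
    have hc0 : c = 0 := by
      by_contra hc0
      have : 1 ≤ c ^ 2 := by have := sq_pos_of_ne_zero hc0 ; omega
      have h2 : 0 < (x * a + y * b) ^ 2 := by positivity
      nlinarith [mul_le_mul_of_nonneg_left this (sq_nonneg (p : ℤ))]
    rw [hc0, mul_zero] at hc
    have : (p : ℤ) * (x ^ 2 - a ^ 2) = 0 := by
      linear_combination x ^ 2 * hab - a ^ 2 * hxy + (x * b + y * a) * hc
    rcases mul_eq_zero.1 this with h | h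
    · exact absurd h hp0.ne'
    · exact sub_eq_zero.1 h
  have : (p : ℤ) ∣ (x * b - y * a) * (x * b + y * a) :=
    ⟨x ^ 2 - a ^ 2, by linear_combination a ^ 2 * hxy - x ^ 2 * hab⟩
  rcases hpp.dvd_or_dvd this with h | h
  · exact key b hab h
  · exact key (-b) (by rw [neg_sq, hab]) ⟨-h.choose, by linear_combination -h.choose_spec⟩

lemma cast_sq_sub_eq_sq {p : ℕ} {a b x I : ZMod (p ^ 2)} (hI : I * I = -1)
    (hab : (p : ZMod (p ^ 2)) = a ^ 2 + b ^ 2)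
    (hx : x ^ 2 = a ^ 2) (hU : IsUnit (a + b * I)) :
    4 * x ^ 2 - 2 * (p : ZMod (p ^ 2)) = (a + b * I) ^ 2 := by
  have h1 : (a + b * I) * (a - b * I) = p := by rw [hab]; linear_combination -b ^ 2 * hI
  have h2 : (a - b * I) ^ 2 = 0 := by
    apply (hU.pow 2).mul_left_cancel
    rw [mul_zero, ← mul_pow, h1]
    exact (sq _).trans natCast_mul_self
  linear_combination 4 * hx + h2 + 2 * h1

lemma exists_jacobiSum_quartic (hp4 : p % 4 = 1) {g : (ZMod p)ˣ}
    (hg : ∀ x, x ∈ Subgroup.zpowers g) : ∃ (χ : MulChar (ZMod p) GaussianInt),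
      χ g = ⟨0, 1⟩ ∧ Odd (jacobiSum (χ ^ 3) (χ ^ 2)).re ∧
      (jacobiSum (χ ^ 3) (χ ^ 2)).re ^ 2 + (jacobiSum (χ ^ 3) (χ ^ 2)).im ^ 2 = (p : ℤ) := by
  let i : GaussianIntˣ := ⟨⟨0, 1⟩, ⟨0, -1⟩, by decide, by decide⟩
  have hi : i ^ 4 = 1 := by decide
  have hi' : i ∈ rootsOfUnity (Fintype.card (ZMod p)ˣ) GaussianInt := by
    rw [mem_rootsOfUnity, ZMod.card_units, show p - 1 = 4 * (p / 4) by omega, pow_mul, hi, one_pow]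
  let χ := MulChar.ofRootOfUnity hi' hg
  have hχ : χ g = ⟨0, 1⟩ := MulChar.ofRootOfUnity_spec hi' hg
  have hχ4 : χ ^ 4 = 1 := by
    refine (MulChar.eq_iff hg _ _).2 ?_
    rw [MulChar.pow_apply' _ (by norm_num), hχ, MulChar.one_apply g.isUnit]
    decide
  have h3 : χ ^ 3 ≠ 1 := fun h => by
    have := congrArg (fun f => f (g : ZMod p)) h
    simp only [MulChar.pow_apply' _ (show 3 ≠ 0 by norm_num), hχ,
      MulChar.one_apply g.isUnit] at this
    revert this; decide
  have h2 : χ ^ 2 ≠ 1 := fun h => by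
    have := congrArg (fun f => f (g : ZMod p)) h
    simp only [MulChar.pow_apply' _ (show 2 ≠ 0 by norm_num), hχ,
      MulChar.one_apply g.isUnit] at this
    revert this; decide
  have h5 : χ ^ 3 * χ ^ 2 ≠ 1 := fun h => by
    rw [← pow_add] at h
    have := congrArg (fun f => f (g : ZMod p)) h
    simp only [MulChar.pow_apply' _ (show 3 + 2 ≠ 0 by norm_num), hχ,
      MulChar.one_apply g.isUnit] at this
    revert this; decide
  refine ⟨χ, hχ, ?_, ?_⟩
  · have hprim : IsPrimitiveRoot (⟨0, 1⟩ : GaussianInt) 4 :=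
      (IsPrimitiveRoot.iff (by norm_num)).2 ⟨by decide, fun l h0 hl => by
        interval_cases l <;> decide⟩
    obtain ⟨z, -, hz⟩ := exists_jacobiSum_eq_neg_one_add (n := 4) (by norm_num)
      (χ := χ ^ 3) (ψ := χ ^ 2)
      (by rw [← pow_mul, mul_comm, pow_mul, hχ4, one_pow])
      (by rw [← pow_mul, mul_comm, pow_mul, hχ4, one_pow])
      (by rw [ZMod.card]; omega) hprim
    rw [hz]
    refine ⟨z.im - 1, ?_⟩
    simp [sq]
    ring
  · set J := jacobiSum (χ ^ 3) (χ ^ 2)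
    have inj := GaussianInt.toComplex_injective
    have key := jacobiSum_mul_jacobiSum_inv (F := ZMod p) (F' := ℂ)
      (by
        rw [ringChar.eq_zero, ZMod.ringChar_zmod_n]
        exact (Fact.out : p.Prime).ne_zero.symm)
      (χ := (χ ^ 3).ringHomComp GaussianInt.toComplex)
      (φ := (χ ^ 2).ringHomComp GaussianInt.toComplex)
      ((MulChar.ringHomComp_ne_one_iff inj).2 h3) ((MulChar.ringHomComp_ne_one_iff inj).2 h2)
      (by rw [← MulChar.ringHomComp_mul]; exact (MulChar.ringHomComp_ne_one_iff inj).2 h5)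
    have hstar : jacobiSum ((χ ^ 3).ringHomComp GaussianInt.toComplex)⁻¹
        ((χ ^ 2).ringHomComp GaussianInt.toComplex)⁻¹ =
        star (jacobiSum ((χ ^ 3).ringHomComp GaussianInt.toComplex)
        ((χ ^ 2).ringHomComp GaussianInt.toComplex)) := by
      unfold jacobiSum
      rw [star_sum]
      refine Finset.sum_congr rfl fun t _ => ?_
      rw [star_mul', MulChar.star_apply', MulChar.star_apply']
    rw [hstar, jacobiSum_ringHomComp, ZMod.card] at key
    have hn : (J.norm : ℂ) = p := by
      rw [GaussianInt.intCast_complex_norm, ← Complex.mul_conj]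
      exact key
    have hn' : J.norm = p := by exact_mod_cast hn
    rw [← hn', Zsqrtd.norm_def]
    ring

lemma jacobiSum_quartic_map {m : ℕ} (hm : p = 4 * m + 1) {g : (ZMod p)ˣ}
    (hg : ∀ x, x ∈ Subgroup.zpowers g) {χ : MulChar (ZMod p) GaussianInt}
    (hχ : χ g = ⟨0, 1⟩) : ∃ I : ZMod (p ^ 2), I * I = -1 ∧
      ((jacobiSum (χ ^ 3) (χ ^ 2)).re : ZMod (p ^ 2)) + ((jacobiSum (χ ^ 3) (χ ^ 2)).im :
        ZMod (p ^ 2)) * I =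
      ∑ t, teichmuller p t ^ (3 * m) * teichmuller p (1 - t) ^ (2 * m) := by
  have hp1 := (Fact.out : p.Prime).one_lt
  have hg1 : g ^ (2 * m) = -1 := by
    have hsq : (g : ZMod p) ^ (2 * m) * g ^ (2 * m) = 1 := by
      rw [← pow_add, show 2 * m + 2 * m = p - 1 by omega, ZMod.pow_card_sub_one_eq_one g.ne_zero]
    rcases mul_self_eq_one_iff.1 hsq with h | h
    · exfalso
      have h' : g ^ (2 * m) = 1 := Units.ext (by rw [Units.val_pow_eq_pow_val, h, Units.val_one])
      have := orderOf_dvd_of_pow_eq_one h'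
      rw [orderOf_eq_card_of_forall_mem_zpowers hg, Nat.card_eq_fintype_card,
        ZMod.card_units] at this
      have := Nat.le_of_dvd (by omega) this
      omega
    · exact Units.ext (by rw [Units.val_pow_eq_pow_val, h, Units.val_neg, Units.val_one])
  have hodd : Odd p := ⟨2 * m, by omega⟩
  have hI : teichmuller p (g : ZMod p) ^ m * teichmuller p (g : ZMod p) ^ m = -1 := by
    rw [← pow_add, ← two_mul, ← map_pow, ← Units.val_pow_eq_pow_val, hg1, Units.val_neg,
      Units.val_one, ← map_one (red p), ← map_neg, teichmuller_red, hodd.neg_one_pow]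
  refine ⟨_, hI, ?_⟩
  let ψ : GaussianInt →+* ZMod (p ^ 2) := Zsqrtd.lift
    ⟨teichmuller p (g : ZMod p) ^ m, by rw [hI]; simp⟩
  have hψ : ∀ t, t ≠ 0 → ψ (χ t) = teichmuller p t ^ m := by
    intro t ht
    obtain ⟨k, hk⟩ := (mem_powers_iff_mem_zpowers (x := g) (y := Units.mk0 t ht)).2 (hg _)
    have hk' : t = (g : ZMod p) ^ k := by
      rw [← Units.val_pow_eq_pow_val, show g ^ k = _ from hk, Units.val_mk0]
    rw [hk', map_pow, map_pow, map_pow, hχ, ← pow_mul, mul_comm k, pow_mul]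
    simp [ψ, Zsqrtd.lift]
  have hJ : ((jacobiSum (χ ^ 3) (χ ^ 2)).re : ZMod (p ^ 2)) + ((jacobiSum (χ ^ 3) (χ ^ 2)).im :
    ZMod (p ^ 2)) *
      teichmuller p (g : ZMod p) ^ m = ψ (jacobiSum (χ ^ 3) (χ ^ 2)) := rfl
  rw [hJ, jacobiSum, map_sum]
  refine Finset.sum_congr rfl fun t _ => ?_
  have hψ' : ∀ k, k ≠ 0 → ∀ t, ψ ((χ ^ k) t) = teichmuller p t ^ (k * m) := by
    intro k hk t
    rw [MulChar.pow_apply' _ hk, map_pow]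
    by_cases ht : t = 0
    · rw [ht, χ.map_zero, map_zero, teichmuller_zero, zero_pow hk, zero_pow]
      exact mul_ne_zero hk (by omega)
    · rw [hψ t ht, ← pow_mul, mul_comm m]
  rw [map_mul, hψ' 3 (by norm_num), hψ' 2 (by norm_num)]

/-- The square of the congruence of Gauss for `C((p-1)/2, (p-1)/4)`, refined modulo `p ^ 2`. -/
lemma four_mul_sq_sub_mul_factorial_pow_four (hp4 : p % 4 = 1) {x y : ℤ}
    (hxy : (p : ℤ) = x ^ 2 + y ^ 2) (hx : Odd x) :
    ((4 * x ^ 2 - 2 * p : ℤ) : ZMod (p ^ 2)) * ((p / 4).factorial : ZMod (p ^ 2)) ^ 4 =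
        ((p - 1).factorial : ZMod (p ^ 2)) * (1 + pHarmonic p (p / 4)) := by
  obtain ⟨g, hg⟩ := IsCyclic.exists_generator (α := (ZMod p)ˣ)
  obtain ⟨m, hm⟩ : ∃ m, m = p / 4 := ⟨_, rfl⟩
  have hpm : p = 4 * m + 1 := by omega
  have hp1 := (Fact.out : p.Prime).one_lt
  obtain ⟨χ, hχ, hJodd, hJnorm⟩ := exists_jacobiSum_quartic hp4 hg
  obtain ⟨I, hI, hJ⟩ := jacobiSum_quartic_map hpm hg hχ
  rw [sum_teichmuller_pow_mul hpm hg] at hJ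
  set a := (jacobiSum (χ ^ 3) (χ ^ 2)).re
  set b := (jacobiSum (χ ^ 3) (χ ^ 2)).im
  have hN : 2 * m < p := by omega
  have hM := isUnit_factorial (p := p) (k := m) (by omega)
  have h2m : IsUnit (2 * (m : ZMod (p ^ 2)) + p) := by
    have := isUnit_natCast (p := p) (k := 2 * m + p) (fun h => by
      have := Nat.le_of_dvd (by omega) ((Nat.dvd_add_left dvd_rfl).1 h)
      omega)
    exact_mod_cast this
  have h4 : IsUnit (4 : ZMod (p ^ 2)) := by
    exact_mod_cast isUnit_natCast_of_lt (p := p) (k := 4) (by norm_num) (by omega)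
  have hC : (m.factorial : ZMod (p ^ 2)) ^ 2 * ((2 * m).choose m : ZMod (p ^ 2)) =
      (2 * m).factorial := by
    have := Nat.choose_mul_factorial_mul_factorial (n := 2 * m) (k := m) (by omega)
    rw [show 2 * m - m = m by omega] at this
    rw [← this]; push_cast; ring
  have hD : (2 * (m : ZMod (p ^ 2)) + p) * (1 + pHarmonic p m) *
      ((m.factorial : ZMod (p ^ 2)) ^ 2 * ((6 * m).choose m : ZMod (p ^ 2))) =
      (2 * m).factorial * (1 + pHarmonic p (2 * m)) * (m + p) := by
    have e1 := shiftedFactorial_eq (p := p) (k := m) (by omega) 1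
    have e2 := shiftedFactorial_eq (p := p) (k := 2 * m) (by omega) 1
    have e3 : (m.factorial : ZMod (p ^ 2)) * ((6 * m).choose m : ZMod (p ^ 2)) =
        ∏ i ∈ Finset.range m, ((m + i : ZMod (p ^ 2)) + p) := by
      rw [← Nat.cast_mul, ← Nat.descFactorial_eq_factorial_mul_choose,
        Nat.descFactorial_eq_prod_range, Nat.cast_prod, ← Finset.prod_range_reflect]
      refine Finset.prod_congr rfl fun i hi => ?_
      rw [Finset.mem_range] at hi
      rw [show 6 * m - (m - 1 - i) = m + i + p by omega]
      push_cast; ring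
    have e4 : (∏ i ∈ Finset.range m, ((m + i : ZMod (p ^ 2)) + p)) * (2 * m + p) =
        (m + p) * ∏ i ∈ Finset.range m, (((m + i + 1 : ℕ) : ZMod (p ^ 2)) + 1 * p) := by
      have := Finset.prod_range_succ (fun i : ℕ => (m + i : ZMod (p ^ 2)) + p) m
      rw [Finset.prod_range_succ'] at this
      push_cast at this ⊢
      simp only [one_mul, add_assoc] at this ⊢
      linear_combination -this
    unfold shiftedFactorial at e1 e2
    rw [two_mul, Finset.prod_range_add, e1] at e2
    rw [two_mul m]
    linear_combination (1 + pHarmonic p m) * (2 * m + p) * m.factorial * e3 +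
      (1 + pHarmonic p m) * m.factorial * e4 + (m + p) * e2
  have hP := factorial_reflect (p := p) hN
  rw [show p - 1 - 2 * m = 2 * m by omega, pow_mul, neg_one_sq, one_pow, one_mul] at hP
  obtain ⟨S, hS⟩ : ∃ S : ℕ → ZMod (p ^ 2), ∀ k, pHarmonic p k = (p : ZMod (p ^ 2)) * S k :=
    ⟨_, fun _ => rfl⟩
  have key : ((a : ZMod (p ^ 2)) + b * I) ^ 2 * (m.factorial : ZMod (p ^ 2)) ^ 4 =
      ((p - 1).factorial : ZMod (p ^ 2)) * (1 + pHarmonic p m) := by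
    simp only [hS] at hD hP ⊢
    refine jacobi_relation natCast_mul_self ?_ h4 h2m (ε := (-1) ^ m) ?_ hC hD hP hJ
    · exact_mod_cast congrArg Nat.cast hpm.symm
    · rw [← mul_pow]; simp
  have hU : IsUnit ((a : ZMod (p ^ 2)) + b * I) := by
    have hu : IsUnit (1 + pHarmonic p m) := IsUnit.of_mul_eq_one (1 - pHarmonic p m)
      (by linear_combination -pHarmonic_mul (p := p) m m)
    have := (isUnit_factorial (p := p) (k := p - 1) (by omega)).mul hu
    rw [← key] at this
    exact (isUnit_pow_iff two_ne_zero).1 (isUnit_of_mul_isUnit_left this)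
  rw [← hm, ← key]
  have hxa := sq_eq_sq_of_sq_add_sq_eq_prime hxy hJnorm.symm hp4 hx hJodd
  have hnorm := congrArg (Int.cast (R := ZMod (p ^ 2))) hJnorm
  push_cast at hnorm
  have := cast_sq_sub_eq_sq (a := (a : ZMod (p ^ 2))) (b := b) (x := x) hI
    hnorm.symm
    (by exact_mod_cast congrArg (Int.cast (R := ZMod (p ^ 2))) hxa) hU
  rw [← this]
  push_cast
  ring

end JacobiSum

section Legendre

/-- The coefficient of `X ^ k` in the shifted Legendre polynomial of degree `n`. -/
def legendreCoeff (n k : ℕ) : ℤ := (-1) ^ k * n.choose k * (n + k).choose n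

lemma sum_legendreCoeff (n : ℕ) : ∑ k ∈ Finset.range (n + 1), legendreCoeff n k = (-1) ^ n := by
  have h := Polynomial.shiftedLegendre_eval_symm n (1 : ℤ)
  simp only [Polynomial.shiftedLegendre, map_sum, map_mul, map_pow, Polynomial.aeval_X, sub_self,
    Polynomial.aeval_C, one_pow, mul_one] at h
  rw [Finset.sum_range_succ' (n := n) (f := fun k => _ * 0 ^ k)] at h
  simpa [legendreCoeff] using h

lemma legendreCoeff_self_succ (n : ℕ) : legendreCoeff n (n + 1) = 0 := by
  simp [legendreCoeff, Nat.choose_succ_self]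

lemma legendreCoeff_succ_left {n k : ℕ} (hk : k ≤ n + 1) :
    legendreCoeff (n + 1) k * (n + 1 - k) = legendreCoeff n k * (n + 1 + k) := by
  have h1 : ((n + 1).choose k : ℤ) * (n + 1 - k) = n.choose k * (n + 1) := by
    have := Nat.choose_mul_succ_eq n k
    zify [hk] at this
    linear_combination -this
  have h2 : ((n + 1 + k).choose (n + 1) : ℤ) * (n + 1) = (n + k).choose n * (n + 1 + k) := by
    have := Nat.add_one_mul_choose_eq (n + k) n
    rw [show n + k + 1 = n + 1 + k by omega] at this
    zify at this
    linear_combination -this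
  have hn : (n + 1 : ℤ) ≠ 0 := by positivity
  unfold legendreCoeff
  apply mul_right_cancel₀ hn
  linear_combination (-1) ^ k * (((n + 1 + k).choose (n + 1) : ℤ) * (n + 1) * h1 +
    n.choose k * (n + 1) * h2)

lemma legendreCoeff_succ_right (n k : ℕ) :
    legendreCoeff n (k + 1) * (k + 1) ^ 2 = -(legendreCoeff n k * ((n - k) * (n + k + 1))) := by
  have h1 : (n.choose (k + 1) : ℤ) * (k + 1) = n.choose k * (n - k) := by
    rcases le_or_gt k n with hk | hk
    · have := Nat.choose_succ_right_eq n k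
      zify [hk] at this
      exact this
    · rw [Nat.choose_eq_zero_of_lt hk, Nat.choose_eq_zero_of_lt (by omega)]; simp
  have h2 : ((n + (k + 1)).choose n : ℤ) * (k + 1) = (n + k).choose n * (n + k + 1) := by
    have := Nat.add_one_mul_choose_eq (n + k) k
    rw [Nat.choose_symm_add, Nat.choose_symm_add (a := n) (b := k)]
    rw [add_assoc] at this
    zify at this
    linear_combination -this
  unfold legendreCoeff
  rw [pow_succ]
  linear_combination -(-1) ^ k * (((n + (k + 1)).choose n : ℤ) * (k + 1) * h1 +
    n.choose k * (n - k) * h2)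

lemma prod_mul_sum_legendreCoeff_div {K : Type*} [Field K] {d a : K}
    (h : ∀ k : ℕ, d * k + a ≠ 0) (n : ℕ) :
    (∏ j ∈ Finset.range (n + 1), (d * j + a)) *
      ∑ k ∈ Finset.range (n + 1), (legendreCoeff n k : K) / (d * k + a) =
    ∏ i ∈ Finset.range n, (d * (i + 1) - a) := by
  induction n with
  | zero =>
    have h0 := h 0
    simp only [Nat.cast_zero] at h0
    simp [legendreCoeff]
    field_simp [h0]
    simpa using h0
  | succ n ih =>
    have key : (d * (n + 1) + a) *
          ∑ k ∈ Finset.range (n + 1 + 1), (legendreCoeff (n + 1) k : K) / (d * k + a) =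
        (d * (n + 1) - a) *
          ∑ k ∈ Finset.range (n + 1), (legendreCoeff n k : K) / (d * k + a) := by
      have e1 : ∑ k ∈ Finset.range (n + 1), (legendreCoeff n k : K) / (d * k + a) =
          ∑ k ∈ Finset.range (n + 1 + 1), (legendreCoeff n k : K) / (d * k + a) := by
        rw [Finset.sum_range_succ _ (n + 1), legendreCoeff_self_succ]
        simp
      have e2 : ∑ k ∈ Finset.range (n + 1 + 1), ((legendreCoeff (n + 1) k : K) +
          legendreCoeff n k) = 0 := by
        have h1 := sum_legendreCoeff (n + 1)
        have h2 := sum_legendreCoeff n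
        have h3 : ∑ k ∈ Finset.range (n + 1 + 1), (legendreCoeff (n + 1) k +
            legendreCoeff n k) = 0 := by
          rw [Finset.sum_add_distrib, h1, Finset.sum_range_succ, h2, legendreCoeff_self_succ]
          ring
        exact_mod_cast congrArg (Int.cast (R := K)) h3
      rw [e1, ← sub_eq_zero, Finset.mul_sum, Finset.mul_sum, ← Finset.sum_sub_distrib, ← e2]
      refine Finset.sum_congr rfl fun k hk => ?_
      have h3 := legendreCoeff_succ_left (n := n) (k := k)
        (by have := Finset.mem_range.1 hk; omega)
      have h4 : (legendreCoeff (n + 1) k : K) * (n + 1 - k) =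
          legendreCoeff n k * (n + 1 + k) := by exact_mod_cast congrArg (Int.cast (R := K)) h3
      have := h k
      field_simp
      linear_combination d * h4
    rw [Finset.prod_range_succ _ (n + 1),
      Finset.prod_range_succ (fun i : ℕ => d * ((i : K) + 1) - a) n, ← ih]
    push_cast
    linear_combination (∏ j ∈ Finset.range (n + 1), (d * j + a)) * key

lemma choose_sq_eq_legendreCoeff {p : ℕ} [Fact p.Prime] (hodd : Odd p) {k : ℕ} (hk : k < p) :
    (((2 * k).choose k : ℕ) : ZMod (p ^ 2)) ^ 2 = 16 ^ k * (legendreCoeff (p / 2) k :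
      ZMod (p ^ 2)) := by
  change ((Nat.centralBinom k : ℕ) : ZMod (p ^ 2)) ^ 2 = _
  have h3 : 2 * ((p / 2 : ℕ) : ZMod (p ^ 2)) + 1 = p := by
    have := Nat.two_mul_div_two_add_one_of_odd hodd
    exact_mod_cast congrArg (Nat.cast (R := ZMod (p ^ 2))) this
  generalize p / 2 = n at *
  induction k with
  | zero => simp [legendreCoeff]
  | succ k ih =>
    have ih := ih (by omega)
    have h1 := legendreCoeff_succ_right n k
    have h1 := congrArg (Int.cast (R := ZMod (p ^ 2))) h1
    have h2 := congrArg (Nat.cast (R := ZMod (p ^ 2))) (Nat.succ_mul_centralBinom_succ k)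
    have h0 := natCast_mul_self (p := p)
    push_cast at h1 h2
    apply ((isUnit_natCast_of_lt (p := p) k.succ_pos hk).pow 2).mul_left_cancel
    push_cast
    rw [pow_succ 16]
    generalize (n : ZMod (p ^ 2)) = N at *
    generalize (legendreCoeff n (k + 1) : ZMod (p ^ 2)) = c' at *
    generalize (legendreCoeff n k : ZMod (p ^ 2)) = c at *
    generalize (Nat.centralBinom (k + 1) : ZMod (p ^ 2)) = b' at *
    generalize (Nat.centralBinom k : ZMod (p ^ 2)) = b at *
    have h5 : 16 * ((N - k) * (N + k + 1)) = -(4 * (2 * (k : ZMod (p ^ 2)) + 1) ^ 2) := by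
      linear_combination 4 * (2 * N + 1 + p) * h3 + 4 * h0
    linear_combination ((k + 1) * b' + 2 * (2 * k + 1) * b) * h2 + 4 * (2 * (k : ZMod (p ^ 2)) +
      1) ^ 2 * ih - 16 ^ k * 16 * h1 + 16 ^ k * c * h5

end Legendre

section Residue

variable {p : ℕ}

/-- The rational number `q` is a quotient of integers which has residue `z` modulo `p ^ 2`. -/
def HasResidue (p : ℕ) (q : ℚ) (z : ZMod (p ^ 2)) : Prop :=
  ∃ a b : ℤ, IsUnit (b : ZMod (p ^ 2)) ∧ q * b = a ∧ z * (b : ZMod (p ^ 2)) = a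

lemma HasResidue.intCast (a : ℤ) : HasResidue p a a := ⟨a, 1, by simp, by simp, by simp⟩

lemma HasResidue.mul {q q' : ℚ} {z z' : ZMod (p ^ 2)} (h : HasResidue p q z)
    (h' : HasResidue p q' z') : HasResidue p (q * q') (z * z') := by
  obtain ⟨a, b, hb, h1, h2⟩ := h
  obtain ⟨a', b', hb', h1', h2'⟩ := h'
  refine ⟨a * a', b * b', by push_cast; exact hb.mul hb', ?_, ?_⟩
  · push_cast; rw [← h1, ← h1']; ring
  · push_cast; rw [← h2, ← h2']; ring

lemma HasResidue.add {q q' : ℚ} {z z' : ZMod (p ^ 2)} (h : HasResidue p q z)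
    (h' : HasResidue p q' z') : HasResidue p (q + q') (z + z') := by
  obtain ⟨a, b, hb, h1, h2⟩ := h
  obtain ⟨a', b', hb', h1', h2'⟩ := h'
  refine ⟨a * b' + a' * b, b * b', by push_cast; exact hb.mul hb', ?_, ?_⟩
  · push_cast; rw [← h1, ← h1']; ring
  · push_cast; rw [← h2, ← h2']; ring

lemma HasResidue.sum_zero {ι : Type*} {s : Finset ι} {q : ι → ℚ}
    (h : ∀ i ∈ s, HasResidue p (q i) 0) : HasResidue p (∑ i ∈ s, q i) 0 := by
  classical
  induction s using Finset.induction_on with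
  | empty => simpa using HasResidue.intCast (p := p) 0
  | insert i s hi ih =>
    rw [Finset.sum_insert hi, ← add_zero (0 : ZMod (p ^ 2))]
    exact (h i (Finset.mem_insert_self i s)).add (ih fun j hj => h j (Finset.mem_insert_of_mem hj))

lemma pCong_of_hasResidue [Fact p.Prime] {q q' : ℚ} {z : ZMod (p ^ 2)} (h : HasResidue p q z)
    (h' : HasResidue p q' z) : pCong p 2 q q' := by
  obtain ⟨a, b, hb, h1, h2⟩ := h
  obtain ⟨a', b', hb', h1', h2'⟩ := h'
  have hd : ((a * b' - a' * b : ℤ) : ZMod (p ^ 2)) = 0 := by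
    push_cast; rw [← h2, ← h2']; ring
  rw [ZMod.intCast_zmod_eq_zero_iff_dvd] at hd
  obtain ⟨e, he⟩ := hd
  have hu := hb.mul hb'
  have hp := (Fact.out : p.Prime)
  have hcop : ¬ (p : ℤ) ∣ b * b' := by
    rintro ⟨f, hf⟩
    have h3 := hu.map (red p)
    rw [← Int.cast_mul, hf, map_intCast] at h3
    simp at h3
  have h0 : b * b' ≠ 0 := fun h => hcop (h ▸ dvd_zero _)
  have hb0 : (b : ℚ) ≠ 0 := by exact_mod_cast left_ne_zero_of_mul h0
  have hb0' : (b' : ℚ) ≠ 0 := by exact_mod_cast right_ne_zero_of_mul h0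
  have hp0 : (p : ℚ) ≠ 0 := by exact_mod_cast hp.ne_zero
  have hq : (q - q') / (p : ℚ) ^ 2 = Rat.divInt e (b * b') := by
    rw [Rat.divInt_eq_div]
    have he' : (a : ℚ) * b' - a' * b = p ^ 2 * e := by exact_mod_cast he
    push_cast
    field_simp
    rw [← h1, ← h1'] at he'
    linear_combination he'
  unfold pCong isPInt
  rw [hq]
  intro hdvd
  exact hcop ((Int.natCast_dvd_natCast.2 hdvd).trans (Rat.den_dvd _ _))

lemma exists_hasResidue_div [Fact p.Prime] {d : ℕ} (h0 : 0 < d) (hd : d < p ^ 2) :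
    ∃ z, HasResidue p ((p : ℚ) / d) z := by
  have hp := (Fact.out : p.Prime)
  have main : ∀ a b : ℕ, IsUnit (b : ZMod (p ^ 2)) → (p : ℚ) * b = a * d →
      ∃ z, HasResidue p ((p : ℚ) / d) z := fun a b hb h => by
    refine ⟨a * (b : ZMod (p ^ 2))⁻¹, a, b, by simpa using hb, ?_, ?_⟩
    · have : (d : ℚ) ≠ 0 := by exact_mod_cast h0.ne'
      push_cast
      field_simp
      linear_combination h
    · push_cast
      rw [mul_assoc, ZMod.inv_mul_of_unit _ hb, mul_one]
  by_cases h : p ∣ d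
  · obtain ⟨e, rfl⟩ := h
    refine main 1 e (isUnit_natCast_of_lt (Nat.pos_of_mul_pos_left h0) ?_) (by push_cast; ring)
    rw [sq] at hd
    exact Nat.lt_of_mul_lt_mul_left hd
  · exact main p d (isUnit_natCast h) rfl

end Residue

section Assembly

variable {p : ℕ} [Fact p.Prime]

lemma hasResidue_sum_sub {a : ℕ} (h5 : 13 ≤ p) (hodd : Odd p) (ha0 : 0 < a) (ha : a ≤ 5) :
    HasResidue p (∑ k ∈ Finset.range p, ((2 * k).choose k : ℚ) ^ 2 / 16 ^ k *
        ((p : ℚ) / (12 * (k : ℚ) + a)) -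
      p * ∑ k ∈ Finset.range (p / 2 + 1), (legendreCoeff (p / 2) k : ℚ) / (12 * (k : ℚ) +
        a)) 0 := by
  have h1 : ∑ k ∈ Finset.range (p / 2 + 1), (legendreCoeff (p / 2) k : ℚ) / (12 * (k : ℚ) + a) =
      ∑ k ∈ Finset.range p, (legendreCoeff (p / 2) k : ℚ) / (12 * (k : ℚ) + a) := by
    refine Finset.sum_subset (Finset.range_subset_range.2 (by omega)) fun k _ hk => ?_
    rw [Finset.mem_range, not_lt] at hk
    rw [legendreCoeff, Nat.choose_eq_zero_of_lt (by omega)]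
    simp
  rw [h1, Finset.mul_sum, ← Finset.sum_sub_distrib]
  refine HasResidue.sum_zero fun k hk => ?_
  rw [Finset.mem_range] at hk
  obtain ⟨z, hz⟩ := exists_hasResidue_div (p := p) (d := 12 * k + a) (by omega) (by nlinarith)
  push_cast at hz
  have h16 : IsUnit (16 : ZMod (p ^ 2)) := by
    have h2 : IsUnit ((2 : ℕ) : ZMod (p ^ 2)) := isUnit_natCast_of_lt (by norm_num) (by omega)
    have := h2.pow 4
    norm_num at this
    exact this
  have h2 : HasResidue p (((2 * k).choose k : ℚ) ^ 2 / 16 ^ k - legendreCoeff (p / 2) k) 0 := by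
    refine ⟨((2 * k).choose k : ℤ) ^ 2 - 16 ^ k * legendreCoeff (p / 2) k, 16 ^ k,
      by simpa using h16.pow k, ?_, ?_⟩
    · push_cast
      field_simp
    · have := choose_sq_eq_legendreCoeff hodd hk
      push_cast
      rw [this]
      ring
  have := h2.mul hz
  rw [zero_mul] at this
  convert this using 1
  ring

lemma legendre_prod_relation {c s s' : ℕ} (hs : s + s' = p / 2) (heven : Even (p / 2))
    (hodd : Odd p) {v W l : ZMod (p ^ 2)} (hv : 12 * v = 1)
    (hW : W * (s.factorial * s'.factorial : ZMod (p ^ 2)) ^ 2 =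
      l * (((p - 1).factorial : ZMod (p ^ 2)) * (1 + 2 * v * ((c : ZMod (p ^ 2)) *
        pHarmonic p s + (6 - (c : ZMod (p ^ 2))) * pHarmonic p s')))) :
    W * ((-1) ^ s * shiftedFactorial p s (-((c : ZMod (p ^ 2)) * v)) ^ 2 *
      shiftedFactorial p s' ((c : ZMod (p ^ 2)) * v)) =
      l * shiftedFactorial p (p / 2 + s) (-((c : ZMod (p ^ 2)) * v)) := by
  have hp := (Fact.out : p.Prime).pos
  have h2 := Nat.two_mul_div_two_add_one_of_odd hodd
  have hP := factorial_reflect (p := p) (k := s') (by omega)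
  have hz1 := pHarmonic_mul (p := p) s s
  have hz2 := pHarmonic_mul (p := p) s s'
  have hz3 := pHarmonic_mul (p := p) s' s'
  have hsgn : (-1 : ZMod (p ^ 2)) ^ s * (-1) ^ s' = 1 := by
    rw [← pow_add, hs, heven.neg_one_pow]
  have hu : IsUnit ((-1 : ZMod (p ^ 2)) ^ s' * (s'.factorial * (1 - pHarmonic p s'))) := by
    have h3 := isUnit_factorial (p := p) (k := p - 1) (by omega)
    rw [hP] at h3
    exact isUnit_of_mul_isUnit_right h3
  rw [show p / 2 + s = p - 1 - s' by omega, shiftedFactorial_eq (by omega),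
    shiftedFactorial_eq (by omega), shiftedFactorial_eq (by omega),
    pHarmonic_reflect hodd (by omega)]
  apply hu.mul_left_cancel
  have e1 : l * (((p - 1).factorial : ZMod (p ^ 2)) * (1 + -((c : ZMod (p ^ 2)) * v) *
    pHarmonic p s')) =
      W * (s.factorial * s'.factorial : ZMod (p ^ 2)) ^ 2 *
        ((1 - 2 * ((c : ZMod (p ^ 2)) * v) * pHarmonic p s) * ((1 + (c : ZMod (p ^ 2)) * v *
          pHarmonic p s') *
          (1 - pHarmonic p s'))) := by
    rw [hW]
    clear hW hP hu hsgn
    generalize pHarmonic p s = h at *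
    generalize pHarmonic p s' = h' at *
    generalize (c : ZMod (p ^ 2)) = d at *
    have e2 : 1 + -(d * v) * h' = (1 + 2 * v * (d * h + (6 - d) * h')) *
        ((1 - 2 * (d * v) * h) * ((1 + d * v * h') * (1 - h'))) := by
      clear h2 hp hs heven hodd
      grind
    rw [e2]
    ring
  have hz : (1 + -((c : ZMod (p ^ 2)) * v) * pHarmonic p s) ^ 2 = 1 - 2 * ((c : ZMod (p ^ 2)) *
    v) * pHarmonic p s := by
    linear_combination ((c : ZMod (p ^ 2)) * v) ^ 2 * hz1
  rw [mul_pow, hz]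
  generalize (1 - 2 * ((c : ZMod (p ^ 2)) * v) * pHarmonic p s) = X at *
  linear_combination -e1 + l * (1 + -((c : ZMod (p ^ 2)) * v) * pHarmonic p s') * hP +
    W * (s.factorial * s'.factorial : ZMod (p ^ 2)) ^ 2 *
        (X * ((1 + (c : ZMod (p ^ 2)) * v * pHarmonic p s') *
          (1 - pHarmonic p s'))) * hsgn

lemma hasResidue_legendre_sum {a c s s' : ℕ} (h5 : 13 ≤ p) (hs : s + s' = p / 2)
    (heven : Even (p / 2)) (hodd : Odd p) (ha0 : 0 < a) (ha : 12 * s + a = c * p)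
    {v W : ZMod (p ^ 2)} {l : ℤ} (hv : 12 * v = 1)
    (hW : W * (s.factorial * s'.factorial : ZMod (p ^ 2)) ^ 2 =
      (l : ZMod (p ^ 2)) * (((p - 1).factorial : ZMod (p ^ 2)) * (1 + 2 * v * ((c :
        ZMod (p ^ 2)) * pHarmonic p s + (6 - (c : ZMod (p ^ 2))) * pHarmonic p s')))) :
    HasResidue p (l * c * (p * ∑ k ∈ Finset.range (p / 2 + 1),
      (legendreCoeff (p / 2) k : ℚ) / (12 * (k : ℚ) + a))) W := by
  have hp := (Fact.out : p.Prime).pos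
  have h2 := Nat.two_mul_div_two_add_one_of_odd hodd
  have h12 : IsUnit (12 : ZMod (p ^ 2)) := IsUnit.of_mul_eq_one _ hv
  have hunit : ∀ k < p, ∀ z, IsUnit (shiftedFactorial p k z) := fun k hk z => by
    rw [shiftedFactorial_eq hk]
    refine (isUnit_factorial hk).mul (IsUnit.of_mul_eq_one (1 - z * pHarmonic p k) ?_)
    linear_combination -z ^ 2 * pHarmonic_mul (p := p) k k
  have hshift : ∀ k z, ∏ i ∈ Finset.range k, (12 * (i + 1 : ZMod (p ^ 2)) + z * p) =
      12 ^ k * shiftedFactorial p k (z * v) := fun k z => by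
    have : (12 : ZMod (p ^ 2)) ^ k = ∏ i ∈ Finset.range k, 12 := by simp
    unfold shiftedFactorial
    rw [this, ← Finset.prod_mul_distrib]
    refine Finset.prod_congr rfl fun i _ => ?_
    push_cast
    linear_combination -z * p * hv
  have haR : (12 : ZMod (p ^ 2)) * s + a = c * p := by
    exact_mod_cast congrArg (Nat.cast (R := ZMod (p ^ 2))) ha
  have haQ : (12 : ℚ) * s + a = c * p := by exact_mod_cast ha
  have hrel := legendre_prod_relation hs heven hodd hv hW
  have e1 : ∏ i ∈ Finset.range s, ((c : ZMod (p ^ 2)) * p - 12 * (i + 1)) =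
      (-1) ^ s * (12 ^ s * shiftedFactorial p s (-((c : ZMod (p ^ 2)) * v))) := by
    have : ((-1 : ZMod (p ^ 2)) ^ s) = ∏ i ∈ Finset.range s, (-1) := by simp
    rw [← neg_mul, ← hshift, this, ← Finset.prod_mul_distrib]
    exact Finset.prod_congr rfl fun i _ => by ring
  have e2 := hshift s' c
  have e3 : (12 ^ s * shiftedFactorial p s (-((c : ZMod (p ^ 2)) * v))) *
      ∏ i ∈ Finset.range (p / 2), (12 * (i + 1 : ZMod (p ^ 2)) - a) =
      12 ^ (p / 2 + s) * shiftedFactorial p (p / 2 + s) (-((c : ZMod (p ^ 2)) * v)) := by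
    rw [← neg_mul, ← hshift, ← hshift, add_comm (p / 2), Finset.prod_range_add]
    congr 1
    refine Finset.prod_congr rfl fun i _ => ?_
    push_cast
    linear_combination -haR
  refine ⟨l * ∏ i ∈ Finset.range (p / 2), (12 * ((i : ℤ) + 1) - a),
    (∏ i ∈ Finset.range s, ((c : ℤ) * p - 12 * (i + 1))) *
      ∏ i ∈ Finset.range s', (12 * ((i : ℤ) + 1) + c * p), ?_, ?_, ?_⟩
  · push_cast
    rw [e1, e2]
    exact (((isUnit_one.neg).pow s).mul ((h12.pow s).mul (hunit s (by omega) _))).mul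
      ((h12.pow s').mul (hunit s' (by omega) _))
  · have hpf := prod_mul_sum_legendreCoeff_div (K := ℚ) (d := 12) (a := a)
      (fun k => by positivity) (p / 2)
    rw [show p / 2 + 1 = s + 1 + s' by omega, Finset.prod_range_add, Finset.prod_range_succ,
      haQ] at hpf
    rw [show p / 2 + 1 = s + 1 + s' by omega]
    push_cast
    rw [← hpf]
    have f1 : ∏ i ∈ Finset.range s, ((c : ℚ) * p - 12 * (i + 1)) =
        ∏ j ∈ Finset.range s, (12 * (j : ℚ) + a) := by
      rw [← Finset.prod_range_reflect]
      refine Finset.prod_congr rfl fun i hi => ?_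
      rw [Finset.mem_range] at hi
      have : ((s - 1 - i : ℕ) : ℚ) + 1 + i = s := by
        exact_mod_cast congrArg (Nat.cast (R := ℚ)) (show s - 1 - i + 1 + i = s by omega)
      linear_combination -haQ - 12 * this
    have f2 : ∏ i ∈ Finset.range s', (12 * ((i : ℚ) + 1) + c * p) =
        ∏ i ∈ Finset.range s', (12 * ((s + 1 + i : ℕ) : ℚ) + a) := by
      refine Finset.prod_congr rfl fun i _ => ?_
      push_cast
      linear_combination -haQ
    rw [f1, f2]
    ring
  · push_cast
    apply ((h12.pow s).mul (hunit s (by omega) (-((c : ZMod (p ^ 2)) * v)))).mul_left_cancel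
    rw [mul_left_comm _ (l : ZMod (p ^ 2)), e3, e1, e2, ← hs, add_right_comm, pow_add, pow_add,
      show s + s + s' = p / 2 + s by omega]
    linear_combination 12 ^ s * 12 ^ s * 12 ^ s' * hrel

end Assembly

section Conclusion

variable {p : ℕ} [Fact p.Prime]

lemma hasResidue_mul_sum {a c s s' : ℕ} (h5 : 13 ≤ p) (hs : s + s' = p / 2)
    (heven : Even (p / 2)) (hodd : Odd p) (ha0 : 0 < a) (ha5 : a ≤ 5) (ha : 12 * s + a = c * p)
    {v W : ZMod (p ^ 2)} {l : ℤ} (hv : 12 * v = 1)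
    (hW : W * (s.factorial * s'.factorial : ZMod (p ^ 2)) ^ 2 =
      (l : ZMod (p ^ 2)) * (((p - 1).factorial : ZMod (p ^ 2)) *
        (1 + 2 * v * ((c : ZMod (p ^ 2)) * pHarmonic p s + (6 - (c : ZMod (p ^ 2))) *
          pHarmonic p s')))) :
    HasResidue p (l * c * ∑ k ∈ Finset.range p, ((2 * k).choose k : ℚ) ^ 2 / 16 ^ k *
      ((p : ℚ) / (12 * (k : ℚ) + a))) W := by
  have h1 := (HasResidue.intCast (p := p) (l * c)).mul (hasResidue_sum_sub h5 hodd ha0 ha5)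
  have h2 := h1.add (hasResidue_legendre_sum h5 hs heven hodd ha0 ha hv hW)
  convert h2 using 1
  · push_cast
    ring
  · ring

lemma factorial_relation (hp4 : p % 4 = 1) (hp3 : p % 3 ≠ 0) {v : ZMod (p ^ 2)} (hv : 12 * v = 1)
    {x y : ℤ} (hxy : (p : ℤ) = x ^ 2 + y ^ 2) (hx : Odd x) :
    ((4 * x ^ 2 - 2 * p : ℤ) : ZMod (p ^ 2)) *
        ((p / 12).factorial * (p / 2 - p / 12).factorial : ZMod (p ^ 2)) ^ 2 =
      (legendreThree p : ZMod (p ^ 2)) * (((p - 1).factorial : ZMod (p ^ 2)) *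
        (1 + 2 * v * (5 * pHarmonic p (p / 2 - p / 12) + pHarmonic p (p / 12)))) := by
  have h1 := factorial_quarter_pow_four hp4 hp3 hv
  have h2 := four_mul_sq_sub_mul_factorial_pow_four hp4 hxy hx
  have hu : IsUnit (1 + pHarmonic p (p / 4)) := by
    refine IsUnit.of_mul_eq_one (1 - pHarmonic p (p / 4)) ?_
    linear_combination -pHarmonic_mul (p := p) (p / 4) (p / 4)
  apply hu.mul_left_cancel
  linear_combination (-((4 * x ^ 2 - 2 * p : ℤ) : ZMod (p ^ 2))) * h1 + (legendreThree p :
    ZMod (p ^ 2)) *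
    (1 + 2 * v * (5 * pHarmonic p (p / 2 - p / 12) + pHarmonic p (p / 12))) * h2

lemma hasResidue_sums (h5 : 13 ≤ p) (hp4 : p % 4 = 1) {x y : ℤ} (hxy : (p : ℤ) = x ^ 2 + y ^ 2)
    (hx : Odd x) :
    HasResidue p ((3 * legThree p - 2) *
        ∑ k ∈ Finset.range p,
          ((2 * k).choose k : ℚ) ^ 2 / 16 ^ k * ((p : ℚ) / (12 * (k : ℚ) + 1)))
      ((4 * x ^ 2 - 2 * p : ℤ) : ZMod (p ^ 2)) ∧
    HasResidue p ((3 * legThree p + 2) *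
        ∑ k ∈ Finset.range p,
          ((2 * k).choose k : ℚ) ^ 2 / 16 ^ k * ((p : ℚ) / (12 * (k : ℚ) + 5)))
      ((4 * x ^ 2 - 2 * p : ℤ) : ZMod (p ^ 2)) := by
  have hp := (Fact.out : p.Prime)
  have hp3 : p % 3 ≠ 0 := fun h => by
    have := (Nat.prime_dvd_prime_iff_eq Nat.prime_three hp).1 (Nat.dvd_of_mod_eq_zero h)
    omega
  have hodd : Odd p := Nat.odd_iff.2 (by omega)
  have heven : Even (p / 2) := Nat.even_iff.2 (by omega)
  have hunit : IsUnit ((12 : ℕ) : ZMod (p ^ 2)) := isUnit_natCast_of_lt (by norm_num) (by omega)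
  obtain ⟨v, hv⟩ := isUnit_iff_exists_inv.1 hunit
  push_cast at hv
  have hW := factorial_relation hp4 hp3 hv hxy hx
  have hs : p / 12 + (p / 2 - p / 12) = p / 2 := by omega
  have hs' : p / 2 - p / 12 + p / 12 = p / 2 := by omega
  obtain h | h : p % 12 = 1 ∨ p % 12 = 5 := by omega
  · have hl : legendreThree p = 1 := if_pos (by omega)
    have hl' : legThree p = 1 := if_pos (by omega)
    have h1 := hasResidue_mul_sum (a := 1) (c := 1) (l := legendreThree p) h5 hs heven hodd
      (by norm_num) (by norm_num) (by omega) hv (hW.trans (by push_cast; ring))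
    have h2 := hasResidue_mul_sum (a := 5) (c := 5) (l := legendreThree p) h5 hs' heven hodd
      (W := ((4 * x ^ 2 - 2 * p : ℤ) : ZMod (p ^ 2))) (by norm_num) (by norm_num) (by omega) hv
      (by push_cast at hW ⊢; linear_combination hW)
    rw [hl] at h1 h2
    rw [hl']
    norm_num at h1 h2 ⊢
    exact ⟨h1, h2⟩
  · have hl : legendreThree p = -1 := if_neg (by omega)
    have hl' : legThree p = -1 := if_neg (by omega)
    have h1 := hasResidue_mul_sum (a := 5) (c := 1) (l := legendreThree p) h5 hs heven hodd
      (by norm_num) (by norm_num) (by omega) hv (hW.trans (by push_cast; ring))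
    have h2 := hasResidue_mul_sum (a := 1) (c := 5) (l := legendreThree p) h5 hs' heven hodd
      (W := ((4 * x ^ 2 - 2 * p : ℤ) : ZMod (p ^ 2))) (by norm_num) (by norm_num) (by omega) hv
      (by push_cast at hW ⊢; linear_combination hW)
    rw [hl] at h1 h2
    rw [hl']
    norm_num at h1 h2 ⊢
    exact ⟨h2, h1⟩

end Conclusion
end ModSq

theorem stmt15 (p : ℕ) (hp : p.Prime) (hp4 : p % 4 = 1) (x y : ℤ)
    (hxy : (p : ℤ) = x ^ 2 + y ^ 2) (hx : Odd x) :
    pCong p 2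
      ((3 * legThree p - 2) *
        ∑ k ∈ Finset.range p,
          ((2 * k).choose k : ℚ) ^ 2 / 16 ^ k * ((p : ℚ) / (12 * (k : ℚ) + 1)))
      ((3 * legThree p + 2) *
        ∑ k ∈ Finset.range p,
          ((2 * k).choose k : ℚ) ^ 2 / 16 ^ k * ((p : ℚ) / (12 * (k : ℚ) + 5))) ∧
    pCong p 2
      ((3 * legThree p + 2) *
        ∑ k ∈ Finset.range p,
          ((2 * k).choose k : ℚ) ^ 2 / 16 ^ k * ((p : ℚ) / (12 * (k : ℚ) + 5)))
      (4 * (x : ℚ) ^ 2 - 2 * (p : ℚ)) := by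
  have : Fact p.Prime := ⟨hp⟩
  by_cases h5 : 13 ≤ p
  · obtain ⟨h1, h2⟩ := ModSq.hasResidue_sums h5 hp4 hxy hx
    refine ⟨ModSq.pCong_of_hasResidue h1 h2, ModSq.pCong_of_hasResidue h2 ?_⟩
    have h3 := ModSq.HasResidue.intCast (p := p) (4 * x ^ 2 - 2 * p)
    push_cast at h3 ⊢
    exact h3
  · have hp5 : p = 5 := by
      have hp9 : p ≠ 9 := fun h => by norm_num [h] at hp
      have hp1 := hp.one_lt
      omega
    subst hp5
    push_cast at hxy
    have hx1 : x ^ 2 = 1 := by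
      have h1 : x ≤ 2 := by nlinarith [sq_nonneg y]
      have h2 : -2 ≤ x := by nlinarith [sq_nonneg y]
      rw [Int.odd_iff] at hx
      obtain rfl | rfl : x = 1 ∨ x = -1 := by omega
      all_goals rfl
    have hx1' : (x : ℚ) ^ 2 = 1 := by exact_mod_cast hx1
    rw [hx1']
    constructor <;>
    · norm_num [Finset.sum_range_succ, Nat.choose, legThree, pCong, isPInt]
end

section
/- Let p be a prime with p > 3, and let D_n = Σ_{k=0}^{n} C(n,k)²·C(2k,k)·C(2n−2k,n−k) denote the Domb numbers. If p ≡ 1 (mod 3) and x, y are integers with p = x² + 3y², then Σ_{n=0}^{p−1} D_n/16^n ≡ Σ_{n=0}^{p−1} D_n/4^n ≡ 4x² − 2p (mod p²). If p ≡ 2 (mod 3), then Σ_{n=0}^{p−1} D_n/16^n ≡ Σ_{n=0}^{p−1} D_n/4^n ≡ 0 (mod p²). -/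
/-- The Domb numbers `D_n = Σ_{k=0}^{n} C(n,k)²·C(2k,k)·C(2n−2k,n−k)`. -/
def domb (n : ℕ) : ℕ :=
  ∑ k ∈ Finset.range (n + 1),
    (n.choose k) ^ 2 * (2 * k).choose k * (2 * n - 2 * k).choose (n - k)

/-- The coefficient `C(2k,k)² C(3k,k)`. -/
def cubicCoeff (k : ℕ) : ℕ := (2 * k).choose k ^ 2 * (3 * k).choose k

/-- The summand of the Domb number `D_(d+k)` with index `k`. -/
def dombTerm (d k : ℕ) : ℚ := ((k + d).choose k : ℚ) ^ 2 * k.centralBinom * d.centralBinom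

lemma dombTerm_succ_right (d k : ℕ) :
    dombTerm d (k + 1) = dombTerm d k * ((k + d + 1) ^ 2 * (2 * (2 * k + 1))) / (k + 1) ^ 3 := by
  have h1 : ((k : ℚ) + 1) * (k + 1).centralBinom = 2 * (2 * k + 1) * k.centralBinom := by
    exact_mod_cast Nat.succ_mul_centralBinom_succ k
  have h2 : ((k : ℚ) + d + 1) * (k + d).choose k = (k + 1 + d).choose (k + 1) * (k + 1) := by
    have := Nat.add_one_mul_choose_eq (k + d) k
    rw [show k + 1 + d = k + d + 1 by ring]
    exact_mod_cast this
  have hk : (k : ℚ) + 1 ≠ 0 := by positivity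
  have h1' : ((k + 1).centralBinom : ℚ) = 2 * (2 * k + 1) * k.centralBinom / (k + 1) := by
    field_simp; linarith
  have h2' : ((k + 1 + d).choose (k + 1) : ℚ) = (k + d + 1) * (k + d).choose k / (k + 1) := by
    field_simp; linarith
  unfold dombTerm
  rw [h1', h2']
  field_simp

lemma dombTerm_comm (d k : ℕ) : dombTerm d k = dombTerm k d := by
  unfold dombTerm
  rw [Nat.choose_symm_add, add_comm k d]
  ring

lemma dombTerm_succ_left (d k : ℕ) :
    dombTerm (d + 1) k = dombTerm d k * ((k + d + 1) ^ 2 * (2 * (2 * d + 1))) / (d + 1) ^ 3 := by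
  rw [dombTerm_comm, dombTerm_succ_right, dombTerm_comm k d]
  ring

/-- The combination of three consecutive Domb numbers appearing in their recurrence. -/
def dombRec (n a b c : ℚ) : ℚ :=
  (n + 2) ^ 3 * c - 2 * (2 * n + 3) * (5 * n ^ 2 + 15 * n + 12) * b + 64 * (n + 1) ^ 3 * a

/-- The polynomial in the telescoping certificate for the Domb recurrence. -/
def dombCert (n k : ℚ) : ℚ :=
  -224 + 744*k + -712*k^2 + 256*k^3 + -32*k^4 + -1312*n + 3268*n*k + -2448*n*k^2 + 688*n*k^3
  + -64*n*k^4 + -3032*n^2 + 5616*n^2*k + -3112*n^2*k^2 + 608*n^2*k^3 + -32*n^2*k^4 + -3568*n^3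
  + 4708*n^3*k + -1728*n^3*k^2 + 176*n^3*k^3 + -2264*n^4 + 1920*n^4*k + -352*n^4*k^2
  + -736*n^5 + 304*n^5*k + -96*n^6

lemma sum_dombRec_dombTerm (K d : ℕ) :
    ∑ k ∈ Finset.range (K + 1), dombRec (K + d : ℕ) (dombTerm (K + d - k) k)
      (dombTerm (K + d + 1 - k) k) (dombTerm (K + d + 2 - k) k)
    = dombTerm d K * (2 * K + 1) * dombCert (K + d) (K + 1) / ((2 * d - 1) * (d + 1) ^ 3) := by
  induction K generalizing d with
  | zero =>
    have h0 : dombTerm 0 0 = 1 := by simp [dombTerm]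
    have h3 : (2 * (d : ℚ) - 1) ≠ 0 := by
      intro h
      have : (2 * d : ℤ) - 1 = 0 := by exact_mod_cast h
      omega
    have h1 : (d : ℚ) + 1 ≠ 0 := by positivity
    have h2 : (d : ℚ) + 1 + 1 ≠ 0 := by positivity
    simp only [zero_add, Finset.sum_range_one, Nat.sub_zero, dombTerm_succ_left, dombRec,
      dombCert]
    rw [eq_div_iff (mul_ne_zero h3 (pow_ne_zero 3 h1))]
    push_cast
    field_simp
    ring
  | succ K ih =>
    rw [Finset.sum_range_succ]
    have := ih (d + 1)
    rw [show K + (d + 1) = K + 1 + d by ring] at this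
    rw [this]
    rw [show K + 1 + d - (K + 1) = d by omega, show K + 1 + d + 1 - (K + 1) = d + 1 by omega,
      show K + 1 + d + 2 - (K + 1) = d + 1 + 1 by omega]
    have h3 : (2 * (d : ℚ) - 1) ≠ 0 := by
      intro h
      have : (2 * d : ℤ) - 1 = 0 := by exact_mod_cast h
      omega
    have h1 : (d : ℚ) + 1 ≠ 0 := by positivity
    have h2 : (d : ℚ) + 1 + 1 ≠ 0 := by positivity
    have h4 : (K : ℚ) + 1 ≠ 0 := by positivity
    have h5 : (2 * ((d : ℚ) + 1) - 1) ≠ 0 := by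
      have : (0 : ℚ) ≤ d := by positivity
      intro h; linarith
    simp only [dombTerm_succ_left, dombTerm_succ_right, dombRec, dombCert]
    rw [eq_div_iff (mul_ne_zero h3 (pow_ne_zero 3 h1))]
    push_cast
    field_simp
    ring

lemma domb_eq_sum_dombTerm (n : ℕ) :
    (domb n : ℚ) = ∑ k ∈ Finset.range (n + 1), dombTerm (n - k) k := by
  unfold domb dombTerm
  push_cast
  refine Finset.sum_congr rfl fun k hk => ?_
  have : k ≤ n := Nat.lt_succ_iff.mp (Finset.mem_range.mp hk)
  rw [Nat.add_sub_cancel' this, Nat.centralBinom, Nat.centralBinom, Nat.mul_sub]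

lemma dombRec_domb (n : ℕ) : dombRec n (domb n) (domb (n + 1)) (domb (n + 2)) = 0 := by
  have h := sum_dombRec_dombTerm n 0
  simp only [add_zero] at h
  have e : dombRec n (domb n) (domb (n + 1)) (domb (n + 2)) =
      ∑ k ∈ Finset.range (n + 1), dombRec n (dombTerm (n - k) k)
      (dombTerm (n + 1 - k) k) (dombTerm (n + 2 - k) k) +
      dombRec n 0 (dombTerm 0 (n + 1)) (dombTerm (0 + 1) (n + 1)) +
      dombRec n 0 0 (dombTerm 0 (n + 1 + 1)) := by
    rw [domb_eq_sum_dombTerm, domb_eq_sum_dombTerm, domb_eq_sum_dombTerm,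
      Finset.sum_range_succ _ (n + 1), Finset.sum_range_succ _ (n + 2),
      Finset.sum_range_succ _ (n + 1)]
    simp only [Nat.sub_self, show n + 2 - (n + 1) = 0 + 1 by omega, dombRec,
      Finset.sum_add_distrib, Finset.sum_sub_distrib, ← Finset.mul_sum]
    ring
  rw [e, h]
  have h4 : (n : ℚ) + 1 ≠ 0 := by positivity
  have h5 : (n : ℚ) + 1 + 1 ≠ 0 := by positivity
  simp only [dombTerm_succ_left, dombTerm_succ_right, dombRec, dombCert]
  push_cast
  field_simp
  ring

lemma eq_domb_of_dombRec {s : ℕ → ℚ} (h0 : s 0 = 1) (h1 : s 1 = 4)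
    (h : ∀ n : ℕ, dombRec n (s n) (s (n + 1)) (s (n + 2)) = 0) (n : ℕ) : s n = domb n := by
  suffices s n = domb n ∧ s (n + 1) = domb (n + 1) from this.1
  induction n with
  | zero => exact ⟨by simp [h0, domb], by simp [h1, domb, Finset.sum_range_succ]⟩
  | succ n ih =>
    refine ⟨ih.2, ?_⟩
    have h2 := h n
    have h3 := dombRec_domb n
    rw [ih.1, ih.2] at h2
    have h4 : ((n : ℚ) + 2) ^ 3 ≠ 0 := by positivity
    unfold dombRec at h2 h3
    apply mul_left_cancel₀ h4
    linarith

lemma cast_choose_succ_right (n k : ℕ) :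
    (n.choose (k + 1) : ℚ) = n.choose k * (n - k) / (k + 1) := by
  have hk : (k : ℚ) + 1 ≠ 0 := by positivity
  rw [eq_div_iff hk]
  rcases le_or_gt k n with h | h
  · have := Nat.choose_succ_right_eq n k
    rw [← Nat.cast_sub h]
    exact_mod_cast this
  · rw [Nat.choose_eq_zero_of_lt h, Nat.choose_eq_zero_of_lt (by omega)]
    simp

lemma cast_choose_succ_succ (n k : ℕ) :
    ((n + 1).choose (k + 1) : ℚ) = n.choose k * (n + 1) / (k + 1) := by
  have hk : (k : ℚ) + 1 ≠ 0 := by positivity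
  rw [eq_div_iff hk]
  have := Nat.add_one_mul_choose_eq n k
  rw [mul_comm (n.choose k : ℚ)]
  exact_mod_cast this.symm

lemma cubicCoeff_mul_factorial (k : ℕ) :
    cubicCoeff k * k.factorial ^ 5 = (2 * k).factorial * (3 * k).factorial := by
  have h1 := Nat.choose_mul_factorial_mul_factorial (show k ≤ 2 * k by omega)
  have h2 := Nat.choose_mul_factorial_mul_factorial (show k ≤ 3 * k by omega)
  rw [show 2 * k - k = k by omega] at h1
  rw [show 3 * k - k = 2 * k by omega] at h2
  rw [cubicCoeff, ← h2, ← h1]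
  ring

lemma cubicCoeff_succ (k : ℕ) :
    (cubicCoeff (k + 1) : ℚ) =
      cubicCoeff k * (6 * (2 * k + 1) * (3 * k + 1) * (3 * k + 2)) / (k + 1) ^ 3 := by
  have h1 : (cubicCoeff k : ℚ) * (k.factorial : ℚ) ^ 5 =
      (2 * k).factorial * (3 * k).factorial := by
    exact_mod_cast cubicCoeff_mul_factorial k
  have h2 : (cubicCoeff (k + 1) : ℚ) * ((k + 1).factorial : ℚ) ^ 5 =
      (2 * k + 2).factorial * (3 * k + 3).factorial := by
    exact_mod_cast cubicCoeff_mul_factorial (k + 1)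
  simp only [Nat.factorial_succ] at h2
  push_cast at h2
  have hk : (k : ℚ) + 1 ≠ 0 := by positivity
  have hf : (k.factorial : ℚ) ^ 5 * (k + 1) ^ 2 ≠ 0 := by positivity
  rw [eq_div_iff (by positivity)]
  apply mul_left_cancel₀ hf
  linear_combination h2 - 6 * (2 * k + 1) * (3 * k + 1) * (3 * k + 2) * (k + 1) ^ 2 * h1

lemma sum_dombRec_quarter (n K : ℕ) :
    ∑ k ∈ Finset.range (K + 1),
      dombRec n (4 ^ n * (cubicCoeff k * (n + k).choose (3 * k)) / 16 ^ k)
        (4 ^ (n + 1) * (cubicCoeff k * (n + 1 + k).choose (3 * k)) / 16 ^ k)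
        (4 ^ (n + 2) * (cubicCoeff k * (n + 2 + k).choose (3 * k)) / 16 ^ k)
    = -24 * (2 * K + 1) * (3 * n + 4) * (n + K + 1) *
        (4 ^ n * (cubicCoeff K * (n + K).choose (3 * K)) / 16 ^ K) := by
  induction K with
  | zero =>
    simp [dombRec, cubicCoeff]
    ring
  | succ K ih =>
    rw [Finset.sum_range_succ, ih]
    have h4 : (K : ℚ) + 1 ≠ 0 := by positivity
    have h5 : (3 * K : ℚ) + 1 ≠ 0 := by positivity
    have h6 : (3 * K : ℚ) + 1 + 1 ≠ 0 := by positivity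
    rw [cubicCoeff_succ, show 3 * (K + 1) = 3 * K + 1 + 1 + 1 by ring,
      show n + (K + 1) = n + K + 1 by ring, show n + 1 + (K + 1) = n + K + 1 + 1 by ring,
      show n + 2 + (K + 1) = n + K + 1 + 1 + 1 by ring]
    simp only [cast_choose_succ_succ, cast_choose_succ_right]
    unfold dombRec
    push_cast
    field_simp
    ring

lemma domb_eq_sum_quarter (n : ℕ) :
    (domb n : ℚ) = ∑ k ∈ Finset.range (n + 1),
      (4 : ℚ) ^ n * (cubicCoeff k * (n + k).choose (3 * k)) / 16 ^ k := by
  have key : ∀ n N : ℕ, n < N →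
      ∑ k ∈ Finset.range N, (4 : ℚ) ^ n * (cubicCoeff k * (n + k).choose (3 * k)) / 16 ^ k =
      ∑ k ∈ Finset.range (n + 1),
        (4 : ℚ) ^ n * (cubicCoeff k * (n + k).choose (3 * k)) / 16 ^ k := by
    intro n N hN
    symm
    refine Finset.sum_subset (by simpa using hN) fun k _ hk => ?_
    rw [Finset.mem_range] at hk
    rw [Nat.choose_eq_zero_of_lt (by omega)]
    simp
  symm
  refine eq_domb_of_dombRec (s := fun n => ∑ k ∈ Finset.range (n + 1),
      (4 : ℚ) ^ n * (cubicCoeff k * (n + k).choose (3 * k)) / 16 ^ k) ?_ ?_ ?_ n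
  · simp [cubicCoeff]
  · simp [cubicCoeff, Finset.sum_range_succ]
  · intro n
    have h := sum_dombRec_quarter n (n + 2)
    rw [Nat.choose_eq_zero_of_lt (show n + (n + 2) < 3 * (n + 2) by omega)] at h
    simp only [dombRec, Finset.sum_add_distrib, Finset.sum_sub_distrib, ← Finset.mul_sum] at h
    rw [key n _ (by omega), key (n + 1) _ (by omega), key (n + 2) _ (by omega)] at h
    simpa [dombRec] using h

lemma sum_dombRec_sixteenth (n K : ℕ) :
    ∑ k ∈ Finset.range (K + 1),
      dombRec n (16 ^ n * (cubicCoeff k * (n + 2 * k).choose (3 * k)) / (-16 : ℚ) ^ k)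
        (16 ^ (n + 1) * (cubicCoeff k * (n + 1 + 2 * k).choose (3 * k)) / (-16 : ℚ) ^ k)
        (16 ^ (n + 2) * (cubicCoeff k * (n + 2 + 2 * k).choose (3 * k)) / (-16 : ℚ) ^ k)
    = 96 * (2 * K + 1) * (3 * n + 5) * (3 * K + 1) *
        (16 ^ n * (cubicCoeff K * (n + 2 * K + 2).choose (3 * K + 1)) / (-16 : ℚ) ^ K) := by
  induction K with
  | zero =>
    simp [dombRec, cubicCoeff]
    ring
  | succ K ih =>
    rw [Finset.sum_range_succ, ih]
    have h4 : (K : ℚ) + 1 ≠ 0 := by positivity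
    have h5 : (3 * K : ℚ) + 1 + 1 ≠ 0 := by positivity
    have h6 : (3 * K : ℚ) + 1 + 1 + 1 ≠ 0 := by positivity
    have h7 : (3 * K : ℚ) + 1 + 1 + 1 + 1 ≠ 0 := by positivity
    rw [cubicCoeff_succ, show 3 * (K + 1) = 3 * K + 1 + 1 + 1 by ring,
      show n + 2 * (K + 1) = n + 2 * K + 2 by ring,
      show n + 1 + 2 * (K + 1) = n + 2 * K + 2 + 1 by ring,
      show n + 2 + 2 * (K + 1) = n + 2 * K + 2 + 1 + 1 by ring,
      show n + 2 * K + 2 + 2 = n + 2 * K + 2 + 1 + 1 by ring, pow_succ (-16 : ℚ) K]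
    rw [cast_choose_succ_succ (n + 2 * K + 2 + 1) (3 * K + 1 + 1),
      cast_choose_succ_succ (n + 2 * K + 2) (3 * K + 1 + 1),
      cast_choose_succ_succ (n + 2 * K + 2) (3 * K + 1),
      cast_choose_succ_right (n + 2 * K + 2) (3 * K + 1 + 1),
      cast_choose_succ_right (n + 2 * K + 2) (3 * K + 1),
      cast_choose_succ_right (n + 2 * K + 2 + 1 + 1) (3 * K + 1 + 1 + 1),
      cast_choose_succ_succ (n + 2 * K + 2 + 1) (3 * K + 1 + 1),
      cast_choose_succ_succ (n + 2 * K + 2) (3 * K + 1)]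
    generalize ((n + 2 * K + 2).choose (3 * K + 1) : ℚ) = h
    unfold dombRec
    push_cast
    field_simp
    ring

lemma domb_eq_sum_sixteenth (n : ℕ) :
    (domb n : ℚ) = ∑ k ∈ Finset.range (n + 1),
      (16 : ℚ) ^ n * (cubicCoeff k * (n + 2 * k).choose (3 * k)) / (-16 : ℚ) ^ k := by
  have key : ∀ n N : ℕ, n < N →
      ∑ k ∈ Finset.range N,
        (16 : ℚ) ^ n * (cubicCoeff k * (n + 2 * k).choose (3 * k)) / (-16 : ℚ) ^ k =
      ∑ k ∈ Finset.range (n + 1),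
        (16 : ℚ) ^ n * (cubicCoeff k * (n + 2 * k).choose (3 * k)) / (-16 : ℚ) ^ k := by
    intro n N hN
    symm
    refine Finset.sum_subset (by simpa using hN) fun k _ hk => ?_
    rw [Finset.mem_range] at hk
    rw [Nat.choose_eq_zero_of_lt (by omega)]
    simp
  symm
  refine eq_domb_of_dombRec (s := fun n => ∑ k ∈ Finset.range (n + 1),
      (16 : ℚ) ^ n * (cubicCoeff k * (n + 2 * k).choose (3 * k)) / (-16 : ℚ) ^ k) ?_ ?_ ?_ n
  · simp [cubicCoeff]
  · norm_num [cubicCoeff, Finset.sum_range_succ, Nat.choose]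
  · intro n
    have h := sum_dombRec_sixteenth n (n + 2)
    rw [Nat.choose_eq_zero_of_lt (show n + 2 * (n + 2) + 2 < 3 * (n + 2) + 1 by omega)] at h
    simp only [dombRec, Finset.sum_add_distrib, Finset.sum_sub_distrib, ← Finset.mul_sum] at h
    rw [key n _ (by omega), key (n + 1) _ (by omega), key (n + 2) _ (by omega)] at h
    simpa [dombRec] using h

lemma sum_range_choose_add {a b : ℕ} (h : a ≤ b) (N : ℕ) :
    ∑ n ∈ Finset.range N, (n + a).choose b = (N + a).choose (b + 1) := by
  induction N with
  | zero => simp [Nat.choose_eq_zero_of_lt (show a < b + 1 by omega)]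
  | succ N ih =>
    rw [Finset.sum_range_succ, ih, show N + 1 + a = N + a + 1 by ring, Nat.choose_succ_succ,
      add_comm]

lemma sum_domb_div_four_pow (N : ℕ) :
    ∑ n ∈ Finset.range N, (domb n : ℚ) / 4 ^ n =
      ∑ k ∈ Finset.range N, (cubicCoeff k * (N + k).choose (3 * k + 1) : ℕ) / (16 : ℚ) ^ k := by
  have h : ∀ n ∈ Finset.range N, (domb n : ℚ) / 4 ^ n =
      ∑ k ∈ Finset.range N, (cubicCoeff k * (n + k).choose (3 * k) : ℚ) / 16 ^ k := by
    intro n hn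
    rw [domb_eq_sum_quarter, Finset.sum_div]
    have hs : Finset.range (n + 1) ⊆ Finset.range N := by
      simpa using Finset.mem_range.mp hn
    rw [← Finset.sum_subset hs]
    · refine Finset.sum_congr rfl fun k _ => ?_
      field_simp
    · intro k _ hk
      rw [Finset.mem_range] at hk
      rw [Nat.choose_eq_zero_of_lt (by omega)]
      simp
  rw [Finset.sum_congr rfl h, Finset.sum_comm]
  refine Finset.sum_congr rfl fun k _ => ?_
  rw [← Finset.sum_div, ← Finset.mul_sum, ← sum_range_choose_add (show k ≤ 3 * k by omega)]
  push_cast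
  rfl

lemma sum_domb_div_sixteen_pow (N : ℕ) :
    ∑ n ∈ Finset.range N, (domb n : ℚ) / 16 ^ n =
      ∑ k ∈ Finset.range N,
        (cubicCoeff k * (N + 2 * k).choose (3 * k + 1) : ℕ) / (-16 : ℚ) ^ k := by
  have h : ∀ n ∈ Finset.range N, (domb n : ℚ) / 16 ^ n =
      ∑ k ∈ Finset.range N, (cubicCoeff k * (n + 2 * k).choose (3 * k) : ℚ) / (-16) ^ k := by
    intro n hn
    rw [domb_eq_sum_sixteenth, Finset.sum_div]
    have hs : Finset.range (n + 1) ⊆ Finset.range N := by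
      simpa using Finset.mem_range.mp hn
    rw [← Finset.sum_subset hs]
    · refine Finset.sum_congr rfl fun k _ => ?_
      field_simp
    · intro k _ hk
      rw [Finset.mem_range] at hk
      rw [Nat.choose_eq_zero_of_lt (by omega)]
      simp
  rw [Finset.sum_congr rfl h, Finset.sum_comm]
  refine Finset.sum_congr rfl fun k _ => ?_
  rw [← Finset.sum_div, ← Finset.mul_sum, ← sum_range_choose_add (show 2 * k ≤ 3 * k by omega)]
  push_cast
  rfl

lemma sum_div_pow_eq {N : ℕ} (f : ℕ → ℤ) {q : ℤ} (hq : q ≠ 0) :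
    ∑ k ∈ Finset.range N, (f k : ℚ) / (q : ℚ) ^ k =
      ((∑ k ∈ Finset.range N, f k * q ^ (N - k) : ℤ) : ℚ) / (q : ℚ) ^ N := by
  push_cast
  rw [Finset.sum_div]
  refine Finset.sum_congr rfl fun k hk => ?_
  have hq' : (q : ℚ) ≠ 0 := by exact_mod_cast hq
  rw [div_eq_div_iff (pow_ne_zero _ hq') (pow_ne_zero _ hq'), mul_assoc, ← pow_add,
    Nat.sub_add_cancel (Finset.mem_range.mp hk).le]

lemma sum_neg_one_pow_choose_mul_choose (n K : ℕ) :
    ∑ k ∈ Finset.range (K + 1), (-1 : ℚ) ^ k * ((n + 1).choose k * (n + k).choose k) =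
      (-1) ^ K * (n.choose K * (n + 1 + K).choose K) := by
  induction K with
  | zero => simp
  | succ K ih =>
    rw [Finset.sum_range_succ, ih, show n + (K + 1) = n + K + 1 by ring,
      show n + 1 + (K + 1) = n + K + 1 + 1 by ring, show n + 1 + K = n + K + 1 by ring,
      cast_choose_succ_succ (n + K) K, cast_choose_succ_succ (n + K + 1) K,
      cast_choose_succ_succ n K, cast_choose_succ_right n K]
    have h : ((n + K + 1).choose K : ℚ) * (n + 1) = (n + K).choose K * (n + K + 1) := by
      have := Nat.choose_mul_succ_eq (n + K) K
      rw [show n + K + 1 - K = n + 1 by omega] at this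
      exact_mod_cast this.symm
    have hk : (K : ℚ) + 1 ≠ 0 := by positivity
    have hn : (n : ℚ) + 1 ≠ 0 := by positivity
    rw [← eq_div_iff hn] at h
    rw [h]
    push_cast
    field_simp
    ring

/-- The coefficients of the shifted Legendre polynomials. -/
def legendreCoeff (n k : ℕ) : ℤ := (-1) ^ k * (n.choose k * (n + k).choose k : ℕ)

lemma sum_legendreCoeff_div (n : ℕ) :
    ∑ k ∈ Finset.range (n + 1), (legendreCoeff n k : ℚ) / (3 * k + 1) =
      (∏ j ∈ Finset.range n, (3 * j + 2 : ℚ)) / ∏ j ∈ Finset.range (n + 1), (3 * j + 1 : ℚ) := by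
  induction n with
  | zero => simp [legendreCoeff]
  | succ n ih =>
    rw [Finset.prod_range_succ, Finset.prod_range_succ _ (n + 1)]
    have h1 : (3 * (n + 1) + 1 : ℚ) ≠ 0 := by positivity
    push_cast
    rw [mul_div_mul_comm, ← ih]
    have h2 : ∑ k ∈ Finset.range (n + 1), (legendreCoeff n k : ℚ) / (3 * k + 1) =
        ∑ k ∈ Finset.range (n + 1 + 1), (legendreCoeff n k : ℚ) / (3 * k + 1) := by
      rw [Finset.sum_range_succ _ (n + 1)]
      simp [legendreCoeff]
    rw [h2, mul_div_assoc', eq_div_iff h1, ← sub_eq_zero, Finset.sum_mul, Finset.sum_mul,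
      ← Finset.sum_sub_distrib]
    have h3 := sum_neg_one_pow_choose_mul_choose n (n + 1)
    rw [Nat.choose_eq_zero_of_lt (show n < n + 1 by omega)] at h3
    rw [show (0 : ℚ) = 2 * ((-1) ^ (n + 1) * ((0 : ℕ) * (n + 1 + (n + 1)).choose (n + 1))) by simp,
      ← h3, Finset.mul_sum]
    refine Finset.sum_congr rfl fun k hk => ?_
    have hk' : (3 * k + 1 : ℚ) ≠ 0 := by positivity
    have hn : (n : ℚ) + 1 ≠ 0 := by positivity
    have h4 : ((n + 1 + k).choose k : ℚ) = (n + k).choose k * (n + k + 1) / (n + 1) := by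
      have := Nat.choose_mul_succ_eq (n + k) k
      rw [show n + k + 1 - k = n + 1 by omega, show n + k + 1 = n + 1 + k by ring] at this
      rw [eq_div_iff hn]
      have h5 : (((n + 1 + k).choose k * (n + 1) : ℕ) : ℚ) =
        ((n + k).choose k * (n + 1 + k) : ℕ) := by rw [this]
      push_cast at h5
      linear_combination h5
    have h6 : (n.choose k : ℚ) = (n + 1).choose k * (n + 1 - k) / (n + 1) := by
      have := Nat.choose_mul_succ_eq n k
      have hkn : k ≤ n + 1 := by rw [Finset.mem_range] at hk; omega
      rw [eq_div_iff hn]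
      have h5 : ((n.choose k * (n + 1) : ℕ) : ℚ) = ((n + 1).choose k * (n + 1 - k) : ℕ) := by
        rw [this]
      push_cast [Nat.cast_sub hkn] at h5
      exact h5
    simp only [legendreCoeff]
    push_cast
    rw [h4, h6]
    field_simp
    ring

lemma sum_legendreCoeff_mul_prod (n : ℕ) :
    ∑ k ∈ Finset.range (n + 1), legendreCoeff n k *
      ∏ j ∈ (Finset.range (n + 1)).erase k, (3 * j + 1 : ℤ) =
      ∏ j ∈ Finset.range n, (3 * j + 2 : ℤ) := by
  have h := sum_legendreCoeff_div n
  have h0 : ∏ j ∈ Finset.range (n + 1), (3 * j + 1 : ℚ) ≠ 0 :=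
    Finset.prod_ne_zero_iff.mpr fun j _ => by positivity
  rw [eq_div_iff h0, Finset.sum_mul] at h
  have h' : ((∑ k ∈ Finset.range (n + 1), legendreCoeff n k *
      ∏ j ∈ (Finset.range (n + 1)).erase k, (3 * j + 1 : ℤ) : ℤ) : ℚ) =
      ((∏ j ∈ Finset.range n, (3 * j + 2 : ℤ) : ℤ) : ℚ) := by
    push_cast
    rw [← h]
    refine Finset.sum_congr rfl fun k hk => ?_
    rw [← Finset.mul_prod_erase _ _ hk]
    have hk' : (3 * k + 1 : ℚ) ≠ 0 := by positivity
    field_simp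
  exact_mod_cast h'

lemma legendreCoeff_succ (n k : ℕ) :
    (k + 1) ^ 2 * legendreCoeff n (k + 1) = -((n - k) * (n + k + 1)) * legendreCoeff n k := by
  have h : ((k + 1) ^ 2 * legendreCoeff n (k + 1) : ℚ) =
      -((n - k) * (n + k + 1)) * legendreCoeff n k := by
    simp only [legendreCoeff]
    push_cast
    rw [show n + (k + 1) = n + k + 1 by ring, cast_choose_succ_succ (n + k) k,
      cast_choose_succ_right n k]
    push_cast
    have hk' : (k + 1 : ℚ) ≠ 0 := by positivity
    field_simp
    ring
  exact_mod_cast h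

lemma natCast_mul_self_eq_zero (p : ℕ) : (p : ZMod (p ^ 2)) * p = 0 := by
  rw [← Nat.cast_mul, ← sq, ZMod.natCast_self]

lemma isUnit_natCast_of_not_dvd {p : ℕ} (hp : p.Prime) {k : ℕ} (h : ¬ p ∣ k) :
    IsUnit (k : ZMod (p ^ 2)) := by
  rw [ZMod.isUnit_iff_coprime]
  exact ((hp.coprime_iff_not_dvd.mpr h).symm).pow_right 2

lemma natCast_mul_inv_of_not_dvd {p : ℕ} (hp : p.Prime) {k : ℕ} (h : ¬ p ∣ k) :
    (k : ZMod (p ^ 2)) * (k : ZMod (p ^ 2))⁻¹ = 1 :=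
  ZMod.coe_mul_inv_eq_one k (((hp.coprime_iff_not_dvd.mpr h).symm).pow_right 2)

lemma not_dvd_succ_of_lt {p k : ℕ} (h : k + 1 < p) : ¬ p ∣ k + 1 :=
  Nat.not_dvd_of_pos_of_lt (Nat.succ_pos k) h

lemma isUnit_factorial {p : ℕ} (hp : p.Prime) {k : ℕ} (h : k < p) :
    IsUnit (k.factorial : ZMod (p ^ 2)) :=
  isUnit_natCast_of_not_dvd hp fun hd => absurd ((hp.dvd_factorial).mp hd) (by omega)

/-- The harmonic number `H_k` modulo `p²`. -/
def harm (p k : ℕ) : ZMod (p ^ 2) := ∑ i ∈ Finset.range k, ((i + 1 : ℕ) : ZMod (p ^ 2))⁻¹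

lemma harm_succ (p k : ℕ) :
    harm p (k + 1) = harm p k + ((k + 1 : ℕ) : ZMod (p ^ 2))⁻¹ := Finset.sum_range_succ _ _

lemma prod_range_add_eq {p : ℕ} (hp : p.Prime) {ε : ZMod (p ^ 2)} (hε : ε * ε = 0) {k : ℕ}
    (hk : k < p) :
    ∏ i ∈ Finset.range k, (((i + 1 : ℕ) : ZMod (p ^ 2)) + ε) =
      (k.factorial : ZMod (p ^ 2)) * (1 + ε * harm p k) := by
  induction k with
  | zero => simp [harm]
  | succ k ih =>
    rw [Finset.prod_range_succ, ih (by omega), Nat.factorial_succ, harm_succ, Nat.cast_mul]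
    have h := natCast_mul_inv_of_not_dvd hp (not_dvd_succ_of_lt hk)
    generalize ((k + 1 : ℕ) : ZMod (p ^ 2)) = c at *
    generalize c⁻¹ = d at *
    linear_combination (-ε * k.factorial) * h + k.factorial * harm p k * hε

lemma harm_pred {p : ℕ} (hp : p.Prime) (hp3 : 3 < p) : (p : ZMod (p ^ 2)) * harm p (p - 1) = 0 := by
  have h2 : (2 : ZMod (p ^ 2)) * (p * harm p (p - 1)) = 0 := by
    have hr : harm p (p - 1) =
        ∑ i ∈ Finset.range (p - 1), ((p - 1 - 1 - i + 1 : ℕ) : ZMod (p ^ 2))⁻¹ :=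
      (Finset.sum_range_reflect (fun i => ((i + 1 : ℕ) : ZMod (p ^ 2))⁻¹) (p - 1)).symm
    rw [two_mul]
    nth_rw 2 [hr]
    rw [harm, ← mul_add, ← Finset.sum_add_distrib, Finset.mul_sum]
    refine Finset.sum_eq_zero fun i hi => ?_
    rw [Finset.mem_range] at hi
    have e1 := natCast_mul_inv_of_not_dvd hp (not_dvd_succ_of_lt (p := p) (k := i) (by omega))
    have e2 := natCast_mul_inv_of_not_dvd hp
      (not_dvd_succ_of_lt (p := p) (k := p - 1 - 1 - i) (by omega))
    have e3 : ((i + 1 : ℕ) : ZMod (p ^ 2)) + ((p - 1 - 1 - i + 1 : ℕ) : ZMod (p ^ 2)) = p := by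
      rw [← Nat.cast_add]
      congr 1
      omega
    have e4 := natCast_mul_self_eq_zero p
    generalize ((i + 1 : ℕ) : ZMod (p ^ 2)) = a at *
    generalize ((p - 1 - 1 - i + 1 : ℕ) : ZMod (p ^ 2)) = b at *
    generalize a⁻¹ = a' at *
    generalize b⁻¹ = b' at *
    generalize (p : ZMod (p ^ 2)) = q at *
    linear_combination a' * b' * e4 + (-q * b') * e1 + (-q * a') * e2 + q * a' * b' * e3
  have hu : IsUnit ((2 : ℕ) : ZMod (p ^ 2)) :=
    isUnit_natCast_of_not_dvd hp (Nat.not_dvd_of_pos_of_lt two_pos (by omega))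
  exact (hu.mul_right_eq_zero).mp (by exact_mod_cast h2)

lemma harm_reflect {p : ℕ} (hp : p.Prime) (hp3 : 3 < p) {k : ℕ} (hk : k < p) :
    (p : ZMod (p ^ 2)) * harm p (p - 1 - k) = p * harm p k := by
  induction k with
  | zero => simpa [harm] using harm_pred hp hp3
  | succ k ih =>
    have h := ih (by omega)
    rw [show p - 1 - k = p - 1 - (k + 1) + 1 by omega, harm_succ] at h
    rw [harm_succ]
    have e1 := natCast_mul_inv_of_not_dvd hp (not_dvd_succ_of_lt hk)
    have e2 := natCast_mul_inv_of_not_dvd hp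
      (not_dvd_succ_of_lt (p := p) (k := p - 1 - (k + 1)) (by omega))
    have e3 : ((k + 1 : ℕ) : ZMod (p ^ 2)) + ((p - 1 - (k + 1) + 1 : ℕ) : ZMod (p ^ 2)) = p := by
      rw [← Nat.cast_add]
      congr 1
      omega
    have e4 := natCast_mul_self_eq_zero p
    generalize ((k + 1 : ℕ) : ZMod (p ^ 2)) = a at *
    generalize ((p - 1 - (k + 1) + 1 : ℕ) : ZMod (p ^ 2)) = b at *
    generalize a⁻¹ = a' at *
    generalize b⁻¹ = b' at *
    generalize (p : ZMod (p ^ 2)) = q at *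
    linear_combination h - (a' * b' * e4 + (-q * b') * e1 + (-q * a') * e2 + q * a' * b' * e3)

lemma centralBinom_sq_eq {p n : ℕ} (hp : p.Prime) (hn : p = 2 * n + 1) {k : ℕ} (hk : k ≤ n) :
    (k.centralBinom : ZMod (p ^ 2)) ^ 2 = 16 ^ k * legendreCoeff n k := by
  induction k with
  | zero => simp [legendreCoeff]
  | succ k ih =>
    have h0 := ih (by omega)
    have h1 : ((k : ZMod (p ^ 2)) + 1) * (k + 1).centralBinom =
        2 * (2 * k + 1) * k.centralBinom := by
      exact_mod_cast congrArg (Nat.cast : ℕ → ZMod (p ^ 2)) (Nat.succ_mul_centralBinom_succ k)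
    have h2 : ((k : ZMod (p ^ 2)) + 1) ^ 2 * legendreCoeff n (k + 1) =
        -((n - k) * (n + k + 1)) * legendreCoeff n k := by
      exact_mod_cast congrArg (Int.cast : ℤ → ZMod (p ^ 2)) (legendreCoeff_succ n k)
    have h3 : (2 * n + 1 : ZMod (p ^ 2)) * (2 * n + 1) = 0 := by
      have := natCast_mul_self_eq_zero p
      have hc : (p : ZMod (p ^ 2)) = 2 * n + 1 := by
        exact_mod_cast congrArg (Nat.cast : ℕ → ZMod (p ^ 2)) hn
      rwa [hc] at this
    have hu : IsUnit (((k + 1 : ℕ) : ZMod (p ^ 2)) ^ 2) :=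
      (isUnit_natCast_of_not_dvd hp (not_dvd_succ_of_lt (by omega))).pow 2
    apply hu.mul_left_cancel
    push_cast
    rw [pow_succ 16 k]
    linear_combination ((k + 1 : ZMod (p ^ 2)) * (k + 1).centralBinom +
        2 * (2 * k + 1) * k.centralBinom) * h1 + 4 * (2 * k + 1) ^ 2 * h0
        - 16 * 16 ^ k * h2 + 4 * 16 ^ k * legendreCoeff n k * h3

lemma choose_add_mul_factorial (p a : ℕ) {b : ℕ} (hb : b < p) :
    ((p + a).choose (a + b + 1) * (a + b + 1).factorial : ℤ) =
      p * ((∏ i ∈ Finset.range a, (((i + 1 : ℕ) : ℤ) + p)) *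
        ((-1) ^ b * ∏ j ∈ Finset.range b, (((j + 1 : ℕ) : ℤ) + -p))) := by
  have key : ((p + a).choose (a + b + 1) * (a + b + 1).factorial : ℤ) =
      (p + a).descFactorial (a + b + 1) := by
    rw [Nat.descFactorial_eq_factorial_mul_choose]
    push_cast
    ring
  rw [key]
  clear key
  induction b with
  | zero =>
    induction a with
    | zero => simp
    | succ a ih =>
      rw [show p + (a + 1) = p + a + 1 by ring, show a + 1 + 0 + 1 = a + 0 + 1 + 1 by ring,
        Nat.succ_descFactorial_succ, Nat.cast_mul, ih, Finset.prod_range_succ]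
      push_cast
      ring
  | succ b ih =>
    rw [show a + (b + 1) + 1 = a + b + 1 + 1 by ring, Nat.descFactorial_succ, Nat.cast_mul,
      ih (by omega), Finset.prod_range_succ,
      show p + a - (a + b + 1) = p - (b + 1) by omega, Nat.cast_sub hb.le, pow_succ]
    push_cast
    ring

/-- The fraction `p / (3k + 1)`, as an element of `ℤ / p²`. -/
def fracWeight (p k : ℕ) : ZMod (p ^ 2) :=
  if 3 * k + 1 = p then 1 else p * ((3 * k + 1 : ℕ) : ZMod (p ^ 2))⁻¹

lemma centralBinom_mul_factorial_sq (k : ℕ) :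
    k.centralBinom * k.factorial ^ 2 = (2 * k).factorial := by
  have h1 := Nat.choose_mul_factorial_mul_factorial (show k ≤ 2 * k by omega)
  rw [show 2 * k - k = k by omega] at h1
  rw [Nat.centralBinom, ← h1]
  ring

lemma cubicCoeff_mul_choose_eq {p n k a b : ℕ} (hp : p.Prime) (hp3 : 3 < p) (hn : p = 2 * n + 1)
    (hk : k ≤ n) (hab : (a = k ∧ b = 2 * k) ∨ (a = 2 * k ∧ b = k)) :
    ((cubicCoeff k * (p + a).choose (3 * k + 1) : ℕ) : ZMod (p ^ 2)) =
      (-1) ^ b * k.centralBinom ^ 2 * fracWeight p k := by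
  have hsum : a + b = 3 * k := by omega
  have ha : a < p := by omega
  have hb : b < p := by omega
  have hI := choose_add_mul_factorial p a hb
  rw [hsum, Nat.factorial_succ] at hI
  have hc : (cubicCoeff k : ℤ) * (k.factorial : ℤ) ^ 5 = (2 * k).factorial * (3 * k).factorial := by
    exact_mod_cast cubicCoeff_mul_factorial k
  set X : ℤ := (∏ i ∈ Finset.range a, (((i + 1 : ℕ) : ℤ) + p)) *
        ((-1) ^ b * ∏ j ∈ Finset.range b, (((j + 1 : ℕ) : ℤ) + -p)) with hX
  have hJ : ((k.factorial : ℤ) ^ 5 * (cubicCoeff k * (p + a).choose (3 * k + 1) : ℕ)) *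
      (3 * k + 1 : ℕ) = (2 * k).factorial * X * p := by
    push_cast at hI ⊢
    linear_combination (2 * k).factorial * hI + (p + a).choose (3 * k + 1) * (3 * k + 1) * hc
  have hpp := natCast_mul_self_eq_zero p
  have hpp' : (-p : ZMod (p ^ 2)) * -p = 0 := by rw [neg_mul_neg, hpp]
  have hXR : (X : ZMod (p ^ 2)) = (-1) ^ b * (k.factorial * (2 * k).factorial) *
      (1 + p * (harm p a - harm p b)) := by
    rw [hX]
    push_cast
    have e1 := prod_range_add_eq hp hpp ha
    have e2 := prod_range_add_eq hp hpp' hb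
    push_cast at e1 e2
    rw [e1, e2]
    have e3 : (k.factorial * (2 * k).factorial : ZMod (p ^ 2)) = a.factorial * b.factorial := by
      rcases hab with ⟨rfl, rfl⟩ | ⟨rfl, rfl⟩ <;> ring
    rw [e3]
    linear_combination (-(-1) ^ b * a.factorial * b.factorial * harm p a * harm p b) * hpp
  have hcb : (k.centralBinom * k.factorial ^ 2 : ZMod (p ^ 2)) = (2 * k).factorial := by
    exact_mod_cast congrArg (Nat.cast : ℕ → ZMod (p ^ 2)) (centralBinom_mul_factorial_sq k)
  have hu : IsUnit ((k.factorial : ZMod (p ^ 2)) ^ 5) :=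
    (isUnit_factorial hp (by omega)).pow 5
  apply hu.mul_left_cancel
  unfold fracWeight
  split_ifs with h
  · have hp0 : (p : ℤ) ≠ 0 := by exact_mod_cast hp.ne_zero
    rw [h] at hJ
    have hJ' := congrArg (Int.cast : ℤ → ZMod (p ^ 2)) (mul_right_cancel₀ hp0 hJ)
    rw [h]
    push_cast at hJ' ⊢
    rw [hJ', hXR]
    have hH : (p : ZMod (p ^ 2)) * (harm p a - harm p b) = 0 := by
      have := harm_reflect hp hp3 (k := k) (by omega)
      rw [show p - 1 - k = 2 * k by omega] at this
      rcases hab with ⟨rfl, rfl⟩ | ⟨rfl, rfl⟩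
      · rw [mul_sub, this, sub_self]
      · rw [mul_sub, this, sub_self]
    rw [hH, ← hcb]
    ring
  · have hnd : ¬ p ∣ 3 * k + 1 := by
      rintro ⟨c, hc⟩
      rcases c with _ | _ | c
      · omega
      · omega
      · have : p * (c + 1 + 1) = p * c + 2 * p := by ring
        have : 0 ≤ p * c := Nat.zero_le _
        omega
    have hinv := natCast_mul_inv_of_not_dvd hp hnd
    have hJ' := congrArg (Int.cast : ℤ → ZMod (p ^ 2)) hJ
    rw [Int.cast_mul, Int.cast_mul _ (p : ℤ), Int.cast_mul _ X, hXR] at hJ'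
    simp only [Int.cast_natCast, Int.cast_mul, Int.cast_pow] at hJ'
    rw [← hcb] at hJ'
    generalize ((3 * k + 1 : ℕ) : ZMod (p ^ 2)) = t at *
    generalize t⁻¹ = t' at *
    generalize ((cubicCoeff k * (p + a).choose (3 * k + 1) : ℕ) : ZMod (p ^ 2)) = T at *
    linear_combination t' * hJ' - k.factorial ^ 5 * T * hinv +
      t' * k.centralBinom ^ 2 * k.factorial ^ 5 * (-1) ^ b * (harm p a - harm p b) * hpp

lemma cubicCoeff_eq_zero {p n k : ℕ} (hp : p.Prime) (hn : p = 2 * n + 1) (hk : n < k)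
    (hkp : k < p) : (cubicCoeff k : ZMod (p ^ 2)) = 0 := by
  rw [ZMod.natCast_eq_zero_iff, cubicCoeff]
  apply Dvd.dvd.mul_right
  apply pow_dvd_pow_of_dvd
  have h : p ∣ (2 * k).choose k * k.factorial * (2 * k - k).factorial := by
    rw [Nat.choose_mul_factorial_mul_factorial (by omega)]
    exact hp.dvd_factorial.mpr (by omega)
  rw [show 2 * k - k = k by omega, mul_assoc] at h
  rcases hp.dvd_mul.mp h with h | h
  · exact h
  · exfalso
    rcases hp.dvd_mul.mp h with h | h <;> exact absurd (hp.dvd_factorial.mp h) (by omega)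

/-- The common value modulo `p²` of the two sums of Domb numbers. -/
def dombSum (p n : ℕ) : ZMod (p ^ 2) :=
  ∑ k ∈ Finset.range (n + 1), legendreCoeff n k * fracWeight p k

lemma sum_mul_pow_eq_dombSum {p n : ℕ} (hp : p.Prime) (hp3 : 3 < p) (hn : p = 2 * n + 1)
    (f : ℕ → ℤ)
    (hf : ∀ k ≤ n, (f k : ZMod (p ^ 2)) = k.centralBinom ^ 2 * fracWeight p k)
    (hf' : ∀ k, n < k → k < p → (f k : ZMod (p ^ 2)) = 0) :
    ((∑ k ∈ Finset.range p, f k * 16 ^ (p - k) : ℤ) : ZMod (p ^ 2)) =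
      16 ^ p * dombSum p n := by
  push_cast
  have hs : Finset.range (n + 1) ⊆ Finset.range p := Finset.range_subset_range.mpr (by omega)
  rw [← Finset.sum_subset hs, dombSum, Finset.mul_sum]
  · refine Finset.sum_congr rfl fun k hk => ?_
    have hkn : k ≤ n := Nat.lt_succ_iff.mp (Finset.mem_range.mp hk)
    rw [hf k hkn, centralBinom_sq_eq hp hn hkn]
    have : (16 : ZMod (p ^ 2)) ^ p = 16 ^ k * 16 ^ (p - k) := by
      rw [← pow_add]
      congr 1
      omega
    rw [this]
    ring
  · intro k hk hk'
    rw [Finset.mem_range] at hk hk'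
    rw [hf' k (by omega) hk, zero_mul]

lemma dombSum_eq_four {p n : ℕ} (hp : p.Prime) (hp3 : 3 < p) (hn : p = 2 * n + 1) :
    ∃ a : ℤ, ∑ n ∈ Finset.range p, (domb n : ℚ) / 4 ^ n = a / 16 ^ p ∧
      (a : ZMod (p ^ 2)) = 16 ^ p * dombSum p n := by
  refine ⟨_, ?_, sum_mul_pow_eq_dombSum hp hp3 hn
    (fun k => (cubicCoeff k * (p + k).choose (3 * k + 1) : ℕ)) ?_ ?_⟩
  · rw [sum_domb_div_four_pow]
    have := sum_div_pow_eq (N := p)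
      (fun k => (cubicCoeff k * (p + k).choose (3 * k + 1) : ℕ)) (q := 16) (by norm_num)
    push_cast at this ⊢
    exact this
  · intro k hk
    rw [Int.cast_natCast, cubicCoeff_mul_choose_eq hp hp3 hn hk (Or.inl ⟨rfl, rfl⟩)]
    simp
  · intro k hk hkp
    simp [cubicCoeff_eq_zero hp hn hk hkp]

lemma dombSum_eq_sixteen {p n : ℕ} (hp : p.Prime) (hp3 : 3 < p) (hn : p = 2 * n + 1) :
    ∃ a : ℤ, ∑ n ∈ Finset.range p, (domb n : ℚ) / 16 ^ n = a / 16 ^ p ∧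
      (a : ZMod (p ^ 2)) = 16 ^ p * dombSum p n := by
  refine ⟨_, ?_, sum_mul_pow_eq_dombSum hp hp3 hn
    (fun k => (-1) ^ k * (cubicCoeff k * (p + 2 * k).choose (3 * k + 1) : ℕ)) ?_ ?_⟩
  · rw [sum_domb_div_sixteen_pow]
    have := sum_div_pow_eq (N := p)
      (fun k => (-1) ^ k * (cubicCoeff k * (p + 2 * k).choose (3 * k + 1) : ℕ)) (q := 16)
      (by norm_num)
    push_cast at this ⊢
    rw [← this]
    refine Finset.sum_congr rfl fun k _ => ?_
    rw [show (-16 : ℚ) = (-1) * 16 by norm_num, mul_pow, ← div_div, div_left_inj' (by positivity),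
      div_eq_iff (by simp)]
    have : ((-1 : ℚ) ^ k) * (-1) ^ k = 1 := by rw [← mul_pow]; simp
    linear_combination (-(cubicCoeff k * (p + 2 * k).choose (3 * k + 1) : ℚ)) * this
  · intro k hk
    rw [Int.cast_mul, Int.cast_natCast, Int.cast_pow, Int.cast_neg, Int.cast_one]
    rw [cubicCoeff_mul_choose_eq hp hp3 hn hk (Or.inr ⟨rfl, rfl⟩), mul_assoc, ← mul_assoc,
      ← mul_pow]
    simp
  · intro k hk hkp
    simp [cubicCoeff_eq_zero hp hn hk hkp]

lemma fracWeight_mul (p k : ℕ) (hp : p.Prime) (h : 3 * k + 1 ≠ p) (hk : 3 * k + 1 < 2 * p) :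
    fracWeight p k * (3 * k + 1 : ℕ) = p := by
  have hnd : ¬ p ∣ 3 * k + 1 := by
    rintro ⟨c, hc⟩
    rcases c with _ | _ | c
    · omega
    · omega
    · have : p * (c + 1 + 1) = p * c + 2 * p := by ring
      have : 0 ≤ p * c := Nat.zero_le _
      omega
  rw [fracWeight, if_neg h, mul_assoc, mul_comm _ ((3 * k + 1 : ℕ) : ZMod (p ^ 2)),
    natCast_mul_inv_of_not_dvd hp hnd, mul_one]

lemma cast_sum_legendreCoeff_mul_prod (p n : ℕ) :
    ∑ k ∈ Finset.range (n + 1), (legendreCoeff n k : ZMod (p ^ 2)) *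
      ∏ j ∈ (Finset.range (n + 1)).erase k, ((3 * j + 1 : ℕ) : ZMod (p ^ 2)) =
      ∏ j ∈ Finset.range n, ((3 * j + 2 : ℕ) : ZMod (p ^ 2)) := by
  have h := congrArg (Int.cast : ℤ → ZMod (p ^ 2)) (sum_legendreCoeff_mul_prod n)
  push_cast at h ⊢
  exact h

lemma dombSum_eq_zero {p n : ℕ} (hp : p.Prime) (hp3 : 3 < p) (hn : p = 2 * n + 1)
    (h3 : p % 3 = 2) : dombSum p n = 0 := by
  set Q : ZMod (p ^ 2) := ∏ j ∈ Finset.range (n + 1), ((3 * j + 1 : ℕ) : ZMod (p ^ 2)) with hQ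
  have hu : IsUnit Q := by
    rw [hQ]
    refine (IsUnit.prod_iff (s := Finset.range (n + 1))).mpr fun j hj => ?_
    rw [Finset.mem_range] at hj
    refine isUnit_natCast_of_not_dvd hp ?_
    rintro ⟨c, hc⟩
    rcases c with _ | _ | c
    · omega
    · omega
    · have : p * (c + 1 + 1) = p * c + 2 * p := by ring
      have : 0 ≤ p * c := Nat.zero_le _
      omega
  have hS : dombSum p n * Q = p * ∏ j ∈ Finset.range n, ((3 * j + 2 : ℕ) : ZMod (p ^ 2)) := by
    rw [← cast_sum_legendreCoeff_mul_prod, dombSum, Finset.sum_mul, Finset.mul_sum]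
    refine Finset.sum_congr rfl fun k hk => ?_
    have hk' := Finset.mem_range.mp hk
    rw [hQ, ← Finset.mul_prod_erase _ _ hk]
    have := fracWeight_mul p k hp (by omega) (by omega)
    rw [← this]
    ring
  have hmem : (p - 2) / 3 ∈ Finset.range n := Finset.mem_range.mpr (by omega)
  rw [← Finset.mul_prod_erase _ _ hmem, show 3 * ((p - 2) / 3) + 2 = p by omega, ← mul_assoc,
    natCast_mul_self_eq_zero, zero_mul] at hS
  exact (hu.mul_left_eq_zero).mp hS

lemma dombSum_mul_prod {p m : ℕ} (hp : p.Prime) (hm : p = 6 * m + 1) :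
    dombSum p (3 * m) *
      ∏ j ∈ (Finset.range (3 * m + 1)).erase (2 * m), ((3 * j + 1 : ℕ) : ZMod (p ^ 2)) =
      ∏ j ∈ Finset.range (3 * m), ((3 * j + 2 : ℕ) : ZMod (p ^ 2)) := by
  rw [← cast_sum_legendreCoeff_mul_prod, dombSum, Finset.sum_mul]
  refine Finset.sum_congr rfl fun k hk => ?_
  have hk' := Finset.mem_range.mp hk
  rw [mul_assoc]
  congr 1
  have h2m : 2 * m ∈ Finset.range (3 * m + 1) := Finset.mem_range.mpr (by omega)
  by_cases h : k = 2 * m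
  · rw [h, fracWeight, if_pos (by omega), one_mul]
  · rw [← Finset.mul_prod_erase ((Finset.range (3 * m + 1)).erase (2 * m)) _
        (Finset.mem_erase.mpr ⟨h, hk⟩),
      ← Finset.mul_prod_erase ((Finset.range (3 * m + 1)).erase k) _
        (Finset.mem_erase.mpr ⟨Ne.symm h, h2m⟩), Finset.erase_right_comm, ← mul_assoc,
      fracWeight_mul p k hp (by omega) (by omega), show 3 * (2 * m) + 1 = p by omega]

lemma prod_erase_three_mul_add_one {R : Type*} [CommRing R] (m : ℕ) :
    ∏ j ∈ (Finset.range (3 * m + 1)).erase (2 * m), ((3 * j + 1 : ℕ) : R) =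
      (∏ i ∈ Finset.range (2 * m), ((6 * m + 1 : ℕ) - 3 * ((i + 1 : ℕ) : R))) *
      ∏ i ∈ Finset.range m, ((6 * m + 1 : ℕ) + 3 * ((i + 1 : ℕ) : R)) := by
  have h1 : (Finset.range (3 * m + 1)).erase (2 * m) =
      (Finset.range (2 * m)) ∪ Finset.Ico (2 * m + 1) (3 * m + 1) := by
    ext j
    simp only [Finset.mem_erase, Finset.mem_range, Finset.mem_union, Finset.mem_Ico]
    omega
  rw [h1, Finset.prod_union]
  · congr 1
    · rw [← Finset.prod_range_reflect]
      refine Finset.prod_congr rfl fun i hi => ?_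
      rw [Finset.mem_range] at hi
      have : ((3 * (2 * m - 1 - i) + 1 : ℕ) : R) + 3 * ((i + 1 : ℕ) : R) = (6 * m + 1 : ℕ) := by
        have : 3 * (2 * m - 1 - i) + 1 + 3 * (i + 1) = 6 * m + 1 := by omega
        exact_mod_cast congrArg (Nat.cast : ℕ → R) this
      rw [← this]
      ring
    · rw [Finset.prod_Ico_eq_prod_range, show 3 * m + 1 - (2 * m + 1) = m by omega]
      refine Finset.prod_congr rfl fun i _ => ?_
      push_cast
      ring
  · rw [Finset.disjoint_left]
    intro j hj hj'
    rw [Finset.mem_range] at hj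
    rw [Finset.mem_Ico] at hj'
    omega

lemma prod_three_mul_add_two {R : Type*} [CommRing R] (m : ℕ) :
    (∏ i ∈ Finset.range m, (2 * (6 * m + 1 : ℕ) - 3 * ((i + 1 : ℕ) : R))) *
      ∏ j ∈ Finset.range (3 * m), ((3 * j + 2 : ℕ) : R) =
      ∏ i ∈ Finset.range (4 * m), (2 * (6 * m + 1 : ℕ) - 3 * ((i + 1 : ℕ) : R)) := by
  rw [show 4 * m = m + 3 * m by ring, Finset.prod_range_add]
  congr 1
  rw [← Finset.prod_range_reflect]
  refine Finset.prod_congr rfl fun i hi => ?_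
  rw [Finset.mem_range] at hi
  have : ((3 * (3 * m - 1 - i) + 2 : ℕ) : R) + 3 * ((m + i + 1 : ℕ) : R) =
      2 * (6 * m + 1 : ℕ) := by
    have : 3 * (3 * m - 1 - i) + 2 + 3 * (m + i + 1) = 2 * (6 * m + 1) := by omega
    exact_mod_cast congrArg (Nat.cast : ℕ → R) this
  rw [← this]
  ring

lemma factorial_pred_eq {p : ℕ} (hp : p.Prime) {k : ℕ} (hk : k < p) :
    ((p - 1).factorial : ZMod (p ^ 2)) =
      ((p - 1 - k).factorial : ZMod (p ^ 2)) * ((-1) ^ k * ((k.factorial : ZMod (p ^ 2)) * (1 - p * harm p k))) := by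
  have h := prod_range_add_eq hp
    (show (-p : ZMod (p ^ 2)) * -p = 0 by rw [neg_mul_neg, natCast_mul_self_eq_zero]) hk
  rw [neg_mul, ← sub_eq_add_neg] at h
  rw [← h]
  clear h
  induction k with
  | zero => simp
  | succ k ih =>
    rw [ih (by omega), Finset.prod_range_succ, show p - 1 - k = p - 1 - (k + 1) + 1 by omega,
      Nat.factorial_succ, show p - 1 - (k + 1) + 1 = p - (k + 1) by omega, Nat.cast_mul,
      Nat.cast_sub hk.le]
    push_cast
    ring

lemma dombSum_mul_factorial {p m : ℕ} (hp : p.Prime) (hm : p = 6 * m + 1) {t : ZMod (p ^ 2)}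
    (ht : 3 * t = 1) :
    dombSum p (3 * m) * (((2 * m).factorial : ZMod (p ^ 2)) * (m.factorial : ZMod (p ^ 2))) ^ 2 =
      ((3 * m).factorial : ZMod (p ^ 2)) ^ 2 *
        (1 - (p : ZMod (p ^ 2)) * t * (3 * harm p (3 * m) - 2 * harm p (2 * m) - harm p m)) := by
  have hm0 : 0 < m := by
    rcases Nat.eq_zero_or_pos m with rfl | h
    · exact absurd hp (by rw [hm]; norm_num)
    · exact h
  have hp3 : 3 < p := by omega
  have hpp := natCast_mul_self_eq_zero p
  have hS := dombSum_mul_prod hp hm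
  rw [prod_erase_three_mul_add_one] at hS
  have hT := prod_three_mul_add_two (R := ZMod (p ^ 2)) m
  have hpc : ((6 * m + 1 : ℕ) : ZMod (p ^ 2)) = p := congrArg Nat.cast hm.symm
  rw [hpc] at hS hT
  have hneg (k : ℕ) (c : ZMod (p ^ 2)) (hk : k < p) :
      ∏ i ∈ Finset.range k, (c * (p : ZMod (p ^ 2)) - 3 * ((i + 1 : ℕ) : ZMod (p ^ 2))) =
        (-3) ^ k * ((k.factorial : ZMod (p ^ 2)) * (1 - c * (p : ZMod (p ^ 2)) * t * harm p k)) := by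
    have h := prod_range_add_eq hp (ε := -(c * p * t)) (k := k)
      (by linear_combination c ^ 2 * t ^ 2 * hpp) hk
    rw [neg_mul, ← sub_eq_add_neg] at h
    rw [← h, ← Finset.card_range k, ← Finset.prod_const, Finset.card_range,
      ← Finset.prod_mul_distrib]
    refine Finset.prod_congr rfl fun i _ => ?_
    linear_combination (-c * p) * ht
  have hpos : ∏ i ∈ Finset.range m, ((p : ZMod (p ^ 2)) + 3 * ((i + 1 : ℕ) : ZMod (p ^ 2))) =
        3 ^ m * ((m.factorial : ZMod (p ^ 2)) * (1 + p * t * harm p m)) := by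
    have h := prod_range_add_eq hp (ε := p * t) (k := m)
      (by linear_combination t ^ 2 * hpp) (by omega)
    rw [← h, ← Finset.card_range m, ← Finset.prod_const, Finset.card_range,
      ← Finset.prod_mul_distrib]
    refine Finset.prod_congr rfl fun i _ => ?_
    linear_combination (-p) * ht
  have e1 := hneg (2 * m) 1 (by omega)
  rw [one_mul] at e1
  rw [e1, hpos] at hS
  rw [hneg m 2 (by omega), hneg (4 * m) 2 (by omega), ← hS] at hT
  have f1 := factorial_pred_eq hp (show 2 * m < p by omega)
  have f2 := factorial_pred_eq hp (show 3 * m < p by omega)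
  rw [f1, show p - 1 - 2 * m = 4 * m by omega, show p - 1 - 3 * m = 3 * m by omega] at f2
  have hH := harm_reflect hp hp3 (show 2 * m < p by omega)
  rw [show p - 1 - 2 * m = 4 * m by omega] at hH
  have hu3 : IsUnit (((-3 : ZMod (p ^ 2)) ^ m) ^ 4) := by
    have : IsUnit (-3 : ZMod (p ^ 2)) := (IsUnit.of_mul_eq_one t ht).neg
    exact (this.pow m).pow 4
  have hs : ((-1 : ZMod (p ^ 2)) ^ m) ^ 2 = 1 := by rw [← pow_mul, mul_comm, pow_mul]; simp
  have h3m : (3 : ZMod (p ^ 2)) ^ m = (-1) ^ m * (-3) ^ m := by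
    rw [← mul_pow]; norm_num
  have h1m : (-1 : ZMod (p ^ 2)) ^ (3 * m) = (-1) ^ m := by
    rw [pow_mul]; norm_num
  have h2m : (-1 : ZMod (p ^ 2)) ^ (2 * m) = 1 := by
    rw [pow_mul]; norm_num
  rw [show (-3 : ZMod (p ^ 2)) ^ (4 * m) = ((-3) ^ m) ^ 4 by rw [← pow_mul, mul_comm],
    show (-3 : ZMod (p ^ 2)) ^ (2 * m) = ((-3) ^ m) ^ 2 by rw [← pow_mul, mul_comm], h3m] at hT
  have hT' : dombSum p (3 * m) * ((-1) ^ m * ((2 * m).factorial * m.factorial ^ 2 : ZMod (p ^ 2))) *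
      (1 - p * t * (harm p m + harm p (2 * m))) =
      ((4 * m).factorial : ZMod (p ^ 2)) * (1 - 2 * p * t * harm p (2 * m)) := by
    apply hu3.mul_left_cancel
    generalize ((-3 : ZMod (p ^ 2)) ^ m) = w at *
    generalize ((-1 : ZMod (p ^ 2)) ^ m) = s at *
    generalize harm p m = x at *
    generalize harm p (2 * m) = y at *
    generalize harm p (4 * m) = v at *
    generalize dombSum p (3 * m) = S at *
    linear_combination hT - w ^ 4 * (4 * m).factorial * 2 * t * hH -
      w ^ 4 * S * s * (2 * m).factorial * m.factorial ^ 2 * t ^ 2 *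
        (-2 * x ^ 2 + x * y + 2 * p * t * x ^ 2 * y) * hpp
  rw [h1m, h2m] at f2
  clear hT hS hH hu3 h1m h2m h3m f1 e1 hpos hneg
  generalize ((-1 : ZMod (p ^ 2)) ^ m) = s at *
  generalize harm p m = x at *
  generalize harm p (2 * m) = y at *
  generalize harm p (3 * m) = z at *
  generalize dombSum p (3 * m) = S at *
  generalize (p : ZMod (p ^ 2)) = q at *
  generalize ((2 * m).factorial : ZMod (p ^ 2)) = M at *
  generalize ((3 * m).factorial : ZMod (p ^ 2)) = F at *
  generalize ((4 * m).factorial : ZMod (p ^ 2)) = G at *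
  generalize (m.factorial : ZMod (p ^ 2)) = N at *
  have a1 : S * (s * (M * N ^ 2)) = G * (1 + q * t * (x - y)) := by
    linear_combination (1 + q * t * (x + y)) * hT' +
      t ^ 2 * (S * s * M * N ^ 2 * (x + y) ^ 2 - 2 * G * y * (x + y)) * hpp
  have a2 : G * M = s * F ^ 2 * (1 + q * (y - z)) := by
    linear_combination (1 + q * y) * f2 + (G * M * y ^ 2 - s * F ^ 2 * z * y) * hpp
  linear_combination s * M * a1 + s * (1 + q * t * (x - y)) * a2 +
    (-S * M ^ 2 * N ^ 2 + F ^ 2 * (1 + q * (y - z)) * (1 + q * t * (x - y))) * hs -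
    F ^ 2 * q * (y - z) * ht + F ^ 2 * t * (y - z) * (x - y) * hpp

lemma pow_eq_pow_of_castHom_eq {p : ℕ} {x y : ZMod (p ^ 2)}
    (h : ZMod.castHom (dvd_pow_self p two_ne_zero) (ZMod p) x =
      ZMod.castHom (dvd_pow_self p two_ne_zero) (ZMod p) y) : x ^ p = y ^ p := by
  obtain ⟨a, rfl⟩ := ZMod.intCast_surjective x
  obtain ⟨b, rfl⟩ := ZMod.intCast_surjective y
  rw [map_intCast, map_intCast, ← sub_eq_zero, ← Int.cast_sub, ZMod.intCast_zmod_eq_zero_iff_dvd]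
    at h
  have h2 := dvd_sub_pow_of_dvd_sub h 1
  rw [pow_one, ← Nat.cast_pow] at h2
  rw [← sub_eq_zero, ← Int.cast_pow, ← Int.cast_pow, ← Int.cast_sub,
    ZMod.intCast_zmod_eq_zero_iff_dvd]
  exact h2

/-- The Teichmüller lift modulo `p²`. -/
def teich (p : ℕ) [Fact p.Prime] : ZMod p →* ZMod (p ^ 2) where
  toFun a := (a.val : ZMod (p ^ 2)) ^ p
  map_one' := by
    rw [ZMod.val_one]
    simp
  map_mul' a b := by
    rw [← mul_pow]
    apply pow_eq_pow_of_castHom_eq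
    rw [map_mul, map_natCast, map_natCast, map_natCast]
    simp only [ZMod.natCast_zmod_val]

lemma teich_castHom (p : ℕ) [Fact p.Prime] (x : ZMod (p ^ 2)) :
    teich p (ZMod.castHom (dvd_pow_self p two_ne_zero) (ZMod p) x) = x ^ p := by
  refine pow_eq_pow_of_castHom_eq ?_
  rw [map_natCast, ZMod.natCast_zmod_val]

lemma castHom_teich (p : ℕ) [Fact p.Prime] (a : ZMod p) :
    ZMod.castHom (dvd_pow_self p two_ne_zero) (ZMod p) (teich p a) = a := by
  change ZMod.castHom _ (ZMod p) ((a.val : ZMod (p ^ 2)) ^ p) = a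
  rw [map_pow, map_natCast, ZMod.natCast_zmod_val, ZMod.pow_card]

lemma teich_pow_card (p : ℕ) [Fact p.Prime] (a : ZMod p) : teich p a ^ p = teich p a := by
  rw [← teich_castHom, castHom_teich]

lemma teich_one_sub (p : ℕ) [Fact p.Prime] (a : ZMod p) :
    teich p (1 - a) = (1 - teich p a) ^ p := by
  rw [← teich_castHom p (1 - teich p a), RingHom.map_sub, RingHom.map_one, castHom_teich]

lemma teich_zero (p : ℕ) [Fact p.Prime] : teich p 0 = 0 := by
  change ((0 : ZMod p).val : ZMod (p ^ 2)) ^ p = 0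
  rw [ZMod.val_zero, Nat.cast_zero, zero_pow (Fact.out : p.Prime).ne_zero]

lemma isUnit_of_castHom_ne_zero {p : ℕ} [Fact p.Prime] {x : ZMod (p ^ 2)}
    (h : ZMod.castHom (dvd_pow_self p two_ne_zero) (ZMod p) x ≠ 0) : IsUnit x := by
  have : NeZero (p ^ 2) := ⟨pow_ne_zero 2 (Fact.out : p.Prime).ne_zero⟩
  rw [← ZMod.natCast_zmod_val x] at h ⊢
  rw [map_natCast, Ne, ZMod.natCast_eq_zero_iff] at h
  exact isUnit_natCast_of_not_dvd Fact.out h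

lemma sum_teich_pow_of_not_dvd {p : ℕ} [Fact p.Prime] {M : ℕ} (h : ¬ (p - 1) ∣ M) :
    ∑ t : ZMod p, teich p t ^ M = 0 := by
  obtain ⟨g, hg⟩ := IsCyclic.exists_generator (α := (ZMod p)ˣ)
  have hM : (g : ZMod p) ^ M ≠ 1 := by
    intro h1
    apply h
    have h2 : g ^ M = 1 := by
      ext
      simpa using h1
    have h3 := orderOf_dvd_of_pow_eq_one h2
    rwa [orderOf_eq_card_of_forall_mem_zpowers hg, Nat.card_eq_fintype_card,
      ZMod.card_units] at h3
  have hu : IsUnit (teich p g ^ M - 1) := by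
    apply isUnit_of_castHom_ne_zero
    rw [map_sub, map_pow, castHom_teich, map_one]
    exact sub_ne_zero.mpr hM
  apply (hu.mul_right_eq_zero).mp
  rw [sub_mul, one_mul, Finset.mul_sum, sub_eq_zero]
  have := Equiv.sum_comp (Units.mulLeft g) (fun t : ZMod p => teich p t ^ M)
  rw [← this]
  refine Finset.sum_congr rfl fun t _ => ?_
  rw [← mul_pow, ← map_mul]
  rfl

lemma teich_pow_pred {p : ℕ} [Fact p.Prime] {a : ZMod p} (ha : a ≠ 0) :
    teich p a ^ (p - 1) = 1 := by
  rw [← map_pow, ZMod.pow_card_sub_one_eq_one ha, map_one]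

lemma sum_teich_pow_of_dvd {p : ℕ} [Fact p.Prime] {M : ℕ} (h : (p - 1) ∣ M) (hM : 0 < M) :
    ∑ t : ZMod p, teich p t ^ M = p - 1 := by
  obtain ⟨c, rfl⟩ := h
  have h1 : ∀ t : ZMod p, teich p t ^ ((p - 1) * c) = 1 - if t = 0 then 1 else 0 := by
    intro t
    split_ifs with ht
    · rw [ht, teich_zero, zero_pow hM.ne']
      simp
    · rw [pow_mul, teich_pow_pred ht]
      simp
  rw [Finset.sum_congr rfl fun t _ => h1 t]
  simp [ZMod.card]

/-- An alternating sum of binomial coefficients weighted by reciprocals. -/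
def harmBinom (p N c : ℕ) : ZMod (p ^ 2) :=
  ∑ i ∈ Finset.range c,
    (-1) ^ i * (N.choose (c - 1 - i) : ZMod (p ^ 2)) * ((i + 1 : ℕ) : ZMod (p ^ 2))⁻¹

lemma harmBinom_succ_succ (p N c : ℕ) :
    harmBinom p (N + 1) (c + 1) = harmBinom p N (c + 1) + harmBinom p N c := by
  unfold harmBinom
  rw [Finset.sum_range_succ, Finset.sum_range_succ _ c]
  have h : ∀ i ∈ Finset.range c,
      (-1) ^ i * ((N + 1).choose (c + 1 - 1 - i) : ZMod (p ^ 2)) *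
        ((i + 1 : ℕ) : ZMod (p ^ 2))⁻¹ =
      (-1) ^ i * (N.choose (c + 1 - 1 - i) : ZMod (p ^ 2)) * ((i + 1 : ℕ) : ZMod (p ^ 2))⁻¹ +
      (-1) ^ i * (N.choose (c - 1 - i) : ZMod (p ^ 2)) * ((i + 1 : ℕ) : ZMod (p ^ 2))⁻¹ := by
    intro i hi
    rw [Finset.mem_range] at hi
    rw [show c + 1 - 1 - i = c - 1 - i + 1 by omega, Nat.choose_succ_succ, Nat.cast_add]
    ring
  rw [Finset.sum_congr rfl h, Finset.sum_add_distrib, show c + 1 - 1 - c = 0 by omega]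
  simp only [Nat.choose_zero_right]
  ring

lemma harmBinom_self_succ {p N : ℕ} (hp : p.Prime) (hN : N + 1 < p) :
    harmBinom p N (N + 1) = ((N + 1 : ℕ) : ZMod (p ^ 2))⁻¹ := by
  have hu := isUnit_natCast_of_not_dvd hp (not_dvd_succ_of_lt hN)
  apply hu.mul_left_cancel
  rw [natCast_mul_inv_of_not_dvd hp (not_dvd_succ_of_lt hN), harmBinom, Finset.mul_sum]
  have h : ∀ i ∈ Finset.range (N + 1), ((N + 1 : ℕ) : ZMod (p ^ 2)) *
      ((-1) ^ i * (N.choose (N + 1 - 1 - i) : ZMod (p ^ 2)) *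
        ((i + 1 : ℕ) : ZMod (p ^ 2))⁻¹) =
      (-1) ^ i * ((N + 1).choose (i + 1) : ZMod (p ^ 2)) := by
    intro i hi
    rw [Finset.mem_range] at hi
    rw [show N + 1 - 1 - i = N - i by omega, Nat.choose_symm (by omega)]
    have h1 := congrArg (Nat.cast : ℕ → ZMod (p ^ 2)) (Nat.add_one_mul_choose_eq N i)
    rw [Nat.cast_mul, Nat.cast_mul] at h1
    have h2 := natCast_mul_inv_of_not_dvd hp
      (not_dvd_succ_of_lt (show i + 1 < p by omega))
    linear_combination (-1) ^ i * ((i + 1 : ℕ) : ZMod (p ^ 2))⁻¹ * h1 +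
      (-1) ^ i * ((N + 1).choose (i + 1) : ZMod (p ^ 2)) * h2
  rw [Finset.sum_congr rfl h]
  have h3 := congrArg (Int.cast : ℤ → ZMod (p ^ 2))
    (Int.alternating_sum_range_choose (n := N + 1))
  rw [Finset.sum_range_succ', if_neg (Nat.succ_ne_zero N)] at h3
  push_cast at h3
  have h4 : ∑ i ∈ Finset.range (N + 1), (-1 : ZMod (p ^ 2)) ^ (i + 1) *
      ((N + 1).choose (i + 1) : ZMod (p ^ 2)) =
      -∑ i ∈ Finset.range (N + 1), (-1 : ZMod (p ^ 2)) ^ i *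
      ((N + 1).choose (i + 1) : ZMod (p ^ 2)) := by
    rw [← Finset.sum_neg_distrib]
    refine Finset.sum_congr rfl fun i _ => ?_
    ring
  rw [h4] at h3
  simp only [Nat.choose_zero_right, Nat.cast_one, mul_one] at h3
  linear_combination -h3

lemma harmBinom_eq {p N c : ℕ} (hp : p.Prime) (hN : N < p) (hc : c ≤ N) :
    harmBinom p N c = N.choose c * (harm p N - harm p (N - c)) := by
  induction N generalizing c with
  | zero =>
    obtain rfl : c = 0 := by omega
    simp [harmBinom]
  | succ N ih =>
    rcases c with _ | c
    · simp [harmBinom]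
    rw [harmBinom_succ_succ]
    have hcN : c ≤ N := by omega
    rcases hcN.eq_or_lt with rfl | h
    · rw [harmBinom_self_succ hp hN, ih (by omega) le_rfl, harm_succ]
      simp [harm]
      ring
    · rw [ih (by omega) hcN, ih (by omega) (show c + 1 ≤ N from h), harm_succ,
        show N + 1 - (c + 1) = N - (c + 1) + 1 by omega,
        show N - c = N - (c + 1) + 1 by omega, harm_succ]
      have h1 := natCast_mul_inv_of_not_dvd hp (not_dvd_succ_of_lt hN)
      have h2 := natCast_mul_inv_of_not_dvd hp
        (not_dvd_succ_of_lt (show N - (c + 1) + 1 < p by omega))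
      have h3 : ((N + 1).choose (c + 1) : ZMod (p ^ 2)) * ((N - (c + 1) + 1 : ℕ) : ZMod (p ^ 2)) =
          N.choose (c + 1) * ((N + 1 : ℕ) : ZMod (p ^ 2)) := by
        have := Nat.choose_mul_succ_eq N (c + 1)
        rw [show N + 1 - (c + 1) = N - (c + 1) + 1 by omega] at this
        exact_mod_cast congrArg (Nat.cast : ℕ → ZMod (p ^ 2)) this.symm
      have h4 : ((N + 1).choose (c + 1) : ZMod (p ^ 2)) = N.choose c + N.choose (c + 1) := by
        rw [Nat.choose_succ_succ, Nat.cast_add]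
      generalize ((N + 1 : ℕ) : ZMod (p ^ 2)) = a at *
      generalize ((N - (c + 1) + 1 : ℕ) : ZMod (p ^ 2)) = b at *
      generalize a⁻¹ = a' at *
      generalize b⁻¹ = b' at *
      generalize harm p N = x at *
      generalize harm p (N - (c + 1)) = y at *
      generalize ((N + 1).choose (c + 1) : ZMod (p ^ 2)) = C at *
      generalize (N.choose (c + 1) : ZMod (p ^ 2)) = C1 at *
      generalize (N.choose c : ZMod (p ^ 2)) = C0 at *
      linear_combination (-x + y + b') * h4 + C * a' * h2 - C1 * b' * h1 - a' * b' * h3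

lemma natCast_mul_choose_pred {p r : ℕ} (hp : p.Prime) (hr : r < p) :
    (p : ZMod (p ^ 2)) * ((p - 1).choose r : ZMod (p ^ 2)) = (-1) ^ r * p := by
  induction r with
  | zero => simp
  | succ r ih =>
    have h := ih (by omega)
    obtain ⟨c, hc⟩ := hp.dvd_choose_self (Nat.succ_ne_zero r) hr
    have h1 : p.choose (r + 1) = (p - 1).choose r + (p - 1).choose (r + 1) := by
      rw [← Nat.choose_succ_succ, show (p - 1).succ = p from Nat.succ_pred hp.ne_zero]
    have h2 := congrArg (Nat.cast : ℕ → ZMod (p ^ 2)) (h1.symm.trans hc)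
    rw [Nat.cast_add, Nat.cast_mul] at h2
    rw [pow_succ (-1 : ZMod (p ^ 2)) r]
    linear_combination (p : ZMod (p ^ 2)) * h2 - h + c * natCast_mul_self_eq_zero p

lemma one_sub_pow_eq {p : ℕ} (hp : p.Prime) (hp3 : 3 < p) (s : ZMod (p ^ 2)) :
    (1 - s) ^ p = 1 - s ^ p -
      p * ∑ r ∈ Finset.range (p - 1), ((r + 1 : ℕ) : ZMod (p ^ 2))⁻¹ * s ^ (r + 1) := by
  rw [sub_eq_neg_add, add_pow, Finset.sum_range_succ]
  have hr : Finset.range p = Finset.range (p - 1 + 1) := by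
    rw [Nat.sub_add_cancel hp.one_le]
  rw [hr, Finset.sum_range_succ', Finset.mul_sum]
  have hodd : Odd p := hp.odd_of_ne_two (by omega)
  rw [hodd.neg_pow]
  have h : ∀ r ∈ Finset.range (p - 1), (-s) ^ (r + 1) * 1 ^ (p - (r + 1)) *
      (p.choose (r + 1) : ZMod (p ^ 2)) =
      -(p * (((r + 1 : ℕ) : ZMod (p ^ 2))⁻¹ * s ^ (r + 1))) := by
    intro r hr
    rw [Finset.mem_range] at hr
    have h1 : (p.choose (r + 1) : ZMod (p ^ 2)) * ((r + 1 : ℕ) : ZMod (p ^ 2)) = (-1) ^ r * p := by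
      rw [← natCast_mul_choose_pred hp (show r < p by omega)]
      have := Nat.add_one_mul_choose_eq (p - 1) r
      rw [Nat.sub_add_cancel hp.one_le] at this
      exact_mod_cast congrArg (Nat.cast : ℕ → ZMod (p ^ 2)) this.symm
    have h2 := natCast_mul_inv_of_not_dvd hp (not_dvd_succ_of_lt (show r + 1 < p by omega))
    have h3 : ((-1 : ZMod (p ^ 2)) ^ r) ^ 2 = 1 := by rw [← pow_mul, mul_comm, pow_mul]; simp
    rw [neg_pow, one_pow, pow_succ (-1 : ZMod (p ^ 2)) r]
    generalize ((r + 1 : ℕ) : ZMod (p ^ 2)) = a at *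
    generalize a⁻¹ = a' at *
    linear_combination (-(-1) ^ r * s ^ (r + 1) * a') * h1 +
      (-1) ^ r * s ^ (r + 1) * (p.choose (r + 1) : ZMod (p ^ 2)) * h2 - p * a' * s ^ (r + 1) * h3
  rw [Finset.sum_congr rfl h, Finset.sum_neg_distrib]
  simp
  ring

lemma add_pow_succ_of_mul_self_eq_zero {R : Type*} [CommRing R] {w : R} (hw : w * w = 0) (y : R)
    (j : ℕ) : (y + w) ^ (j + 1) = y ^ (j + 1) + (j + 1) * y ^ j * w := by
  induction j with
  | zero => simp
  | succ j ih =>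
    rw [pow_succ, ih]
    push_cast
    linear_combination (j + 1) * y ^ j * hw

/-- The Jacobi sum modulo `p²` attached to the powers `a`, `b` of the Teichmüller character. -/
def teichJacobi (p : ℕ) [Fact p.Prime] (a b : ℕ) : ZMod (p ^ 2) :=
  ∑ t : ZMod p, teich p t ^ a * teich p (1 - t) ^ b

lemma sum_teich_pow_mul_one_sub_pow (p : ℕ) [Fact p.Prime] (a b : ℕ) :
    ∑ t : ZMod p, teich p t ^ a * (1 - teich p t) ^ b =
      ∑ q ∈ Finset.range (b + 1), (-1) ^ q * (b.choose q : ZMod (p ^ 2)) *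
        ∑ t : ZMod p, teich p t ^ (a + q) := by
  simp_rw [Finset.mul_sum]
  rw [Finset.sum_comm]
  refine Finset.sum_congr rfl fun t _ => ?_
  rw [sub_eq_neg_add, add_pow, Finset.mul_sum]
  refine Finset.sum_congr rfl fun q _ => ?_
  rw [one_pow, neg_pow, pow_add]
  ring

lemma teichJacobi_succ {p : ℕ} [hp : Fact p.Prime] (hp3 : 3 < p) (a j : ℕ) :
    teichJacobi p a (j + 1) = ∑ t : ZMod p, teich p t ^ a * (1 - teich p t) ^ (j + 1) -
      (j + 1) * ∑ q ∈ Finset.range (j + 1), (-1) ^ q * (j.choose q : ZMod (p ^ 2)) *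
        ∑ r ∈ Finset.range (p - 1), ((r + 1 : ℕ) : ZMod (p ^ 2))⁻¹ *
          (p * ∑ t : ZMod p, teich p t ^ (a + (r + 1) + q)) := by
  have hpp := natCast_mul_self_eq_zero p
  have h1 : ∀ t : ZMod p, teich p t ^ a * teich p (1 - t) ^ (j + 1) =
      teich p t ^ a * (1 - teich p t) ^ (j + 1) - (j + 1) *
        ∑ r ∈ Finset.range (p - 1), ((r + 1 : ℕ) : ZMod (p ^ 2))⁻¹ * p *
          (teich p t ^ (a + (r + 1)) * (1 - teich p t) ^ j) := by
    intro t
    have hs : ∑ r ∈ Finset.range (p - 1), ((r + 1 : ℕ) : ZMod (p ^ 2))⁻¹ * p *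
          (teich p t ^ (a + (r + 1)) * (1 - teich p t) ^ j) =
        teich p t ^ a * (1 - teich p t) ^ j * p *
          ∑ r ∈ Finset.range (p - 1), ((r + 1 : ℕ) : ZMod (p ^ 2))⁻¹ * teich p t ^ (r + 1) := by
      rw [Finset.mul_sum]
      refine Finset.sum_congr rfl fun r _ => ?_
      rw [pow_add]
      ring
    rw [hs, teich_one_sub, one_sub_pow_eq hp.out hp3, teich_pow_card]
    generalize ∑ r ∈ Finset.range (p - 1),
      ((r + 1 : ℕ) : ZMod (p ^ 2))⁻¹ * teich p t ^ (r + 1) = T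
    rw [sub_eq_add_neg _ ((p : ZMod (p ^ 2)) * T),
      add_pow_succ_of_mul_self_eq_zero (by linear_combination T ^ 2 * hpp)]
    ring
  rw [teichJacobi, Finset.sum_congr rfl fun t _ => h1 t, Finset.sum_sub_distrib,
    ← Finset.mul_sum, Finset.sum_comm]
  congr 2
  simp_rw [← Finset.mul_sum, sum_teich_pow_mul_one_sub_pow]
  simp_rw [Finset.mul_sum]
  rw [Finset.sum_comm]
  refine Finset.sum_congr rfl fun q _ => Finset.sum_congr rfl fun r _ =>
    Finset.sum_congr rfl fun t _ => ?_
  ring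

lemma sum_inv_mul_sum_teich_of_lt {p m q : ℕ} [hp : Fact p.Prime] (hm : p = 6 * m + 1)
    (hq : q < 2 * m) :
    ∑ r ∈ Finset.range (p - 1), ((r + 1 : ℕ) : ZMod (p ^ 2))⁻¹ *
          (p * ∑ t : ZMod p, teich p t ^ (4 * m + (r + 1) + q)) =
      -(p * ((2 * m - q : ℕ) : ZMod (p ^ 2))⁻¹) := by
  have hmem : 2 * m - q - 1 ∈ Finset.range (p - 1) := Finset.mem_range.mpr (by omega)
  rw [Finset.sum_eq_single_of_mem _ hmem]
  · rw [sum_teich_pow_of_dvd ⟨1, by omega⟩ (by omega), show 2 * m - q - 1 + 1 = 2 * m - q by omega]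
    linear_combination ((2 * m - q : ℕ) : ZMod (p ^ 2))⁻¹ * natCast_mul_self_eq_zero p
  · intro r hr hne
    rw [Finset.mem_range] at hr
    rw [sum_teich_pow_of_not_dvd, mul_zero, mul_zero]
    rintro ⟨c, hc⟩
    rw [show p - 1 = 6 * m by omega] at hc
    rcases c with _ | _ | c
    · omega
    · omega
    · have : 6 * m * (c + 1 + 1) = 6 * m * c + 12 * m := by ring
      have : 0 ≤ 6 * m * c := Nat.zero_le _
      omega

lemma sum_inv_mul_sum_teich_add {p m q : ℕ} [hp : Fact p.Prime] (hm : p = 6 * m + 1)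
    (hq : q < m) :
    ∑ r ∈ Finset.range (p - 1), ((r + 1 : ℕ) : ZMod (p ^ 2))⁻¹ *
          (p * ∑ t : ZMod p, teich p t ^ (4 * m + (r + 1) + (2 * m + q))) =
      p * ((q + 1 : ℕ) : ZMod (p ^ 2))⁻¹ := by
  have hmem : 6 * m - q - 1 ∈ Finset.range (p - 1) := Finset.mem_range.mpr (by omega)
  rw [Finset.sum_eq_single_of_mem _ hmem]
  · rw [sum_teich_pow_of_dvd ⟨2, by omega⟩ (by omega)]
    have h1 := natCast_mul_inv_of_not_dvd hp.out
      (not_dvd_succ_of_lt (show 6 * m - q - 1 + 1 < p by omega))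
    have h2 := natCast_mul_inv_of_not_dvd hp.out (not_dvd_succ_of_lt (show q + 1 < p by omega))
    have h3 : ((6 * m - q - 1 + 1 : ℕ) : ZMod (p ^ 2)) + ((q + 1 : ℕ) : ZMod (p ^ 2)) = p := by
      rw [← Nat.cast_add]
      congr 1
      omega
    have hpp := natCast_mul_self_eq_zero p
    generalize ((6 * m - q - 1 + 1 : ℕ) : ZMod (p ^ 2)) = a at *
    generalize ((q + 1 : ℕ) : ZMod (p ^ 2)) = b at *
    generalize a⁻¹ = a' at *
    generalize b⁻¹ = b' at *
    linear_combination p * b' * h1 + p * a' * h2 - p * a' * b' * h3 + (a' - a' * b') * hpp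
  · intro r hr hne
    rw [Finset.mem_range] at hr
    rw [sum_teich_pow_of_not_dvd, mul_zero, mul_zero]
    rintro ⟨c, hc⟩
    rw [show p - 1 = 6 * m by omega] at hc
    rcases c with _ | _ | _ | c
    · omega
    · omega
    · omega
    · have : 6 * m * (c + 1 + 1 + 1) = 6 * m * c + 18 * m := by ring
      have : 0 ≤ 6 * m * c := Nat.zero_le _
      omega

lemma teichJacobi_eq_harmBinom {p m j : ℕ} [hp : Fact p.Prime] (hp3 : 3 < p) (hm : p = 6 * m + 1)
    (hj : 3 * m = j + 1) :
    teichJacobi p (4 * m) (3 * m) = (p - 1) * ((3 * m).choose m : ZMod (p ^ 2)) -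
      3 * m * p * (harmBinom p j (2 * m) + harmBinom p j m) := by
  have hjc : (j + 1 : ZMod (p ^ 2)) = 3 * m := by
    exact_mod_cast congrArg (Nat.cast : ℕ → ZMod (p ^ 2)) hj.symm
  have hfirst : ∑ t : ZMod p, teich p t ^ (4 * m) * (1 - teich p t) ^ (3 * m) =
      (p - 1) * ((3 * m).choose m : ZMod (p ^ 2)) := by
    rw [sum_teich_pow_mul_one_sub_pow]
    have hmem : 2 * m ∈ Finset.range (3 * m + 1) := Finset.mem_range.mpr (by omega)
    rw [Finset.sum_eq_single_of_mem _ hmem]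
    · rw [sum_teich_pow_of_dvd ⟨1, by omega⟩ (by omega), pow_mul,
        Nat.choose_symm_of_eq_add (show 3 * m = 2 * m + m by ring)]
      simp
      ring
    · intro q hq hne
      rw [Finset.mem_range] at hq
      rw [sum_teich_pow_of_not_dvd, mul_zero]
      rintro ⟨c, hc⟩
      rw [show p - 1 = 6 * m by omega] at hc
      rcases c with _ | _ | c
      · omega
      · omega
      · have : 6 * m * (c + 1 + 1) = 6 * m * c + 12 * m := by ring
        have : 0 ≤ 6 * m * c := Nat.zero_le _
        omega
  have hr : Finset.range (j + 1) = Finset.range (2 * m + m) := by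
    rw [← hj]
    congr 1
    ring
  have h := teichJacobi_succ hp3 (4 * m) j
  rw [← hj, hfirst, hj, hr, Finset.sum_range_add, hjc, ← hj] at h
  rw [h, sub_right_inj, mul_assoc (3 * (m : ZMod (p ^ 2))) (p : ZMod (p ^ 2))]
  congr 1
  rw [mul_add]
  congr 1
  · rw [← Finset.sum_range_reflect, harmBinom, Finset.mul_sum]
    refine Finset.sum_congr rfl fun i hi => ?_
    rw [Finset.mem_range] at hi
    rw [sum_inv_mul_sum_teich_of_lt hm (by omega),
      show 2 * m - (2 * m - 1 - i) = i + 1 by omega]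
    have hs : (-1 : ZMod (p ^ 2)) ^ (2 * m - 1 - i) = -(-1) ^ i := by
      have h1 : (-1 : ZMod (p ^ 2)) ^ (2 * m - 1 - i) * ((-1) ^ i * (-1)) = 1 := by
        rw [← pow_succ, ← pow_add, show 2 * m - 1 - i + (i + 1) = 2 * m by omega, pow_mul]
        simp
      have h2 : ((-1 : ZMod (p ^ 2)) ^ i) ^ 2 = 1 := by rw [← pow_mul, mul_comm, pow_mul]; simp
      linear_combination (-(-1) ^ i) * h1 - (-1) ^ (2 * m - 1 - i) * h2
    rw [hs]
    ring
  · rw [harmBinom, Finset.mul_sum]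
    refine Finset.sum_congr rfl fun i hi => ?_
    rw [Finset.mem_range] at hi
    rw [sum_inv_mul_sum_teich_add hm hi,
      Nat.choose_symm_of_eq_add (show j = (2 * m + i) + (m - 1 - i) by omega), pow_add, pow_mul]
    simp
    ring

lemma teichJacobi_eq {p m : ℕ} [hp : Fact p.Prime] (hp3 : 3 < p) (hm : p = 6 * m + 1) :
    teichJacobi p (4 * m) (3 * m) = -((3 * m).choose m : ZMod (p ^ 2)) *
      (1 + p * m * (3 * harm p (3 * m) - harm p m - 2 * harm p (2 * m))) := by
  obtain ⟨j, hj⟩ : ∃ j, 3 * m = j + 1 := ⟨3 * m - 1, by omega⟩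
  obtain ⟨m', rfl⟩ : ∃ m', m = m' + 1 := ⟨m - 1, by omega⟩
  rw [teichJacobi_eq_harmBinom hp3 hm hj, harmBinom_eq hp.out (by omega) (by omega),
    harmBinom_eq hp.out (by omega) (by omega), show j - 2 * (m' + 1) = m' by omega,
    show j - (m' + 1) = 2 * m' + 1 by omega, hj, show 2 * (m' + 1) = 2 * m' + 1 + 1 by ring,
    harm_succ p j, harm_succ p m', harm_succ p (2 * m' + 1)]
  have i1 := natCast_mul_inv_of_not_dvd hp.out (not_dvd_succ_of_lt (show j + 1 < p by omega))
  have i2 := natCast_mul_inv_of_not_dvd hp.out (not_dvd_succ_of_lt (show m' + 1 < p by omega))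
  have i3 := natCast_mul_inv_of_not_dvd hp.out
    (not_dvd_succ_of_lt (show 2 * m' + 1 + 1 < p by omega))
  have c1 : (j + 1) * j.choose (2 * m' + 1 + 1) = (m' + 1) * (j + 1).choose (m' + 1) := by
    rw [mul_comm, Nat.choose_mul_succ_eq,
      ← Nat.choose_symm_of_eq_add (show j + 1 = (2 * m' + 1 + 1) + (m' + 1) by omega),
      show j + 1 - (2 * m' + 1 + 1) = m' + 1 by omega, mul_comm]
  have c2 : (j + 1) * j.choose (m' + 1) = (2 * m' + 1 + 1) * (j + 1).choose (m' + 1) := by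
    rw [mul_comm, Nat.choose_mul_succ_eq, show j + 1 - (m' + 1) = 2 * m' + 1 + 1 by omega,
      mul_comm]
  have d1 := congrArg (Nat.cast : ℕ → ZMod (p ^ 2)) c1
  have d2 := congrArg (Nat.cast : ℕ → ZMod (p ^ 2)) c2
  have d3 : ((j + 1 : ℕ) : ZMod (p ^ 2)) = 3 * ((m' + 1 : ℕ) : ZMod (p ^ 2)) := by
    exact_mod_cast congrArg (Nat.cast : ℕ → ZMod (p ^ 2)) hj.symm
  have d4 : ((2 * m' + 1 + 1 : ℕ) : ZMod (p ^ 2)) = 2 * ((m' + 1 : ℕ) : ZMod (p ^ 2)) := by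
    push_cast
    ring
  rw [Nat.cast_mul, Nat.cast_mul] at d1 d2
  rw [d3] at d1 d2 i1 ⊢
  rw [d4] at d2 i3 ⊢
  generalize ((m' + 1 : ℕ) : ZMod (p ^ 2)) = M at *
  generalize ((j + 1).choose (m' + 1) : ZMod (p ^ 2)) = C at *
  generalize (j.choose (m' + 1) : ZMod (p ^ 2)) = C1 at *
  generalize (j.choose (2 * m' + 1 + 1) : ZMod (p ^ 2)) = C2 at *
  generalize (3 * M)⁻¹ = a at *
  generalize (2 * M)⁻¹ = b at *
  generalize M⁻¹ = c at *
  generalize harm p j = x at *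
  generalize harm p m' = y at *
  generalize harm p (2 * m' + 1) = z at *
  linear_combination (-p * (x - y)) * d1 - p * (x - z) * d2 + p * C * i1 - p * C * i2 - p * C * i3

lemma dombSum_eq_teichJacobi_sq {p m : ℕ} [hp : Fact p.Prime] (hp3 : 3 < p)
    (hm : p = 6 * m + 1) :
    dombSum p (3 * m) = teichJacobi p (4 * m) (3 * m) ^ 2 := by
  have h3 : ((3 : ℕ) : ZMod (p ^ 2)) * ((3 : ℕ) : ZMod (p ^ 2))⁻¹ = 1 :=
    natCast_mul_inv_of_not_dvd hp.out (Nat.not_dvd_of_pos_of_lt three_pos hp3)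
  rw [Nat.cast_ofNat] at h3
  have hS := dombSum_mul_factorial hp.out hm h3
  have hu : IsUnit ((((2 * m).factorial : ZMod (p ^ 2)) * (m.factorial : ZMod (p ^ 2))) ^ 2) :=
    ((isUnit_factorial hp.out (by omega)).mul (isUnit_factorial hp.out (by omega))).pow 2
  have hC : ((3 * m).choose m : ZMod (p ^ 2)) * (m.factorial * (2 * m).factorial) =
      (3 * m).factorial := by
    have := Nat.choose_mul_factorial_mul_factorial (show m ≤ 3 * m by omega)
    rw [show 3 * m - m = 2 * m by omega, mul_assoc] at this
    exact_mod_cast congrArg (Nat.cast : ℕ → ZMod (p ^ 2)) this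
  have hpp := natCast_mul_self_eq_zero p
  have hpm : (p : ZMod (p ^ 2)) = 6 * m + 1 := by
    exact_mod_cast congrArg (Nat.cast : ℕ → ZMod (p ^ 2)) hm
  apply hu.mul_right_cancel
  rw [hS, teichJacobi_eq hp3 hm, ← hC]
  generalize (3 : ZMod (p ^ 2))⁻¹ = t at *
  clear hS hC hu
  generalize harm p m = x at *
  generalize harm p (2 * m) = y at *
  generalize harm p (3 * m) = z at *
  generalize ((3 * m).choose m : ZMod (p ^ 2)) = C at *
  generalize ((2 * m).factorial : ZMod (p ^ 2)) = M at *
  generalize (m.factorial : ZMod (p ^ 2)) = N at *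
  have h2 : 2 * (p : ZMod (p ^ 2)) * m = -(p * t) := by
    linear_combination (-2 * p * m) * h3 - p * t * hpm + t * hpp
  linear_combination (-C ^ 2 * M ^ 2 * N ^ 2 * (3 * z - x - 2 * y)) * h2 -
    C ^ 2 * M ^ 2 * N ^ 2 * m ^ 2 * (3 * z - x - 2 * y) ^ 2 * hpp

/-- The sum of the quadratic character of `1 - t` over all `t` with `t ^ k = c`. -/
def quadSum (p : ℕ) [Fact p.Prime] (k : ℕ) (c : ZMod p) : ℤ :=
  ∑ t : ZMod p with t ^ k = c, quadraticChar (ZMod p) (1 - t)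

lemma pow_eq_one_or_eq_or_eq_sq {p m : ℕ} [Fact p.Prime] (hm : p = 6 * m + 1) {w : ZMod p}
    (hw : w ^ 2 + w + 1 = 0) {t : ZMod p} (ht : t ≠ 0) :
    t ^ (4 * m) = 1 ∨ t ^ (4 * m) = w ∨ t ^ (4 * m) = w ^ 2 := by
  have h1 : (t ^ (4 * m)) ^ 3 = 1 := by
    rw [← pow_mul, show 4 * m * 3 = (p - 1) * 2 by omega, pow_mul,
      ZMod.pow_card_sub_one_eq_one ht, one_pow]
  generalize t ^ (4 * m) = s at *
  have h2 : (s - 1) * ((s - w) * (s - w ^ 2)) = 0 := by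
    linear_combination h1 + (s - s ^ 2 + (s - 1) * (w - 1)) * hw
  rcases mul_eq_zero.mp h2 with h | h
  · exact Or.inl (sub_eq_zero.mp h)
  rcases mul_eq_zero.mp h with h | h
  · exact Or.inr (Or.inl (sub_eq_zero.mp h))
  · exact Or.inr (Or.inr (sub_eq_zero.mp h))

lemma ne_one_of_sq_add_self_add_one {p : ℕ} [hp : Fact p.Prime] (hp3 : 3 < p) {w : ZMod p}
    (hw : w ^ 2 + w + 1 = 0) : w ≠ 1 := by
  rintro rfl
  have : ((3 : ℕ) : ZMod p) = 0 := by
    push_cast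
    linear_combination hw
  rw [ZMod.natCast_eq_zero_iff] at this
  exact absurd (Nat.le_of_dvd three_pos this) (by omega)

lemma sum_mul_quadraticChar_one_sub {p m : ℕ} [Fact p.Prime] (hp3 : 3 < p) (hm : p = 6 * m + 1)
    {w : ZMod p} (hw : w ^ 2 + w + 1 = 0) {S : Type*} [CommRing S] (z : S) (f : ZMod p → S)
    (h0 : f 0 = 0) (h1 : ∀ t, t ^ (4 * m) = 1 → f t = 1) (h2 : ∀ t, t ^ (4 * m) = w → f t = z)
    (h3 : ∀ t, t ^ (4 * m) = w ^ 2 → f t = z ^ 2) :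
    ∑ t : ZMod p, f t * ((quadraticChar (ZMod p) (1 - t) : ℤ) : S) =
      quadSum p (4 * m) 1 + quadSum p (4 * m) w * z + quadSum p (4 * m) (w ^ 2) * z ^ 2 := by
  have hw1 := ne_one_of_sq_add_self_add_one hp3 hw
  have hw0 : w ≠ 0 := by
    rintro rfl
    simp at hw
  have hw2 : w ^ 2 ≠ w := fun h => hw1 (mul_left_cancel₀ hw0 (by linear_combination h))
  have hw21 : w ^ 2 ≠ 1 := fun h => hw1 (by
    have h4 : (w - 1) * (w ^ 2 + w + 1) = 0 := by rw [hw, mul_zero]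
    have h5 : w * (w ^ 2) = 1 := by linear_combination h4
    rwa [h, mul_one] at h5)
  have key : ∀ t : ZMod p, f t * ((quadraticChar (ZMod p) (1 - t) : ℤ) : S) =
      (if t ^ (4 * m) = 1 then ((quadraticChar (ZMod p) (1 - t) : ℤ) : S) else 0) +
      (if t ^ (4 * m) = w then ((quadraticChar (ZMod p) (1 - t) : ℤ) : S) else 0) * z +
      (if t ^ (4 * m) = w ^ 2 then ((quadraticChar (ZMod p) (1 - t) : ℤ) : S) else 0) * z ^ 2 := by
    intro t
    rcases eq_or_ne t 0 with rfl | ht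
    · rw [h0, zero_pow (by omega), if_neg zero_ne_one, if_neg hw0.symm,
        if_neg (pow_ne_zero 2 hw0).symm]
      ring
    rcases pow_eq_one_or_eq_or_eq_sq hm hw ht with h | h | h
    · rw [h1 t h, h, if_pos rfl, if_neg hw1.symm, if_neg hw21.symm]
      ring
    · rw [h2 t h, h, if_pos rfl, if_neg hw1, if_neg hw2.symm]
      ring
    · rw [h3 t h, h, if_pos rfl, if_neg hw21, if_neg hw2]
      ring
  rw [Finset.sum_congr rfl fun t _ => key t, Finset.sum_add_distrib, Finset.sum_add_distrib,
    ← Finset.sum_mul, ← Finset.sum_mul, ← Finset.sum_filter, ← Finset.sum_filter,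
    ← Finset.sum_filter]
  simp only [quadSum, Int.cast_sum]

lemma ringChar_zmod_ne_two {p : ℕ} (hp3 : 3 < p) : ringChar (ZMod p) ≠ 2 := by
  rw [ZMod.ringChar_zmod_n]
  omega

lemma teich_pow_eq_quadraticChar {p m : ℕ} [hp : Fact p.Prime] (hp3 : 3 < p) (hm : p = 6 * m + 1)
    (u : ZMod p) :
    teich p u ^ (3 * m) = ((quadraticChar (ZMod p) u : ℤ) : ZMod (p ^ 2)) := by
  have h1 := quadraticChar_eq_pow_of_char_ne_two' (ringChar_zmod_ne_two hp3) u
  rw [ZMod.card, show p / 2 = 3 * m by omega] at h1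
  rw [← map_pow, ← h1]
  rcases eq_or_ne u 0 with rfl | hu
  · simp [teich_zero]
  rcases quadraticChar_dichotomy hu with h | h
  · rw [h]
    simp
  · rw [h]
    have h2 := pow_eq_pow_of_castHom_eq (p := p)
      (x := (((-1 : ZMod p).val : ℕ) : ZMod (p ^ 2))) (y := -1) (by
        rw [map_natCast, ZMod.natCast_zmod_val, RingHom.map_neg, RingHom.map_one])
    change ((((-1 : ℤ) : ZMod p)).val : ZMod (p ^ 2)) ^ p = _
    rw [Int.cast_neg, Int.cast_one, h2, (hp.out.odd_of_ne_two (by omega)).neg_one_pow,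
      Int.cast_neg, Int.cast_one]

lemma teich_sq_add_self_add_one {p : ℕ} [hp : Fact p.Prime] (hp3 : 3 < p) {w : ZMod p}
    (hw : w ^ 2 + w + 1 = 0) : teich p w ^ 2 + teich p w + 1 = 0 := by
  have hu : IsUnit (teich p w - 1) := by
    apply isUnit_of_castHom_ne_zero
    rw [RingHom.map_sub, castHom_teich, RingHom.map_one]
    exact sub_ne_zero.mpr (ne_one_of_sq_add_self_add_one hp3 hw)
  apply hu.mul_right_eq_zero.mp
  have h3 : teich p w ^ 3 = 1 := by
    rw [← map_pow, show w ^ 3 = 1 by linear_combination (w - 1) * hw, map_one]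
  linear_combination h3

lemma teichJacobi_eq_quadSum {p m : ℕ} [hp : Fact p.Prime] (hp3 : 3 < p) (hm : p = 6 * m + 1)
    {w : ZMod p} (hw : w ^ 2 + w + 1 = 0) :
    teichJacobi p (4 * m) (3 * m) = quadSum p (4 * m) 1 + quadSum p (4 * m) w * teich p w +
      quadSum p (4 * m) (w ^ 2) * teich p w ^ 2 := by
  rw [← sum_mul_quadraticChar_one_sub hp3 hm hw (teich p w) (fun t => teich p t ^ (4 * m))]
  · exact Finset.sum_congr rfl fun t _ => by rw [teich_pow_eq_quadraticChar hp3 hm]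
  · rw [teich_zero, zero_pow (by omega)]
  · intro t ht
    rw [← map_pow, ht, map_one]
  · intro t ht
    rw [← map_pow, ht]
  · intro t ht
    rw [← map_pow, ht, map_pow]

lemma quadSum_add_add {p m : ℕ} [hp : Fact p.Prime] (hp3 : 3 < p) (hm : p = 6 * m + 1)
    {w : ZMod p} (hw : w ^ 2 + w + 1 = 0) :
    quadSum p (4 * m) 1 + quadSum p (4 * m) w + quadSum p (4 * m) (w ^ 2) = -1 := by
  have h := sum_mul_quadraticChar_one_sub hp3 hm hw (1 : ℤ) (fun t => if t = 0 then 0 else 1)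
    (if_pos rfl) ?_ ?_ ?_
  · have h1 : ∑ t : ZMod p, quadraticChar (ZMod p) (1 - t) = 0 := by
      rw [← quadraticChar_sum_zero (ringChar_zmod_ne_two hp3)]
      exact Equiv.sum_comp (Equiv.subLeft (1 : ZMod p)) _
    have h2 : ∀ t : ZMod p, (if t = 0 then (0 : ℤ) else 1) * ((quadraticChar (ZMod p) (1 - t) : ℤ)) =
        quadraticChar (ZMod p) (1 - t) - if t = 0 then 1 else 0 := by
      intro t
      split_ifs with ht
      · simp [ht]
      · simp
    simp only [Int.cast_id, mul_one, one_pow] at h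
    rw [← h, Finset.sum_congr rfl fun t _ => h2 t, Finset.sum_sub_distrib, h1]
    simp
  all_goals
    intro t ht
    have : t ≠ 0 := by
      rintro rfl
      rw [zero_pow (by omega)] at ht
      first
        | exact zero_ne_one ht
        | (subst ht; simp at hw)
        | (rw [pow_eq_zero_iff two_ne_zero |>.mp ht.symm] at hw; simp at hw)
    simp [this]

lemma exists_cubic_char {p m : ℕ} [hp : Fact p.Prime] (hp3 : 3 < p) (hm : p = 6 * m + 1) :
    ∃ (w : ZMod p) (ζ : ℂ) (χ : MulChar (ZMod p) ℂ), w ^ 2 + w + 1 = 0 ∧ ζ ^ 2 + ζ + 1 = 0 ∧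
      orderOf χ = 3 ∧ ∀ (t : ZMod p) (i : ℕ), t ^ (4 * m) = w ^ i → χ t = ζ ^ i := by
  obtain ⟨χ, hχ⟩ := MulChar.exists_mulChar_orderOf (ZMod p) (n := 3)
    (by rw [ZMod.card]; exact ⟨2 * m, by omega⟩) (Complex.isPrimitiveRoot_exp 3 three_ne_zero)
  obtain ⟨g, hg⟩ := IsCyclic.exists_generator (α := (ZMod p)ˣ)
  have hord : orderOf g = 6 * m := by
    rw [orderOf_eq_card_of_forall_mem_zpowers hg, Nat.card_eq_fintype_card, ZMod.card_units]
    omega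
  have hpow : ∀ u : (ZMod p)ˣ, ∃ k : ℕ, g ^ k = u := fun u =>
    (mem_powers_iff_mem_zpowers (x := g)).mpr (hg u)
  have hχ3 : χ ^ 3 = 1 := by rw [← hχ, pow_orderOf_eq_one]
  have hζ3 : χ g ^ 3 = 1 := by
    rw [← MulChar.pow_apply_coe, hχ3, MulChar.one_apply_coe]
  have hζ1 : χ g ≠ 1 := by
    intro h
    have : χ = 1 := by
      apply MulChar.ext
      intro u
      obtain ⟨k, rfl⟩ := hpow u
      rw [Units.val_pow_eq_pow_val, map_pow, h, one_pow, ← Units.val_pow_eq_pow_val,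
        MulChar.one_apply_coe]
    rw [this, orderOf_one] at hχ
    omega
  have hwu : g ^ (4 * m) ≠ 1 := by
    intro h
    have := orderOf_dvd_of_pow_eq_one h
    rw [hord] at this
    obtain ⟨c, hc⟩ := this
    have hm0 : 0 < m := by omega
    have : 4 = 6 * c := by
      apply Nat.eq_of_mul_eq_mul_right hm0
      rw [hc]
      ring
    omega
  have hw3 : ((g : ZMod p) ^ (4 * m)) ^ 3 = 1 := by
    rw [← pow_mul, show 4 * m * 3 = (p - 1) * 2 by omega, pow_mul,
      ZMod.pow_card_sub_one_eq_one g.ne_zero, one_pow]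
  have hw1 : (g : ZMod p) ^ (4 * m) ≠ 1 := fun h => hwu (by
    ext
    simpa using h)
  have hordw : orderOf (g ^ (4 * m)) = 3 := by
    refine orderOf_eq_prime ?_ hwu
    ext
    simpa using hw3
  refine ⟨g ^ (4 * m), χ g, χ, ?_, ?_, hχ, ?_⟩
  · apply (mul_right_inj' (sub_ne_zero.mpr hw1)).mp
    linear_combination hw3
  · apply (mul_right_inj' (sub_ne_zero.mpr hζ1)).mp
    linear_combination hζ3
  · intro t i ht
    have ht0 : t ≠ 0 := by
      rintro rfl
      rw [zero_pow (by omega)] at ht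
      exact pow_ne_zero _ (pow_ne_zero _ g.ne_zero) ht.symm
    obtain ⟨k, hk⟩ := hpow (Units.mk0 t ht0)
    have hk' : t = g ^ k := by
      rw [← Units.val_pow_eq_pow_val, hk, Units.val_mk0]
    rw [hk'] at ht ⊢
    have h1 : (g ^ (4 * m)) ^ k = (g ^ (4 * m)) ^ i := by
      ext
      rw [← pow_mul, mul_comm, pow_mul]
      simpa using ht
    rw [pow_eq_pow_iff_modEq, hordw] at h1
    rw [map_pow]
    exact pow_eq_pow_of_modEq h1 hζ3

lemma exists_quadSum_norm {p m : ℕ} [hp : Fact p.Prime] (hp3 : 3 < p) (hm : p = 6 * m + 1) :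
    ∃ w : ZMod p, w ^ 2 + w + 1 = 0 ∧
      (quadSum p (4 * m) 1 - quadSum p (4 * m) (w ^ 2)) ^ 2 -
        (quadSum p (4 * m) 1 - quadSum p (4 * m) (w ^ 2)) *
          (quadSum p (4 * m) w - quadSum p (4 * m) (w ^ 2)) +
        (quadSum p (4 * m) w - quadSum p (4 * m) (w ^ 2)) ^ 2 = p := by
  obtain ⟨w, ζ, χ, hw, hζ, hχ, h⟩ := exists_cubic_char hp3 hm
  refine ⟨w, hw, ?_⟩
  set ψ : MulChar (ZMod p) ℂ := (quadraticChar (ZMod p)).ringHomComp (Int.castRingHom ℂ) with hψ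
  have hψ2 : ψ ^ 2 = 1 := by
    rw [hψ, MulChar.ringHomComp_pow, (quadraticChar_isQuadratic (ZMod p)).sq_eq_one,
      MulChar.ringHomComp_one]
  have hψ1 : ψ ≠ 1 := by
    intro hh
    exact quadraticChar_ne_one (ringChar_zmod_ne_two hp3)
      ((MulChar.ringHomComp_eq_one_iff (RingHom.injective_int (Int.castRingHom ℂ))).mp hh)
  have hχ3 : χ ^ 3 = 1 := by rw [← hχ, pow_orderOf_eq_one]
  have hχ1 : χ ≠ 1 := by
    rintro rfl
    rw [orderOf_one] at hχ
    omega
  have hχψ : χ * ψ ≠ 1 := by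
    intro hh
    apply hψ1
    have h3 : ψ = (χ * ψ) ^ 3 := by rw [mul_pow, hχ3, one_mul, pow_succ, hψ2, one_mul]
    rw [h3, hh, one_pow]
  have hJ := jacobiSum_mul_jacobiSum_inv (F := ZMod p) (F' := ℂ) (by
    rw [ZMod.ringChar_zmod_n, ringChar.eq_zero]; omega) hχ1 hψ1 hχψ
  have hψi : ψ⁻¹ = ψ := inv_eq_of_mul_eq_one_left (by rw [← sq, hψ2])
  have hχi : χ⁻¹ = χ ^ 2 := inv_eq_of_mul_eq_one_left (by rw [← pow_succ, hχ3])
  have hζ3 : ζ ^ 3 = 1 := by linear_combination (ζ - 1) * hζ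
  have e1 : jacobiSum χ ψ = quadSum p (4 * m) 1 + quadSum p (4 * m) w * ζ +
      quadSum p (4 * m) (w ^ 2) * ζ ^ 2 := by
    rw [← sum_mul_quadraticChar_one_sub hp3 hm hw ζ χ (MulChar.map_zero χ)]
    · rfl
    · intro t ht
      simpa using h t 0 (by simpa using ht)
    · intro t ht
      simpa using h t 1 (by simpa using ht)
    · intro t ht
      exact h t 2 ht
  have e2 : jacobiSum (χ ^ 2) ψ = quadSum p (4 * m) 1 + quadSum p (4 * m) w * ζ ^ 2 +
      quadSum p (4 * m) (w ^ 2) * (ζ ^ 2) ^ 2 := by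
    have hs : ∀ t, (χ ^ 2) t = χ t ^ 2 := fun t => MulChar.pow_apply' χ two_ne_zero t
    rw [← sum_mul_quadraticChar_one_sub hp3 hm hw (ζ ^ 2) (fun t => (χ ^ 2) t)]
    · rfl
    · rw [hs, MulChar.map_zero]
      simp
    · intro t ht
      rw [hs, h t 0 (by simpa using ht)]
      simp
    · intro t ht
      rw [hs, h t 1 (by simpa using ht), pow_one]
    · intro t ht
      rw [hs, h t 2 ht]
  rw [hψi, hχi, e1, e2, ZMod.card] at hJ
  generalize quadSum p (4 * m) 1 = a at *
  generalize quadSum p (4 * m) w = b at *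
  generalize quadSum p (4 * m) (w ^ 2) = c at *
  have : (((a - c) ^ 2 - (a - c) * (b - c) + (b - c) ^ 2 : ℤ) : ℂ) = ((p : ℤ) : ℂ) := by
    push_cast
    rw [← hJ]
    have hz : ζ ^ 2 = -ζ - 1 := by linear_combination hζ
    have hz4 : (ζ ^ 2) ^ 2 = ζ := by linear_combination ζ * hζ3
    rw [hz4, hz]
    linear_combination (b ^ 2 + c ^ 2 - 2 * b * c) * hz
  exact_mod_cast this

lemma even_card_pow_eq_one {p m : ℕ} [hp : Fact p.Prime] (hp3 : 3 < p) (hm : 0 < m) :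
    (((Finset.univ.filter fun t : ZMod p => t ^ (4 * m) = 1).card : ℕ) : ZMod 2) = 0 := by
  rw [Finset.card_eq_sum_ones, Nat.cast_sum]
  refine Finset.sum_involution (fun t _ => -t) ?_ ?_ ?_ ?_
  · intro t _
    decide
  · intro t ht _ h
    have h2 : ((2 : ℕ) : ZMod p) * t = 0 := by
      push_cast
      linear_combination -h
    rcases mul_eq_zero.mp h2 with h3 | h3
    · rw [ZMod.natCast_eq_zero_iff] at h3
      exact absurd (Nat.le_of_dvd two_pos h3) (by omega)
    · rw [Finset.mem_filter, h3, zero_pow (by omega)] at ht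
      exact absurd ht.2 zero_ne_one
  · intro t ht
    rw [Finset.mem_filter] at ht ⊢
    exact ⟨Finset.mem_univ _, by
      rw [show 4 * m = 2 * (2 * m) by ring, pow_mul, neg_sq, ← pow_mul,
        show 2 * (2 * m) = 4 * m by ring]
      exact ht.2⟩
  · intro t _
    exact neg_neg t

lemma odd_quadSum_one {p m : ℕ} [hp : Fact p.Prime] (hp3 : 3 < p) (hm : p = 6 * m + 1) :
    ((quadSum p (4 * m) 1 : ℤ) : ZMod 2) = 1 := by
  have h1 : ∀ t : ZMod p, ((quadraticChar (ZMod p) (1 - t) : ℤ) : ZMod 2) =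
      1 - if t = 1 then 1 else 0 := by
    intro t
    split_ifs with ht
    · simp [ht]
    · rcases quadraticChar_dichotomy (sub_ne_zero.mpr (Ne.symm ht)) with h | h <;> rw [h] <;> decide
  rw [quadSum, Int.cast_sum, Finset.sum_congr rfl fun t _ => h1 t, Finset.sum_sub_distrib,
    Finset.sum_ite_eq', if_pos (by simp)]
  have := even_card_pow_eq_one (p := p) (m := m) hp3 (by omega)
  rw [Finset.card_eq_sum_ones, Nat.cast_sum, Nat.cast_one] at this
  rw [this]
  decide

lemma sq_eq_sq_of_eq_sq_add_three_mul_sq {p : ℕ} (hp : p.Prime) {x y a b : ℤ}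
    (h1 : (p : ℤ) = x ^ 2 + 3 * y ^ 2) (h2 : (p : ℤ) = a ^ 2 + 3 * b ^ 2) : x ^ 2 = a ^ 2 := by
  have hp0 : (0 : ℤ) < p := by exact_mod_cast hp.pos
  have main : ∀ b : ℤ, (p : ℤ) = a ^ 2 + 3 * b ^ 2 → (p : ℤ) ∣ x * b - y * a → x ^ 2 = a ^ 2 := by
    rintro b h2 ⟨c, hc⟩
    have h3 : (p : ℤ) ^ 2 = (x * a + 3 * y * b) ^ 2 + 3 * (x * b - y * a) ^ 2 := by
      rw [sq]
      nth_rewrite 1 [h1]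
      rw [h2]
      ring
    have hc0 : c = 0 := by
      by_contra hne
      have : 1 ≤ c ^ 2 := Int.add_one_le_iff.mpr (show 0 < c ^ 2 by positivity)
      rw [hc] at h3
      nlinarith [sq_nonneg (x * a + 3 * y * b), sq_nonneg (p : ℤ), mul_pos hp0 hp0]
    rw [hc0, mul_zero] at hc
    have h4 : (p : ℤ) * x ^ 2 = p * a ^ 2 := by
      linear_combination x ^ 2 * h2 - a ^ 2 * h1 + 3 * (x * b + y * a) * hc
    exact mul_left_cancel₀ hp0.ne' h4
  have h5 : (p : ℤ) ∣ (x * b - y * a) * (x * b + y * a) :=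
    ⟨b ^ 2 - y ^ 2, by linear_combination y ^ 2 * h2 - b ^ 2 * h1⟩
  rcases (Nat.prime_iff_prime_int.mp hp).dvd_or_dvd h5 with h | h
  · exact main b h2 h
  · refine main (-b) (by rw [h2]; ring) ?_
    rw [show x * -b - y * a = -(x * b + y * a) by ring]
    exact (dvd_neg).mpr h

lemma isUnit_teichJacobi {p m : ℕ} [hp : Fact p.Prime] (hp3 : 3 < p) (hm : p = 6 * m + 1) :
    IsUnit (teichJacobi p (4 * m) (3 * m)) := by
  rw [teichJacobi_eq hp3 hm]
  have hC : ((3 * m).choose m : ZMod (p ^ 2)) * (m.factorial * (2 * m).factorial) =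
      (3 * m).factorial := by
    have := Nat.choose_mul_factorial_mul_factorial (show m ≤ 3 * m by omega)
    rw [show 3 * m - m = 2 * m by omega, mul_assoc] at this
    exact_mod_cast congrArg (Nat.cast : ℕ → ZMod (p ^ 2)) this
  have hu : IsUnit ((3 * m).choose m : ZMod (p ^ 2)) := by
    have := isUnit_factorial hp.out (show 3 * m < p by omega)
    rw [← hC] at this
    exact isUnit_of_mul_isUnit_left this
  refine hu.neg.mul ?_
  generalize 3 * harm p (3 * m) - harm p m - 2 * harm p (2 * m) = h
  refine IsUnit.of_mul_eq_one (1 - p * m * h) ?_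
  linear_combination (-m ^ 2 * h ^ 2 : ZMod (p ^ 2)) * natCast_mul_self_eq_zero p

lemma intCast_four_mul_sq_sub {p m : ℕ} [hp : Fact p.Prime] (hp3 : 3 < p) (hm : p = 6 * m + 1)
    {x y : ℤ} (hxy : (p : ℤ) = x ^ 2 + 3 * y ^ 2) :
    ((4 * x ^ 2 - 2 * p : ℤ) : ZMod (p ^ 2)) = dombSum p (3 * m) := by
  obtain ⟨w, hw, hN⟩ := exists_quadSum_norm hp3 hm
  have hJu := isUnit_teichJacobi hp3 hm
  have hJ := teichJacobi_eq_quadSum hp3 hm hw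
  have hs := quadSum_add_add hp3 hm hw
  have hodd := odd_quadSum_one hp3 hm
  have hz := teich_sq_add_self_add_one hp3 hw
  rw [dombSum_eq_teichJacobi_sq hp3 hm]
  generalize teichJacobi p (4 * m) (3 * m) = J at *
  generalize quadSum p (4 * m) 1 = a at *
  generalize quadSum p (4 * m) w = b at *
  generalize quadSum p (4 * m) (w ^ 2) = c at *
  generalize teich p w = z at *
  have ha : ∃ e, a = 2 * e + 1 := by
    rw [← Int.cast_one, ZMod.intCast_eq_intCast_iff_dvd_sub] at hodd
    obtain ⟨d, hd⟩ := hodd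
    exact ⟨-d, by push_cast at hd; linarith⟩
  obtain ⟨e, he⟩ := ha
  have hc : c = -1 - a - b := by linarith
  have hev : ∃ f, b - c = 2 * f := by
    exact ⟨b + e + 1, by rw [hc, he]; ring⟩
  obtain ⟨f, hf⟩ := hev
  have hx : 4 * x ^ 2 = (2 * a - b - c) ^ 2 := by
    have := sq_eq_sq_of_eq_sq_add_three_mul_sq hp.out hxy
      (a := a - c - f) (b := f) (by rw [← hN, hf]; ring)
    rw [this]
    have : 2 * a - b - c = 2 * (a - c - f) := by linarith
    rw [this]
    ring
  have hz3 : z ^ 3 = 1 := by linear_combination (z - 1) * hz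
  have hN' : J * (a + b * z ^ 2 + c * z) = (p : ZMod (p ^ 2)) := by
    have := congrArg (Int.cast : ℤ → ZMod (p ^ 2)) hN
    push_cast at this
    rw [← this, hJ]
    linear_combination (a * b + a * c + b * c) * hz + (b ^ 2 + c ^ 2 + b * c * z) * hz3
  have hK : ((a : ZMod (p ^ 2)) + b * z ^ 2 + c * z) ^ 2 = 0 := by
    apply (hJu.pow 2).mul_right_eq_zero.mp
    rw [← mul_pow, hN']
    exact (sq _).trans (natCast_mul_self_eq_zero p)
  have hT : ((2 * a - b - c : ℤ) : ZMod (p ^ 2)) = J + (a + b * z ^ 2 + c * z) := by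
    push_cast
    rw [hJ]
    linear_combination (-b - c : ZMod (p ^ 2)) * hz
  rw [hx, Int.cast_sub, Int.cast_pow, hT]
  push_cast
  linear_combination 2 * hN' + hK

lemma pCong_div_pow {p : ℕ} (hp : p.Prime) (hp3 : 3 < p) {a b : ℤ}
    (h : (a : ZMod (p ^ 2)) = b) : pCong p 2 ((a : ℚ) / 16 ^ p) ((b : ℚ) / 16 ^ p) := by
  rw [eq_comm, ZMod.intCast_eq_intCast_iff_dvd_sub] at h
  obtain ⟨c, hc⟩ := h
  have hp0 : (p : ℚ) ≠ 0 := by exact_mod_cast hp.ne_zero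
  have h1 : ((a : ℚ) / 16 ^ p - (b : ℚ) / 16 ^ p) / (p : ℚ) ^ 2 = (c : ℚ) / ((16 ^ p : ℤ) : ℚ) := by
    have h2 : (a : ℚ) - b = p ^ 2 * c := by exact_mod_cast hc
    rw [← sub_div, h2]
    push_cast
    field_simp
  rw [pCong, h1, isPInt]
  intro h3
  have h4 : ((p : ℕ) : ℤ) ∣ 16 ^ p := (Int.natCast_dvd_natCast.mpr h3).trans (by
    have := Rat.den_dvd c (16 ^ p)
    rwa [Rat.divInt_eq_div] at this)
  have h5 : p ∣ 2 ^ (4 * p) := by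
    rw [pow_mul]
    exact_mod_cast h4
  have := Nat.le_of_dvd two_pos (hp.dvd_of_dvd_pow h5)
  omega

theorem stmt16 (p : ℕ) (hp : p.Prime) (hp3 : 3 < p) :
    (p % 3 = 1 → ∀ x y : ℤ, (p : ℤ) = x ^ 2 + 3 * y ^ 2 →
      pCong p 2 (∑ n ∈ Finset.range p, (domb n : ℚ) / 16 ^ n)
        (∑ n ∈ Finset.range p, (domb n : ℚ) / 4 ^ n) ∧
      pCong p 2 (∑ n ∈ Finset.range p, (domb n : ℚ) / 4 ^ n)
        (4 * (x : ℚ) ^ 2 - 2 * (p : ℚ))) ∧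
    (p % 3 = 2 →
      pCong p 2 (∑ n ∈ Finset.range p, (domb n : ℚ) / 16 ^ n)
        (∑ n ∈ Finset.range p, (domb n : ℚ) / 4 ^ n) ∧
      pCong p 2 (∑ n ∈ Finset.range p, (domb n : ℚ) / 4 ^ n) 0) := by
  have := Fact.mk hp
  obtain ⟨n, hn⟩ := hp.odd_of_ne_two (by omega)
  obtain ⟨a, ha, ha'⟩ := dombSum_eq_sixteen hp hp3 hn
  obtain ⟨b, hb, hb'⟩ := dombSum_eq_four hp hp3 hn
  rw [ha, hb]
  have hab := pCong_div_pow hp hp3 (ha'.trans hb'.symm)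
  have h16 : (16 : ℚ) ^ p ≠ 0 := by positivity
  constructor
  · intro h1 x y hxy
    refine ⟨hab, ?_⟩
    obtain ⟨m, rfl⟩ : ∃ m, n = 3 * m := ⟨n / 3, by omega⟩
    have h2 := intCast_four_mul_sq_sub hp3 (show p = 6 * m + 1 by omega) hxy
    have h3 : (4 * (x : ℚ) ^ 2 - 2 * p) = ((16 ^ p * (4 * x ^ 2 - 2 * p) : ℤ) : ℚ) / 16 ^ p := by
      push_cast
      field_simp
    rw [h3]
    refine pCong_div_pow hp hp3 ?_
    rw [hb', ← h2]
    push_cast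
    ring
  · intro h2
    refine ⟨hab, ?_⟩
    have h3 : (0 : ℚ) = ((0 : ℤ) : ℚ) / 16 ^ p := by simp
    rw [h3]
    refine pCong_div_pow hp hp3 ?_
    rw [hb', dombSum_eq_zero hp hp3 hn h2, mul_zero, Int.cast_zero]
end
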